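/- There is an absolute constant c > 0 such that in every topological graph G with n vertices and m ≥ 4n edges, there are two disjoint sets of edges E₁ and E₂, each of cardinality at least m²/(n²·(log₂(m/n))^c), such that every edge in E₁ crosses every edge in E₂. -/

import Mathlib

/-- A topological graph: a simple graph drawn in the plane. Vertices are represented by
distinct points, and each edge `uv` is represented by a curve connecting the point of `u`
to the point of `v` that passes through no point representing a vertex other than its two
endpoints. -/
structure TopologicalGraph (V : Type*) where
  /-- The underlying abstract simple graph. -/
  G : SimpleGraph V
  /-- The point representing each vertex. -/
  pos : V → ℝ × ℝ
  pos_inj : Function.Injective pos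
  /-- The curve representing each edge (symmetric in the two endpoints). -/
  arc : V → V → Set (ℝ × ℝ)
  arc_symm : ∀ u v, arc u v = arc v u
  arc_spec : ∀ u v, G.Adj u v → ∃ f : ℝ → ℝ × ℝ,
    ContinuousOn f (Set.Icc 0 1) ∧ f 0 = pos u ∧ f 1 = pos v ∧
      arc u v = f '' Set.Icc 0 1
  arc_avoid : ∀ u v, G.Adj u v → ∀ w, w ≠ u → w ≠ v → pos w ∉ arc u v

/-- Two edges `uv` and `xy` of a topological graph cross if their curves share a point
that is not a common endpoint of the two edges. -/
def TopologicalGraph.Crosses {V : Type*} (T : TopologicalGraph V) (u v x y : V) : Prop :=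
  ∃ p ∈ T.arc u v ∩ T.arc x y,
    ∀ w, (w = u ∨ w = v) → (w = x ∨ w = y) → p ≠ T.pos w

/-- The crossing relation on edges regarded as unordered pairs. -/
def TopologicalGraph.CrossesE {V : Type*} (T : TopologicalGraph V) (e e' : Sym2 V) : Prop :=
  ∃ u v x y, e = s(u, v) ∧ e' = s(x, y) ∧ T.Crosses u v x y


namespace CBP

/-- lattice points -/
abbrev P := ℤ × ℤ

/-- lattice adjacency -/
def LAdj (a b : P) : Prop :=
  (a.1 = b.1 ∧ (a.2 = b.2 + 1 ∨ b.2 = a.2 + 1)) ∨ (a.2 = b.2 ∧ (a.1 = b.1 + 1 ∨ b.1 = a.1 + 1))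

lemma LAdj.symm {a b : P} (h : LAdj a b) : LAdj b a := by
  unfold LAdj at *; omega

lemma LAdj.ne {a b : P} (h : LAdj a b) : a ≠ b := by
  rintro rfl; unfold LAdj at *; omega

/-- list walks -/
inductive Wk : P → P → List P → Prop
  | nil (a : P) : Wk a a [a]
  | cons {a b c : P} {l : List P} : LAdj a b → Wk b c l → Wk a c (a :: l)

lemma Wk.head {a b : P} {l : List P} (h : Wk a b l) : ∃ l', l = a :: l' := by
  cases h <;> exact ⟨_, rfl⟩

lemma Wk.left_mem {a b : P} {l : List P} (h : Wk a b l) : a ∈ l := by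
  obtain ⟨l', rfl⟩ := h.head; simp

lemma Wk.right_mem {a b : P} {l : List P} (h : Wk a b l) : b ∈ l := by
  induction h with
  | nil => simp
  | cons _ _ ih => exact List.mem_cons_of_mem _ ih

lemma Wk.append {a b c : P} {l l' : List P} (h : Wk a b l) (h' : Wk b c l') :
    Wk a c (l ++ l'.tail) := by
  induction h with
  | nil => obtain ⟨m, rfl⟩ := h'.head; simpa using h'
  | cons hab _ ih => exact Wk.cons hab (ih h')

lemma Wk.snoc {a b c : P} {l : List P} (h : Wk a b l) (h' : LAdj b c) :
    Wk a c (l ++ [c]) := by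
  simpa using h.append (Wk.cons h' (Wk.nil c))

lemma Wk.reverse {a b : P} {l : List P} (h : Wk a b l) : Wk b a l.reverse := by
  induction h with
  | nil => exact Wk.nil _
  | cons hab _ ih => rw [List.reverse_cons]; exact ih.snoc hab.symm

/-- connectivity inside a set -/
def Conn (S : Set P) (a b : P) : Prop := ∃ l, Wk a b l ∧ ∀ x ∈ l, x ∈ S

lemma Conn.refl {S : Set P} {a : P} (h : a ∈ S) : Conn S a a :=
  ⟨[a], Wk.nil a, by simpa using h⟩
lemma Conn.left {S : Set P} {a b : P} (h : Conn S a b) : a ∈ S := by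
  obtain ⟨l, h1, h2⟩ := h; exact h2 _ h1.left_mem
lemma Conn.right {S : Set P} {a b : P} (h : Conn S a b) : b ∈ S := by
  obtain ⟨l, h1, h2⟩ := h; exact h2 _ h1.right_mem
lemma Conn.symm {S : Set P} {a b : P} (h : Conn S a b) : Conn S b a := by
  obtain ⟨l, h1, h2⟩ := h; exact ⟨_, h1.reverse, by simpa using h2⟩
lemma Conn.trans {S : Set P} {a b c : P} (h : Conn S a b) (h' : Conn S b c) : Conn S a c := by
  obtain ⟨l, h1, h2⟩ := h
  obtain ⟨l', h1', h2'⟩ := h'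
  refine ⟨_, h1.append h1', ?_⟩
  intro x hx
  rcases List.mem_append.1 hx with hx | hx
  · exact h2 _ hx
  · exact h2' _ (List.mem_of_mem_tail hx)
lemma Conn.mono {S T : Set P} {a b : P} (h : Conn S a b) (hST : S ⊆ T) : Conn T a b := by
  obtain ⟨l, h1, h2⟩ := h; exact ⟨l, h1, fun x hx => hST (h2 x hx)⟩
lemma Conn.adj {S : Set P} {a b : P} (ha : a ∈ S) (hb : b ∈ S) (h : LAdj a b) : Conn S a b :=
  ⟨[a, b], Wk.cons h (Wk.nil b), by simp [ha, hb]⟩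

/-- crossing indicator of a step with the ray to the right of the face `p` -/
def st (a b p : P) : ZMod 2 :=
  if a.1 = b.1 ∧ a.1 > p.1 ∧ ((a.2 = p.2 ∧ b.2 = p.2 + 1) ∨ (b.2 = p.2 ∧ a.2 = p.2 + 1)) then 1 else 0

/-- order indicator -/
def ol (u p : P) : ZMod 2 := if p.2 > u.2 ∨ (p.2 = u.2 ∧ p.1 < u.1) then 1 else 0

/-- winding parity -/
def om : List P → P → ZMod 2
  | [], _ => 0
  | [_], _ => 0
  | a :: b :: l, p => st a b p + om (b :: l) p

lemma ol_swap {u p : P} (h : u ≠ p) : ol p u = ol u p + 1 := by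
  have h' : u.1 ≠ p.1 ∨ u.2 ≠ p.2 := by
    by_contra hc; push Not at hc; exact h (Prod.ext hc.1 hc.2)
  unfold ol; split_ifs <;> first | omega | rfl

lemma st_symm (a b p : P) : st a b p = st b a p := by
  unfold st; congr 1; apply propext; omega

def TwoEdge (u v p q : P) : Prop :=
  st u v p + st u v q + st p q u + st p q v = ol u p + ol u q + ol v p + ol v q

lemma TwoEdge.s1 {u v p q : P} (h : TwoEdge u v p q) : TwoEdge v u p q := by
  unfold TwoEdge at *; rw [st_symm v u, st_symm v u]; linear_combination h
lemma TwoEdge.s2 {u v p q : P} (h : TwoEdge u v p q) : TwoEdge u v q p := by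
  unfold TwoEdge at *; rw [st_symm q p, st_symm q p]; linear_combination h
lemma TwoEdge.s3 {u v p q : P} (h1 : u ≠ p) (h2 : u ≠ q) (h3 : v ≠ p) (h4 : v ≠ q)
    (h : TwoEdge u v p q) : TwoEdge p q u v := by
  unfold TwoEdge at *
  rw [ol_swap h1, ol_swap h2, ol_swap h3, ol_swap h4]
  have : (4 : ZMod 2) = 0 := rfl
  linear_combination h - this

lemma pne {a b c d : ℤ} (h : ((a, b) : P) ≠ (c, d)) : a ≠ c ∨ b ≠ d := by
  by_contra hc; push Not at hc; exact h (Prod.ext hc.1 hc.2)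

def Nrm (u v : P) : Prop := (v = (u.1 + 1, u.2)) ∨ (v = (u.1, u.2 + 1))
lemma LAdj.nrm {u v : P} (h : LAdj u v) : Nrm u v ∨ Nrm v u := by
  unfold LAdj at h; unfold Nrm; simp only [Prod.ext_iff]; omega

lemma st_H (u p : P) : st u (u.1 + 1, u.2) p = 0 := by
  unfold st; rw [if_neg]; simp only; omega

lemma st_V (u p : P) : st u (u.1, u.2 + 1) p = if u.1 > p.1 ∧ u.2 = p.2 then 1 else 0 := by
  unfold st; split_ifs <;> simp only [true_and] at * <;> first | omega | rfl

lemma st_VV (u p : P) : st u (u.1, u.2 + 1) p + st u (u.1, u.2 + 1) (p.1, p.2 + 1) =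
    if u.1 > p.1 ∧ (u.2 = p.2 ∨ u.2 = p.2 + 1) then 1 else 0 := by
  rw [st_V, st_V]; split_ifs <;> simp only at * <;> first | omega | rfl

lemma twoEdge_nrm_HH {u p : P} (h1 : u ≠ p) (h2 : u ≠ (p.1+1,p.2)) (h3 : (u.1+1,u.2) ≠ p)  :
    TwoEdge u (u.1+1,u.2) p (p.1+1,p.2) := by
  unfold TwoEdge; rw [st_H, st_H, st_H, st_H]
  obtain ⟨x, y⟩ := u; obtain ⟨s, t⟩ := p
  replace h1 := pne h1; replace h2 := pne h2; replace h3 := pne h3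
  simp only at *
  unfold ol
  split_ifs <;> first | rfl | (exfalso; simp only at *; omega)

lemma twoEdge_nrm_VV {u p : P} (h1 : u ≠ p) (h2 : u ≠ (p.1,p.2+1)) (h3 : (u.1,u.2+1) ≠ p)  :
    TwoEdge u (u.1,u.2+1) p (p.1,p.2+1) := by
  unfold TwoEdge; rw [st_VV, add_assoc, st_VV]
  obtain ⟨x, y⟩ := u; obtain ⟨s, t⟩ := p
  replace h1 := pne h1; replace h2 := pne h2; replace h3 := pne h3
  simp only at *
  unfold ol
  split_ifs <;> first | rfl | (exfalso; simp only at *; omega)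

lemma twoEdge_nrm_HV {u p : P} (h1 : u ≠ p) (h2 : u ≠ (p.1,p.2+1)) (h3 : (u.1+1,u.2) ≠ p)
   (h4 : (u.1+1,u.2) ≠ (p.1,p.2+1))  :
    TwoEdge u (u.1+1,u.2) p (p.1,p.2+1) := by
  unfold TwoEdge; rw [st_H, st_H, st_V, st_V]
  obtain ⟨x, y⟩ := u; obtain ⟨s, t⟩ := p
  replace h1 := pne h1; replace h2 := pne h2; replace h3 := pne h3; replace h4 := pne h4
  simp only at *
  unfold ol
  split_ifs <;> first | rfl | (exfalso; simp only at *; omega)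

lemma twoEdge_nrm {u v p q : P} (huv : Nrm u v) (hpq : Nrm p q) (h1 : u ≠ p) (h2 : u ≠ q)
    (h3 : v ≠ p) (h4 : v ≠ q) : TwoEdge u v p q := by
  rcases huv with rfl | rfl <;> rcases hpq with rfl | rfl
  · exact twoEdge_nrm_HH h1 h2 h3
  · exact twoEdge_nrm_HV h1 h2 h3 h4
  · exact (twoEdge_nrm_HV h1.symm h3.symm h2.symm h4.symm).s3 h1.symm h3.symm h2.symm h4.symm
  · exact twoEdge_nrm_VV h1 h2 h3

lemma twoEdge {u v p q : P} (huv : LAdj u v) (hpq : LAdj p q) (h1 : u ≠ p) (h2 : u ≠ q)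
    (h3 : v ≠ p) (h4 : v ≠ q) : TwoEdge u v p q := by
  rcases huv.nrm with h | h <;> rcases hpq.nrm with h' | h'
  · exact twoEdge_nrm h h' h1 h2 h3 h4
  · exact (twoEdge_nrm h h' h2 h1 h4 h3).s2
  · exact (twoEdge_nrm h h' h3 h4 h1 h2).s1
  · exact (twoEdge_nrm h h' h4 h3 h2 h1).s1.s2

lemma Wk.om_cons {a b c : P} {l : List P} (h : Wk b c l) (p : P) :
    om (a :: l) p = st a b p + om l p := by
  obtain ⟨l', rfl⟩ := h.head; rfl

lemma om_edge {a b p q : P} {l : List P} (h : Wk a b l) (hpq : LAdj p q) (hp : p ∉ l) (hq : q ∉ l) :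
    om l p + om l q + st p q a + st p q b = ol a p + ol a q + ol b p + ol b q := by
  have two : (2 : ZMod 2) = 0 := rfl
  induction h with
  | nil a => simp only [om]; linear_combination (st p q a - ol a p - ol a q) * two
  | @cons a b c l hab hl ih =>
    have h1 := hl.left_mem
    simp only [List.mem_cons, not_or] at hp hq
    have := twoEdge hab hpq (Ne.symm hp.1) (Ne.symm hq.1) (fun h => hp.2 (h ▸ h1)) (fun h => hq.2 (h ▸ h1))
    have ih' := ih hp.2 hq.2
    unfold TwoEdge at this
    rw [hl.om_cons, hl.om_cons]
    linear_combination ih' + this - (st p q b - ol b p - ol b q) * two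

lemma om_walk {a b c d : P} {l m : List P} (h : Wk a b l) (h' : Wk c d m)
    (hd : ∀ x ∈ l, x ∉ m) :
    om l c + om l d + om m a + om m b = ol a c + ol a d + ol b c + ol b d := by
  have two : (2 : ZMod 2) = 0 := rfl
  induction h' with
  | nil c => simp only [om]; linear_combination (om l c - ol a c - ol b c) * two
  | @cons c d e m hcd hm ih =>
    have h1 := hm.left_mem
    have hc : c ∉ l := fun h => hd c h (by simp)
    have hdd : d ∉ l := fun h => hd d h (by simp [h1])
    have := om_edge h hcd hc hdd
    have ih' := ih (fun x hx hx' => hd x hx (by simp [hx']))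
    rw [hm.om_cons, hm.om_cons]
    linear_combination ih' + this - (om l d - ol a d - ol b d) * two

theorem K5 (p : Fin 5 → P) (W : Fin 5 → Fin 5 → Set P)
    (hW : ∀ i j, i < j → Conn (W i j) (p i) (p j))
    (hd : ∀ i j k l, i < j → k < l → i ≠ k → i ≠ l → j ≠ k → j ≠ l → Disjoint (W i j) (W k l)) :
    False := by
  have hl : ∀ i j : Fin 5, ∃ l, i < j → Wk (p i) (p j) l ∧ ∀ x ∈ l, x ∈ W i j := by
    intro i j
    by_cases h : i < j
    · obtain ⟨l, h⟩ := hW i j h; exact ⟨l, fun _ => h⟩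
    · exact ⟨[], fun h' => absurd h' h⟩
  choose f hf using hl
  have key : ∀ i j k l, i < j → k < l → i ≠ k → i ≠ l → j ≠ k → j ≠ l →
      om (f i j) (p k) + om (f i j) (p l) + om (f k l) (p i) + om (f k l) (p j)
        = ol (p i) (p k) + ol (p i) (p l) + ol (p j) (p k) + ol (p j) (p l) := by
    intro i j k l h1 h2 h3 h4 h5 h6
    refine om_walk (hf i j h1).1 (hf k l h2).1 fun x hx hx' => ?_
    exact Set.disjoint_left.1 (hd i j k l h1 h2 h3 h4 h5 h6) ((hf i j h1).2 x hx) ((hf k l h2).2 x hx')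
  have dne : ∀ i j k l, i < j → k < l → i ≠ k → i ≠ l → j ≠ k → j ≠ l →
      p i ≠ p k ∧ p i ≠ p l ∧ p j ≠ p k ∧ p j ≠ p l := by
    intro i j k l h1 h2 h3 h4 h5 h6
    have h := Set.disjoint_left.1 (hd i j k l h1 h2 h3 h4 h5 h6)
    refine ⟨fun he => ?_, fun he => ?_, fun he => ?_, fun he => ?_⟩
    · exact h (hW i j h1).left (he ▸ (hW k l h2).left)
    · exact h (hW i j h1).left (he ▸ (hW k l h2).right)
    · exact h (hW i j h1).right (he ▸ (hW k l h2).left)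
    · exact h (hW i j h1).right (he ▸ (hW k l h2).right)
  have two : (2 : ZMod 2) = 0 := rfl
  have a1 := key 0 1 2 3 (by decide) (by decide) (by decide) (by decide) (by decide) (by decide)
  have a2 := key 0 2 1 3 (by decide) (by decide) (by decide) (by decide) (by decide) (by decide)
  have a3 := key 0 3 1 2 (by decide) (by decide) (by decide) (by decide) (by decide) (by decide)
  have b1 := key 0 1 2 4 (by decide) (by decide) (by decide) (by decide) (by decide) (by decide)
  have b2 := key 0 2 1 4 (by decide) (by decide) (by decide) (by decide) (by decide) (by decide)
  have b3 := key 0 4 1 2 (by decide) (by decide) (by decide) (by decide) (by decide) (by decide)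
  have c1 := key 0 1 3 4 (by decide) (by decide) (by decide) (by decide) (by decide) (by decide)
  have c2 := key 0 3 1 4 (by decide) (by decide) (by decide) (by decide) (by decide) (by decide)
  have c3 := key 0 4 1 3 (by decide) (by decide) (by decide) (by decide) (by decide) (by decide)
  have d1 := key 0 2 3 4 (by decide) (by decide) (by decide) (by decide) (by decide) (by decide)
  have d2 := key 0 3 2 4 (by decide) (by decide) (by decide) (by decide) (by decide) (by decide)
  have d3 := key 0 4 2 3 (by decide) (by decide) (by decide) (by decide) (by decide) (by decide)
  have e1 := key 1 2 3 4 (by decide) (by decide) (by decide) (by decide) (by decide) (by decide)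
  have e2 := key 1 3 2 4 (by decide) (by decide) (by decide) (by decide) (by decide) (by decide)
  have e3 := key 1 4 2 3 (by decide) (by decide) (by decide) (by decide) (by decide) (by decide)
  have m1 := dne 1 2 3 4 (by decide) (by decide) (by decide) (by decide) (by decide) (by decide)
  have m2 := dne 1 3 2 4 (by decide) (by decide) (by decide) (by decide) (by decide) (by decide)
  have n13 := ol_swap m1.1
  have n14 := ol_swap m1.2.1
  have n23 := ol_swap m1.2.2.1
  have n24 := ol_swap m1.2.2.2
  have n12 := ol_swap m2.1
  have n34 := ol_swap m2.2.2.2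
  have : (1 : ZMod 2) = 0 := by
    linear_combination -(a1 + a2 + a3 + b1 + b2 + b3 + c1 + c2 + c3 + d1 + d2 + d3 + e1 + e2 + e3) - ((2)*n12 + (2)*n13 + (3)*n23 + (2)*n14 + (3)*n24 + (3)*n34) + ((1)*om (f 0 1) (p 2) + (1)*om (f 0 1) (p 3) + (1)*om (f 2 3) (p 0) + (1)*om (f 2 3) (p 1) + (1)*om (f 0 2) (p 1) + (1)*om (f 0 2) (p 3) + (1)*om (f 1 3) (p 0) + (1)*om (f 1 3) (p 2) + (1)*om (f 0 3) (p 1) + (1)*om (f 0 3) (p 2) + (1)*om (f 1 2) (p 0) + (1)*om (f 1 2) (p 3) + (1)*om (f 0 1) (p 4) + (1)*om (f 2 4) (p 0) + (1)*om (f 2 4) (p 1) + (1)*om (f 0 2) (p 4) + (1)*om (f 1 4) (p 0) + (1)*om (f 1 4) (p 2) + (1)*om (f 0 4) (p 1) + (1)*om (f 0 4) (p 2) + (1)*om (f 1 2) (p 4) + (1)*om (f 3 4) (p 0) + (1)*om (f 3 4) (p 1) + (1)*om (f 0 3) (p 4) + (1)*om (f 1 4) (p 3) + (1)*om (f 0 4)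 (p 3) + (1)*om (f 1 3) (p 4) + (1)*om (f 3 4) (p 2) + (1)*om (f 2 4) (p 3) + (1)*om (f 2 3) (p 4) - ((3)*ol (p 0) (p 2) + (3)*ol (p 0) (p 3) + (3)*ol (p 1) (p 2) + (3)*ol (p 1) (p 3) + (3)*ol (p 0) (p 1) + (3)*ol (p 2) (p 3) + (3)*ol (p 0) (p 4) + (3)*ol (p 1) (p 4) + (3)*ol (p 2) (p 4) + (3)*ol (p 3) (p 4)) - 7) * two
  exact absurd this (by decide)
end CBP

namespace CBP
open Classical in
/-- crossing-free system on the vertex set `R` -/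
structure Sys {V : Type*} (A : V → V → Prop) (p : V → P) (W : V → V → Set P) (R : Finset V) : Prop where
  symm : ∀ u ∈ R, ∀ v ∈ R, A u v → A v u
  ne : ∀ u ∈ R, ∀ v ∈ R, A u v → u ≠ v
  conn : ∀ u ∈ R, ∀ v ∈ R, A u v → Conn (W u v) (p u) (p v)
  wsymm : ∀ u ∈ R, ∀ v ∈ R, W u v = W v u
  disj : ∀ u ∈ R, ∀ v ∈ R, ∀ x ∈ R, ∀ y ∈ R, A u v → A x y → u ≠ x → u ≠ y → v ≠ x → v ≠ y →
    Disjoint (W u v) (W x y)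

section
variable {V : Type*} {A : V → V → Prop} {p : V → P} {W : V → V → Set P} {R : Finset V}

lemma Sys.mono (h : Sys A p W R) {R' : Finset V} (hR : R' ⊆ R) : Sys A p W R' where
  symm u hu v hv := h.symm u (hR hu) v (hR hv)
  ne u hu v hv := h.ne u (hR hu) v (hR hv)
  conn u hu v hv := h.conn u (hR hu) v (hR hv)
  wsymm u hu v hv := h.wsymm u (hR hu) v (hR hv)
  disj u hu v hv x hx y hy := h.disj u (hR hu) v (hR hv) x (hR hx) y (hR hy)

/-- contracted adjacency -/
def cA (A : V → V → Prop) (u v : V) (x y : V) : Prop :=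
  x ≠ y ∧ (A x y ∨ (x = u ∧ A v y) ∨ (y = u ∧ A v x))

open Classical in
/-- contracted sets -/
noncomputable def cW (A : V → V → Prop) (W : V → V → Set P) (u v : V) (x y : V) : Set P :=
  if A x y ∨ A y x then W x y else if x = u then W u v ∪ W v y else if y = u then W u v ∪ W v x else W x y

open Classical in
lemma Sys.contract (h : Sys A p W R) {u v : V} (hu : u ∈ R) (hv : v ∈ R) (huv : A u v) :
    Sys (cA A u v) p (cW A W u v) (R.erase v) where
  symm x hx y hy hxy := by
    have hx' := Finset.mem_of_mem_erase hx
    have hy' := Finset.mem_of_mem_erase hy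
    obtain ⟨h1, h2⟩ := hxy
    refine ⟨h1.symm, ?_⟩
    rcases h2 with h2 | h2 | h2
    · exact Or.inl (h.symm _ hx' _ hy' h2)
    · exact Or.inr (Or.inr h2)
    · exact Or.inr (Or.inl h2)
  ne x _ y _ hxy := hxy.1
  wsymm x hx y hy := by
    have hx' := Finset.mem_of_mem_erase hx
    have hy' := Finset.mem_of_mem_erase hy
    unfold cW
    have := h.wsymm x hx' y hy'
    split_ifs <;> first | tauto | (subst_vars; rfl)
  conn x hx y hy hxy := by
    have hx' := Finset.mem_of_mem_erase hx
    have hy' := Finset.mem_of_mem_erase hy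
    obtain ⟨h1, h2⟩ := hxy
    unfold cW
    by_cases h3 : A x y
    · rw [if_pos (Or.inl h3)]; exact h.conn _ hx' _ hy' h3
    have h4 : ¬ (A x y ∨ A y x) := by
      rintro (h | h'); exact h3 h; exact h3 (h.symm _ hy' _ hx' h')
    rw [if_neg h4]
    rcases h2 with h2 | ⟨rfl, h2⟩ | ⟨rfl, h2⟩
    · exact absurd h2 h3
    · rw [if_pos rfl]
      exact ((h.conn _ hx' _ hv huv).mono Set.subset_union_left).trans
        ((h.conn _ hv _ hy' h2).mono Set.subset_union_right)
    · rw [if_neg h1, if_pos rfl]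
      exact (((h.conn _ hy' _ hv huv).mono Set.subset_union_left).trans
        ((h.conn _ hv _ hx' h2).mono Set.subset_union_right)).symm
  disj := by
    have cl : ∀ x ∈ R.erase v, ∀ y ∈ R.erase v, cA A u v x y →
        (A x y ∧ cW A W u v x y = W x y) ∨ (x = u ∧ A v y ∧ cW A W u v x y = W u v ∪ W v y) ∨
        (y = u ∧ A v x ∧ cW A W u v x y = W u v ∪ W v x) := by
      intro x hx y hy hxy
      have hx' := Finset.mem_of_mem_erase hx
      have hy' := Finset.mem_of_mem_erase hy
      obtain ⟨h1, h2⟩ := hxy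
      unfold cW
      by_cases h3 : A x y
      · left; exact ⟨h3, if_pos (Or.inl h3)⟩
      have h4 : ¬ (A x y ∨ A y x) := by
        rintro (h | h'); exact h3 h; exact h3 (h.symm _ hy' _ hx' h')
      rw [if_neg h4]
      rcases h2 with h2 | ⟨rfl, h2⟩ | ⟨rfl, h2⟩
      · exact absurd h2 h3
      · right; left; exact ⟨rfl, h2, if_pos rfl⟩
      · right; right; exact ⟨rfl, h2, by rw [if_neg h1, if_pos rfl]⟩
    intro x hx y hy z hz w hw hxy hzw n1 n2 n3 n4
    have hx' := Finset.mem_of_mem_erase hx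
    have hy' := Finset.mem_of_mem_erase hy
    have hz' := Finset.mem_of_mem_erase hz
    have hw' := Finset.mem_of_mem_erase hw
    have hxv := Finset.ne_of_mem_erase hx
    have hyv := Finset.ne_of_mem_erase hy
    have hzv := Finset.ne_of_mem_erase hz
    have hwv := Finset.ne_of_mem_erase hw
    have D := h.disj
    rcases cl x hx y hy hxy with ⟨a1, a2⟩ | ⟨a0, a1, a2⟩ | ⟨a0, a1, a2⟩ <;>
    rcases cl z hz w hw hzw with ⟨b1, b2⟩ | ⟨b0, b1, b2⟩ | ⟨b0, b1, b2⟩ <;>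
    rw [a2, b2]
    · exact D x hx' y hy' z hz' w hw' a1 b1 n1 n2 n3 n4
    · subst b0
      rw [Set.disjoint_union_right]
      exact ⟨D x hx' y hy' z hz' v hv a1 huv n1 hxv n3 hyv, D x hx' y hy' v hv w hw' a1 b1 hxv n2 hyv n4⟩
    · subst b0
      rw [Set.disjoint_union_right]
      exact ⟨D x hx' y hy' w hw' v hv a1 huv n2 hxv n4 hyv, D x hx' y hy' v hv z hz' a1 b1 hxv n1 hyv n3⟩
    · subst a0
      rw [Set.disjoint_union_left]
      exact ⟨D x hx' v hv z hz' w hw' huv b1 n1 n2 hzv.symm hwv.symm,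
        D v hv y hy' z hz' w hw' a1 b1 hzv.symm hwv.symm n3 n4⟩
    · exact absurd (a0.trans b0.symm) n1
    · exact absurd (a0.trans b0.symm) n2
    · subst a0
      rw [Set.disjoint_union_left]
      exact ⟨D y hy' v hv z hz' w hw' huv b1 n3 n4 hzv.symm hwv.symm,
        D v hv x hx' z hz' w hw' a1 b1 hzv.symm hwv.symm n1 n2⟩
    · exact absurd (a0.trans b0.symm) n3
    · exact absurd (a0.trans b0.symm) n4

open Classical in
/-- ordered edges inside `U` -/
noncomputable def oE (A : V → V → Prop) (U : Finset V) : Finset (V × V) :=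
  (U ×ˢ U).filter (fun q => A q.1 q.2)

open Classical in
/-- common neighbours -/
noncomputable def cN (A : V → V → Prop) (U : Finset V) (u v : V) : Finset V :=
  U.filter (fun w => A u w ∧ A v w)

lemma mem_oE {U : Finset V} {q : V × V} : q ∈ oE A U ↔ (q.1 ∈ U ∧ q.2 ∈ U) ∧ A q.1 q.2 := by
  simp [oE]

open Classical in
lemma contract_count {U : Finset V} (hs : ∀ u ∈ U, ∀ v ∈ U, A u v → A v u)
    (hne : ∀ u ∈ U, ∀ v ∈ U, A u v → u ≠ v) {u v : V} (hu : u ∈ U) (hv : v ∈ U) (huv : A u v) :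
    (oE A U).card ≤ (oE (cA A u v) (U.erase v)).card + 2 * (1 + (cN A U u v).card) := by
  have nuv := hne u hu v hv huv
  have hvu := hs u hu v hv huv
  set C := cN A U u v with hC
  set Bad : Finset (V × V) := ({(u, v), (v, u)} : Finset (V × V)) ∪
    (C.image (fun w => (v, w)) ∪ C.image (fun w => (w, v))) with hBad
  have hb : Bad.card ≤ 2 * (1 + C.card) := by
    calc Bad.card ≤ 2 + (C.card + C.card) := by
          refine (Finset.card_union_le _ _).trans (add_le_add Finset.card_le_two ?_)
          exact (Finset.card_union_le _ _).trans (add_le_add Finset.card_image_le Finset.card_image_le)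
      _ = _ := by ring
  have hsd : (oE A U).card ≤ (oE A U \ Bad).card + Bad.card := by
    have := Finset.le_card_sdiff Bad (oE A U); omega
  suffices (oE A U \ Bad).card ≤ (oE (cA A u v) (U.erase v)).card by omega
  set σ : V → V := fun x => if x = v then u else x with hσ
  have hbad : ∀ q ∈ oE A U \ Bad, (q.1 ∈ U ∧ q.2 ∈ U) ∧ A q.1 q.2 ∧ A q.2 q.1 ∧ q.1 ≠ q.2 ∧
     (q.1 = v → q.2 ≠ u ∧ ¬ A u q.2) ∧ (q.2 = v → q.1 ≠ u ∧ ¬ A u q.1) := by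
    rintro ⟨x, y⟩ hq
    rw [Finset.mem_sdiff, mem_oE] at hq
    obtain ⟨⟨⟨hx, hy⟩, hxy⟩, hnb⟩ := hq
    simp only [hBad, Finset.mem_union, Finset.mem_insert, Finset.mem_singleton, Finset.mem_image,
      Prod.mk.injEq, not_or, hC, cN, Finset.mem_filter, not_exists, not_and] at hnb
    simp only at *
    have hyx := hs x hx y hy hxy
    refine ⟨⟨hx, hy⟩, hxy, hyx, hne x hx y hy hxy, ?_, ?_⟩
    · rintro rfl
      refine ⟨fun h => hnb.1.2 rfl h, fun h => hnb.2.1 y ⟨hy, h, hxy⟩ rfl rfl⟩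
    · rintro rfl
      refine ⟨fun h => hnb.1.1 h rfl, fun h => hnb.2.2 x ⟨hx, h, hyx⟩ rfl rfl⟩
  refine Finset.card_le_card_of_injOn (fun q => (σ q.1, σ q.2)) ?_ ?_
  · rintro ⟨x, y⟩ hq
    obtain ⟨⟨hx, hy⟩, hxy, hyx, hn, h1, h2⟩ := hbad _ hq
    simp only at *
    rw [Finset.mem_coe, mem_oE]
    simp only [hσ, Finset.mem_erase, cA]
    by_cases hxv : x = v <;> by_cases hyv : y = v <;> grind
  · rintro ⟨x, y⟩ hq ⟨x', y'⟩ hq' heq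
    obtain ⟨⟨hx, hy⟩, hxy, hyx, hn, h1, h2⟩ := hbad _ hq
    obtain ⟨⟨hx', hy'⟩, hxy', hyx', hn', h1', h2'⟩ := hbad _ hq'
    simp only [hσ, Prod.mk.injEq] at *
    by_cases hxv : x = v <;> by_cases hyv : y = v <;> by_cases hxv' : x' = v <;> by_cases hyv' : y' = v <;> grind

lemma K5_sys {a b c u v : V} (h : Sys A p W R) (ha : a ∈ R) (hb : b ∈ R) (hc : c ∈ R) (hu : u ∈ R)
   (hv : v ∈ R) (hab : A a b) (hac : A a c) (hau : A a u) (hav : A a v) (hbc : A b c) (hbu : A b u)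
   (hbv : A b v) (hcu : A c u) (hcv : A c v) (huv : A u v) : False := by
  set g : Fin 5 → V := ![a, b, c, u, v] with hg
  have hR : ∀ i, g i ∈ R := by
    intro i; fin_cases i <;> simpa [hg]
  have hA : ∀ i j, i < j → A (g i) (g j) := by
    intro i j hij
    fin_cases i <;> fin_cases j <;> first | (exfalso; revert hij; decide) | (simpa [hg])
  have hn : ∀ i j, i ≠ j → g i ≠ g j := by
    intro i j hij
    rcases lt_or_gt_of_ne hij with h' | h'
    · exact h.ne _ (hR i) _ (hR j) (hA i j h')
    · exact (h.ne _ (hR j) _ (hR i) (hA j i h')).symm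
  refine K5 (fun i => p (g i)) (fun i j => W (g i) (g j)) (fun i j hij => ?_) ?_
  · exact h.conn _ (hR i) _ (hR j) (hA i j hij)
  · intro i j k l h1 h2 h3 h4 h5 h6
    exact h.disj _ (hR i) _ (hR j) _ (hR k) _ (hR l) (hA i j h1) (hA k l h2) (hn _ _ h3) (hn _ _ h4)
      (hn _ _ h5) (hn _ _ h6)

open Classical in
lemma PL_aux : ∀ (r : ℕ), r ≤ 3 → ∀ (N : ℕ) (A : V → V → Prop) (p : V → P) (W : V → V → Set P) (Q U : Finset V),
    U.card ≤ N → Q.card + r = 3 → Disjoint Q U → U.Nonempty → Sys A p W (Q ∪ U) →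
    (∀ x ∈ Q, ∀ y ∈ Q, x ≠ y → A x y) → (∀ x ∈ Q, ∀ y ∈ U, A x y) →
    2 ^ r * U.card ≤ (oE A U).card → False := by
  intro r
  induction r with
  | zero =>
    intro _ N A p W Q U _ hQ hd hU hS hQc hQU he
    have : (oE A U).Nonempty := by
      rw [← Finset.card_pos]; have := hU.card_pos; omega
    obtain ⟨⟨u, v⟩, huv⟩ := this
    rw [mem_oE] at huv
    obtain ⟨⟨hu, hv⟩, huv⟩ := huv
    obtain ⟨a, b, c, hab, hac, hbc, rfl⟩ := Finset.card_eq_three.1 (show Q.card = 3 by omega)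
    refine K5_sys (a := a) (b := b) (c := c) (u := u) (v := v) hS (by simp) (by simp) (by simp) (Finset.mem_union_right _ hu)
      (Finset.mem_union_right _ hv) ?_ ?_ ?_ ?_ ?_ ?_ ?_ ?_ ?_ huv
    · exact hQc _ (by simp) _ (by simp) hab
    · exact hQc _ (by simp) _ (by simp) hac
    · exact hQU _ (by simp) _ hu
    · exact hQU _ (by simp) _ hv
    · exact hQc _ (by simp) _ (by simp) hbc
    · exact hQU _ (by simp) _ hu
    · exact hQU _ (by simp) _ hv
    · exact hQU _ (by simp) _ hu
    · exact hQU _ (by simp) _ hv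
  | succ r ihr =>
    intro hr N
    induction N with
    | zero =>
      intro A p W Q U hN _ _ hU
      have := hU.card_pos; omega
    | succ N ihN =>
      intro A p W Q U hN hQ hd hU hS hQc hQU he
      have hSU : Sys A p W U := hS.mono Finset.subset_union_right
      by_cases hex : ∃ u ∈ U, ∃ v ∈ U, A u v ∧ (cN A U u v).card < 2 ^ r
      · obtain ⟨u, hu, v, hv, huv, hcn⟩ := hex
        have nuv := hSU.ne u hu v hv huv
        have hcc := contract_count hSU.symm hSU.ne hu hv huv
        have hvQ : v ∉ Q := fun h => Finset.disjoint_left.1 hd h hv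
        have hcard := Finset.card_erase_of_mem hv
        have hpos := hU.card_pos
        refine ihN (cA A u v) p (cW A W u v) Q (U.erase v) (by omega) hQ
          (hd.mono_right (Finset.erase_subset _ _)) ⟨u, Finset.mem_erase.2 ⟨nuv, hu⟩⟩ ?_ ?_ ?_ ?_
        · have := hS.contract (Finset.mem_union_right _ hu) (Finset.mem_union_right _ hv) huv
          rwa [Finset.erase_union_distrib, Finset.erase_eq_of_notMem hvQ] at this
        · intro x hx y hy hxy
          exact ⟨hxy, Or.inl (hQc x hx y hy hxy)⟩
        · intro x hx y hy
          have hy' := Finset.mem_of_mem_erase hy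
          refine ⟨?_, Or.inl (hQU x hx y hy')⟩
          rintro rfl; exact Finset.disjoint_left.1 hd hx hy'
        · rw [hcard, Nat.mul_sub, mul_one]
          rw [pow_succ] at *
          omega
      · push Not at hex
        have : (oE A U).Nonempty := by
          rw [← Finset.card_pos]; have := hU.card_pos; have : 0 < 2 ^ (r + 1) * U.card := by positivity
          omega
        obtain ⟨⟨u, v⟩, huv⟩ := this
        rw [mem_oE] at huv
        obtain ⟨⟨hu, hv⟩, huv⟩ := huv
        simp only at hu hv huv
        set U1 := U.filter (fun w => A u w) with hU1
        have huU1 : u ∉ U1 := by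
          intro h; rw [hU1, Finset.mem_filter] at h; exact hSU.ne u hu u hu h.2 rfl
        have huQ : u ∉ Q := fun h => Finset.disjoint_left.1 hd h hu
        have hsub : U1 ⊆ U := Finset.filter_subset _ _
        refine ihr (by omega) U1.card A p W (insert u Q) U1 le_rfl ?_ ?_ ⟨v, ?_⟩ ?_ ?_ ?_ ?_
        · rw [Finset.card_insert_of_notMem huQ]; omega
        · rw [Finset.disjoint_insert_left]; exact ⟨huU1, hd.mono_right hsub⟩
        · rw [hU1, Finset.mem_filter]; exact ⟨hv, huv⟩
        · refine hS.mono ?_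
          intro x hx
          simp only [Finset.mem_union, Finset.mem_insert] at *
          rcases hx with (rfl | hx) | hx
          · exact Or.inr hu
          · exact Or.inl hx
          · exact Or.inr (hsub hx)
        · intro x hx y hy hxy
          rw [Finset.mem_insert] at hx hy
          rcases hx with rfl | hx <;> rcases hy with rfl | hy
          · exact absurd rfl hxy
          · exact hS.symm _ (by simp [hy]) _ (by simp [hu]) (hQU y hy x hu)
          · exact hQU x hx y hu
          · exact hQc x hx y hy hxy
        · intro x hx y hy
          rw [Finset.mem_insert] at hx
          rcases hx with rfl | hx
          · exact (Finset.mem_filter.1 hy).2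
          · exact hQU x hx y (hsub hy)
        · have : (oE A U1).card = ∑ w ∈ U1, (cN A U u w).card := by
            rw [oE, Finset.card_filter, Finset.sum_product]
            refine Finset.sum_congr rfl fun w hw => ?_
            rw [← Finset.card_filter, hU1, Finset.filter_filter, cN]
          rw [this, mul_comm, ← smul_eq_mul]
          refine Finset.card_nsmul_le_sum _ _ _ fun w hw => ?_
          exact hex u hu w (hsub hw) (Finset.mem_filter.1 hw).2

theorem PL {U : Finset V} (hU : U.Nonempty) (h : Sys A p W U) : (oE A U).card < 8 * U.card := by
  classical
  by_contra hc
  push Not at hc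
  exact PL_aux 3 le_rfl U.card A p W ∅ U le_rfl (by simp) (by simp) hU (by simpa using h) (by simp) (by simp)
    (by simpa using hc)
end
end CBP

namespace CBP
section
variable {V : Type*}

/-- independent (vertex-disjoint) pairs -/
def Ind (q q' : V × V) : Prop := q.1 ≠ q'.1 ∧ q.1 ≠ q'.2 ∧ q.2 ≠ q'.1 ∧ q.2 ≠ q'.2

lemma Ind.symm {q q' : V × V} (h : Ind q q') : Ind q' q :=
  ⟨h.1.symm, h.2.2.1.symm, h.2.1.symm, h.2.2.2.symm⟩

open Classical in
/-- ordered crossing pairs -/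
noncomputable def crs (E : Finset (V × V)) (W : V × V → Set P) : Finset ((V × V) × (V × V)) :=
  (E ×ˢ E).filter (fun z => Ind z.1 z.2 ∧ ¬ Disjoint (W z.1) (W z.2))

lemma mem_crs {E : Finset (V × V)} {W : V × V → Set P} {z} : z ∈ crs E W ↔
    (z.1 ∈ E ∧ z.2 ∈ E) ∧ Ind z.1 z.2 ∧ ¬ Disjoint (W z.1) (W z.2) := by
  simp [crs]

/-- edges inside U -/
def eIn [DecidableEq V] (E : Finset (V × V)) (U : Finset V) : Finset (V × V) :=
  E.filter (fun q => q.1 ∈ U ∧ q.2 ∈ U)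

open Classical in
lemma PL_free {E : Finset (V × V)} {W : V × V → Set P} {p : V → P} {U : Finset V}
    (hne : ∀ q ∈ E, q.1 ≠ q.2) (hor : ∀ q ∈ E, (q.2, q.1) ∉ E)
    (hW : ∀ q ∈ E, Conn (W q) (p q.1) (p q.2)) (hU : ∀ q ∈ E, q.1 ∈ U ∧ q.2 ∈ U)
    (hfree : ∀ q ∈ E, ∀ q' ∈ E, Ind q q' → Disjoint (W q) (W q')) (hUn : U.Nonempty) :
    E.card < 4 * U.card := by
  set A : V → V → Prop := fun u v => (u, v) ∈ E ∨ (v, u) ∈ E with hA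
  set W' : V → V → Set P := fun u v => {x | ((u, v) ∈ E ∧ x ∈ W (u, v)) ∨ ((v, u) ∈ E ∧ x ∈ W (v, u))} with hW'
  have hS : Sys A p W' U := by
    refine ⟨?_, ?_, ?_, ?_, ?_⟩
    · intro u _ v _ h; exact h.symm
    · rintro u _ v _ (h | h)
      · exact hne _ h
      · exact (hne _ h).symm
    · rintro u _ v _ (h | h)
      · exact (hW _ h).mono (fun x hx => Or.inl ⟨h, hx⟩)
      · exact (hW _ h).symm.mono (fun x hx => Or.inr ⟨h, hx⟩)
    · intro u _ v _; ext x; simp only [hW', Set.mem_ofPred_eq]; tauto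
    · intro u _ v _ x _ y _ _ _ n1 n2 n3 n4
      rw [Set.disjoint_left]
      have key : ∀ q ∈ E, ∀ q' ∈ E, Ind q q' → ∀ z, z ∈ W q → z ∈ W q' → False :=
        fun q hq q' hq' hi z h1 h2 => Set.disjoint_left.1 (hfree q hq q' hq' hi) h1 h2
      rintro z (⟨h1, h2⟩ | ⟨h1, h2⟩) (⟨h3, h4⟩ | ⟨h3, h4⟩)
      · exact key _ h1 _ h3 ⟨n1, n2, n3, n4⟩ z h2 h4
      · exact key _ h1 _ h3 ⟨n2, n1, n4, n3⟩ z h2 h4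
      · exact key _ h1 _ h3 ⟨n3, n4, n1, n2⟩ z h2 h4
      · exact key _ h1 _ h3 ⟨n4, n3, n2, n1⟩ z h2 h4
  have hlt := PL hUn hS
  have : E.card + E.card ≤ (oE A U).card := by
    have hi : (E.image Prod.swap).card = E.card := Finset.card_image_of_injective _ Prod.swap_injective
    have hd : Disjoint E (E.image Prod.swap) := by
      rw [Finset.disjoint_left]
      intro q hq hq'
      obtain ⟨q', h1, rfl⟩ := Finset.mem_image.1 hq'
      exact hor _ h1 hq
    rw [← hi]
    nth_rewrite 1 [hi]
    rw [← Finset.card_union_of_disjoint hd]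
    refine Finset.card_le_card ?_
    intro q hq
    rw [mem_oE]
    rcases Finset.mem_union.1 hq with hq | hq
    · exact ⟨hU q hq, Or.inl hq⟩
    · obtain ⟨q', h1, rfl⟩ := Finset.mem_image.1 hq
      exact ⟨(hU _ h1).symm, Or.inr h1⟩
  omega

open Classical in
lemma crs_lower {E : Finset (V × V)} {W : V × V → Set P} {p : V → P} {U : Finset V}
    (hne : ∀ q ∈ E, q.1 ≠ q.2) (hor : ∀ q ∈ E, (q.2, q.1) ∉ E)
    (hW : ∀ q ∈ E, Conn (W q) (p q.1) (p q.2)) (hU : ∀ q ∈ E, q.1 ∈ U ∧ q.2 ∈ U) :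
    E.card ≤ 4 * U.card + (crs E W).card := by
  rcases U.eq_empty_or_nonempty with rfl | hUn
  · have : E = ∅ := by
      apply Finset.eq_empty_of_forall_notMem; intro q hq; simpa using hU q hq
    simp [this]
  set E' := E.filter (fun q => ∀ q' ∈ E, Ind q q' → Disjoint (W q) (W q')) with hE'
  have h1 : E'.card < 4 * U.card := by
    refine PL_free (W := W) (p := p) ?_ ?_ ?_ ?_ ?_ hUn
    · intro q hq; exact hne _ (Finset.mem_filter.1 hq).1
    · intro q hq hq'; exact hor _ (Finset.mem_filter.1 hq).1 (Finset.mem_filter.1 hq').1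
    · intro q hq; exact hW _ (Finset.mem_filter.1 hq).1
    · intro q hq; exact hU _ (Finset.mem_filter.1 hq).1
    · intro q hq q' hq'; exact (Finset.mem_filter.1 hq).2 q' (Finset.mem_filter.1 hq').1
  have h2 : E \ E' ⊆ (crs E W).image Prod.fst := by
    intro q hq
    rw [Finset.mem_sdiff, hE', Finset.mem_filter] at hq
    obtain ⟨hq, hn⟩ := hq
    push Not at hn
    obtain ⟨q', hq', hi, hd⟩ := hn hq
    exact Finset.mem_image.2 ⟨(q, q'), mem_crs.2 ⟨⟨hq, hq'⟩, hi, hd⟩, rfl⟩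
  have h3 := (Finset.card_le_card h2).trans Finset.card_image_le
  have h4 := Finset.le_card_sdiff E' E
  omega

lemma count_col [Fintype V] [DecidableEq V] (s : ℕ) [NeZero s] (A : Finset V) :
    (Finset.univ.filter (fun c : V → Fin s => ∀ a ∈ A, c a = 0)).card * s ^ A.card = s ^ Fintype.card V := by
  have h1 : (Finset.univ.filter (fun c : V → Fin s => ∀ a ∈ A, c a = 0)) =
      Fintype.piFinset (fun v => if v ∈ A then ({0} : Finset (Fin s)) else Finset.univ) := by
    ext c
    simp only [Finset.mem_filter, Finset.mem_univ, true_and, Fintype.mem_piFinset]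
    refine forall_congr' fun a => ?_
    by_cases h : a ∈ A <;> simp [h]
  rw [h1, Fintype.card_piFinset]
  have h2 : s ^ A.card = ∏ v : V, if v ∈ A then s else 1 := by
    rw [Finset.prod_ite_mem, Finset.univ_inter, Finset.prod_const]
  rw [h2, ← Finset.prod_mul_distrib]
  have : ∀ v : V, ((if v ∈ A then ({0} : Finset (Fin s)) else Finset.univ).card * if v ∈ A then s else 1) = s := by
    intro v; by_cases h : v ∈ A <;> simp [h]
  simp [this]

open Classical in
theorem crossing_avg [Fintype V] {E : Finset (V × V)} {W : V × V → Set P} {p : V → P}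
    (hne : ∀ q ∈ E, q.1 ≠ q.2) (hor : ∀ q ∈ E, (q.2, q.1) ∉ E)
    (hW : ∀ q ∈ E, Conn (W q) (p q.1) (p q.2)) (s : ℕ) (hs : 0 < s) :
    E.card * s ^ 2 ≤ 4 * Fintype.card V * s ^ 3 + (crs E W).card := by
  have : NeZero s := ⟨hs.ne'⟩
  set n := Fintype.card V with hn
  let U : (V → Fin s) → Finset V := fun c => Finset.univ.filter (fun v => c v = 0)
  have hmain : ∀ c : V → Fin s, (E.filter (fun q => q.1 ∈ U c ∧ q.2 ∈ U c)).card ≤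
      4 * (U c).card + (((crs E W).filter (fun z => (z.1.1 ∈ U c ∧ z.1.2 ∈ U c) ∧ (z.2.1 ∈ U c ∧ z.2.2 ∈ U c))).card) := by
    intro c
    have := crs_lower (E := E.filter (fun q => q.1 ∈ U c ∧ q.2 ∈ U c)) (W := W) (p := p) (U := U c)
      (fun q hq => hne q (Finset.mem_filter.1 hq).1)
      (fun q hq hq' => hor q (Finset.mem_filter.1 hq).1 (Finset.mem_filter.1 hq').1)
      (fun q hq => hW q (Finset.mem_filter.1 hq).1)
      (fun q hq => (Finset.mem_filter.1 hq).2)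
    refine this.trans (Nat.add_le_add_left (Finset.card_le_card ?_) _)
    intro z hz
    obtain ⟨⟨z1, z2⟩, z3⟩ := mem_crs.1 hz
    have z1' := Finset.mem_filter.1 z1
    have z2' := Finset.mem_filter.1 z2
    exact Finset.mem_filter.2 ⟨mem_crs.2 ⟨⟨z1'.1, z2'.1⟩, z3⟩, z1'.2, z2'.2⟩
  have hsum := Finset.sum_le_sum (fun c (_ : c ∈ Finset.univ) => hmain c)
  rw [Finset.sum_add_distrib, ← Finset.mul_sum] at hsum
  have e1 : (∑ c : V → Fin s, (E.filter (fun q => q.1 ∈ U c ∧ q.2 ∈ U c)).card) * s ^ 2 = E.card * s ^ n := by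
    simp only [Finset.card_filter]
    rw [Finset.sum_comm, Finset.sum_mul, ← smul_eq_mul, ← Finset.sum_const]
    refine Finset.sum_congr rfl fun q hq => ?_
    rw [← Finset.card_filter, hn, ← count_col s {q.1, q.2}, Finset.card_pair (hne q hq)]
    congr 3; ext c; simp [U]
  have e2 : (∑ c : V → Fin s, (U c).card) * s = n * s ^ n := by
    simp only [U, Finset.card_filter]
    rw [Finset.sum_comm, Finset.sum_mul, hn, ← Finset.card_univ, ← smul_eq_mul, ← Finset.sum_const]
    refine Finset.sum_congr rfl fun v _ => ?_
    have := count_col s {v}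
    rw [← Finset.card_filter, Finset.card_univ, ← this, Finset.card_singleton, pow_one]
    congr 2; ext c; simp
  have e3 : (∑ c : V → Fin s, ((crs E W).filter (fun z => (z.1.1 ∈ U c ∧ z.1.2 ∈ U c) ∧ (z.2.1 ∈ U c ∧ z.2.2 ∈ U c))).card) * s ^ 4
      = (crs E W).card * s ^ n := by
    simp only [Finset.card_filter]
    rw [Finset.sum_comm, Finset.sum_mul, ← smul_eq_mul, ← Finset.sum_const]
    refine Finset.sum_congr rfl fun z hz => ?_
    rw [mem_crs] at hz
    obtain ⟨⟨hz1, hz2⟩, ⟨i1, i2, i3, i4⟩, -⟩ := hz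
    have hc : ({z.1.1, z.1.2, z.2.1, z.2.2} : Finset V).card = 4 := by
      rw [Finset.card_insert_of_notMem, Finset.card_insert_of_notMem, Finset.card_pair (hne _ hz2)]
      · simp [i3, i4]
      · simp [i1, i2, hne _ hz1]
    rw [← Finset.card_filter, hn, ← count_col s {z.1.1, z.1.2, z.2.1, z.2.2}, hc]
    congr 3; ext c; simp [U, and_assoc]
  have hpos : 0 < s ^ n := by positivity
  refine Nat.le_of_mul_le_mul_right ?_ hpos
  generalize (∑ c : V → Fin s, (E.filter (fun q => q.1 ∈ U c ∧ q.2 ∈ U c)).card) = a at *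
  generalize (∑ c : V → Fin s, ((crs E W).filter (fun z => (z.1.1 ∈ U c ∧ z.1.2 ∈ U c) ∧ (z.2.1 ∈ U c ∧ z.2.2 ∈ U c))).card) = b at *
  generalize (∑ c : V → Fin s, (U c).card) = d at *
  calc E.card * s ^ 2 * s ^ n = (E.card * s ^ n) * s ^ 2 := by ring
    _ = (a * s ^ 2) * s ^ 2 := by rw [e1]
    _ = a * s ^ 4 := by ring
    _ ≤ (4 * d + b) * s ^ 4 := Nat.mul_le_mul_right _ hsum
    _ = 4 * (d * s) * s ^ 3 + b * s ^ 4 := by ring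
    _ = _ := by rw [e2, e3]; ring

theorem crossing_lemma [Fintype V] {E : Finset (V × V)} {W : V × V → Set P} {p : V → P}
    (hne : ∀ q ∈ E, q.1 ≠ q.2) (hor : ∀ q ∈ E, (q.2, q.1) ∉ E)
    (hW : ∀ q ∈ E, Conn (W q) (p q.1) (p q.2)) (hn : 0 < Fintype.card V)
    (h8 : 8 * Fintype.card V ≤ E.card) :
    E.card ^ 3 ≤ 512 * Fintype.card V ^ 2 * (crs E W).card := by
  set n := Fintype.card V
  set e := E.card
  set s := e / (8 * n) with hs
  have h1 : 8 * n * s ≤ e := Nat.mul_div_le _ _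
  have h2 : e < 8 * n * (s + 1) := by
    have := Nat.lt_mul_div_succ e (show 0 < 8 * n by omega)
    simpa using this
  have h3 : 0 < s := Nat.div_pos h8 (by omega)
  have h4 := crossing_avg hne hor hW s h3
  change e * s ^ 2 ≤ 4 * n * s ^ 3 + _ at h4
  generalize (crs E W).card = x at *
  have h5 : e ≤ 16 * n * s := by nlinarith
  have h6 : e * s ^ 2 ≤ 2 * x := by nlinarith [Nat.mul_le_mul_right (s ^ 2) h1]
  calc e ^ 3 = e ^ 2 * e := by ring
    _ ≤ (16 * n * s) ^ 2 * e := by gcongr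
    _ = 256 * n ^ 2 * (e * s ^ 2) := by ring
    _ ≤ 256 * n ^ 2 * (2 * x) := by gcongr
    _ = _ := by ring
end
end CBP

namespace CBP
section
variable {ι : Type*} [DecidableEq ι]

/-- linked through a finite set -/
inductive Lk (I : ι → ι → Prop) : ι → ι → Finset ι → Prop
  | nil (a : ι) : Lk I a a {a}
  | snoc {a b c : ι} {S : Finset ι} : Lk I a b S → I b c → Lk I a c (insert c S)

/-- admissible routing -/
structure Rt (I : ι → ι → Prop) (L C : ℕ) (F : Finset ((ι × ι) × Finset ι)) : Prop where
  ne : ∀ f ∈ F, f.1.1 ≠ f.1.2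
  lk : ∀ f ∈ F, Lk I f.1.1 f.1.2 f.2
  card : ∀ f ∈ F, f.2.card ≤ L + 1
  inj : ∀ f ∈ F, ∀ g ∈ F, f.1 = g.1 → f = g
  sw : ∀ f ∈ F, ∀ g ∈ F, f.1 ≠ g.1.swap
  cong : ∀ x, (F.filter (fun f => x ∈ f.2)).card ≤ C

open Classical in
/-- balls -/
noncomputable def bll (I : ι → ι → Prop) (W : Finset ι) (v : ι) : ℕ → Finset ι
  | 0 => {v}
  | r + 1 => bll I W v r ∪ @Finset.filter _ (fun w => ∃ x ∈ bll I W v r, I x w) (Classical.decPred _) W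

lemma mem_bll_succ {I : ι → ι → Prop} {W : Finset ι} {v w : ι} {r : ℕ} : w ∈ bll I W v (r + 1) ↔
    w ∈ bll I W v r ∨ (w ∈ W ∧ ∃ x ∈ bll I W v r, I x w) := by
  simp only [bll, Finset.mem_union, Finset.mem_filter]

lemma bll_sub {I : ι → ι → Prop} {W : Finset ι} {v : ι} (hv : v ∈ W) (r : ℕ) : bll I W v r ⊆ W := by
  induction r with
  | zero => simpa [bll] using hv
  | succ r ih =>
    intro x hx
    rcases mem_bll_succ.1 hx with h | h
    · exact ih h
    · exact h.1

lemma bll_lk {I : ι → ι → Prop} {W : Finset ι} {v : ι} (hv : v ∈ W) (r : ℕ) :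
    ∀ w ∈ bll I W v r, ∃ S : Finset ι, S ⊆ W ∧ S.card ≤ r + 1 ∧ Lk I v w S := by
  induction r with
  | zero =>
    intro w hw
    simp only [bll, Finset.mem_singleton] at hw
    subst hw
    exact ⟨{w}, by simpa using hv, by simp, Lk.nil w⟩
  | succ r ih =>
    intro w hw
    simp only [bll, Finset.mem_union, Finset.mem_filter] at hw
    rcases hw with hw | ⟨hw, x, hx, hxw⟩
    · obtain ⟨S, h1, h2, h3⟩ := ih w hw
      exact ⟨S, h1, by omega, h3⟩
    · obtain ⟨S, h1, h2, h3⟩ := ih x hx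
      refine ⟨insert w S, Finset.insert_subset hw h1, ?_, h3.snoc hxw⟩
      have := Finset.card_insert_le w S; omega

open Classical in
theorem routing [Fintype ι] (I : ι → ι → Prop) (hI : ∀ a b, I a b → I b a) (δ : ℝ) (hδ : 0 < δ) (hδ1 : δ ≤ 1 / 25)
    (L C : ℕ) (hL : (Fintype.card ι : ℝ) < (1 + δ / 2) ^ L)
    (hC : (Fintype.card ι : ℝ) * (L + 1) ≤ 200 * δ * C) (hN : 4 ≤ Fintype.card ι)
    (hsep : ∀ A S B : Finset ι, A ∪ S ∪ B = Finset.univ → Disjoint A S → Disjoint A B → Disjoint S B →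
      (∀ a ∈ A, ∀ b ∈ B, ¬ I a b) → (S.card : ℝ) ≤ δ * Fintype.card ι →
      (A.card : ℝ) ≤ 0.8 * Fintype.card ι → (B.card : ℝ) ≤ 0.8 * Fintype.card ι → False) :
    ∃ F, Rt I L C F ∧ Fintype.card ι ^ 2 ≤ 400 * F.card := by
  set N := Fintype.card ι with hNdef
  have hNpos : (0:ℝ) < N := by have : 0 < N := by omega
                               exact_mod_cast this
  have hN4 : (4:ℝ) ≤ N := by exact_mod_cast hN
  have hex : ((Finset.univ : Finset (Finset ((ι × ι) × Finset ι))).filter (fun F => Rt I L C F)).Nonempty := by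
    refine ⟨∅, ?_⟩
    rw [Finset.mem_filter]
    refine ⟨Finset.mem_univ _, ?_⟩
    constructor <;> simp
  obtain ⟨F, hF, hmax⟩ := Finset.exists_max_image _ Finset.card hex
  have hR : Rt I L C F := (Finset.mem_filter.1 hF).2
  replace hmax : ∀ F', Rt I L C F' → F'.card ≤ F.card := fun F' h' =>
    hmax F' (Finset.mem_filter.2 ⟨Finset.mem_univ _, h'⟩)
  refine ⟨F, hR, ?_⟩
  by_contra hlt
  push Not at hlt
  have hltR : 400 * (F.card : ℝ) < N ^ 2 := by exact_mod_cast hlt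
  have hCpos : (0:ℝ) < C := by
    have h1 : (0:ℝ) < N * (L + 1) := by positivity
    have h2 : 0 < 200 * δ * (C:ℝ) := lt_of_lt_of_le h1 hC
    exact pos_of_mul_pos_right h2 (by positivity)
  -- congested vertices
  set X : Finset ι := Finset.univ.filter (fun x => C ≤ (F.filter (fun f => x ∈ f.2)).card) with hX
  have hXc : (X.card : ℝ) ≤ δ * N / 2 := by
    have h1 : X.card * C ≤ F.card * (L + 1) := by
      calc X.card * C ≤ ∑ x ∈ X, (F.filter (fun f => x ∈ f.2)).card := by
            rw [← smul_eq_mul]; exact Finset.card_nsmul_le_sum _ _ _ fun x hx => (Finset.mem_filter.1 hx).2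
        _ ≤ ∑ x : ι, (F.filter (fun f => x ∈ f.2)).card := Finset.sum_le_univ_sum_of_nonneg (fun _ => Nat.zero_le _)
        _ = ∑ f ∈ F, f.2.card := by
            simp only [Finset.card_filter]
            rw [Finset.sum_comm]
            refine Finset.sum_congr rfl fun f _ => ?_
            rw [← Finset.card_filter, Finset.filter_univ_mem]
        _ ≤ F.card * (L + 1) := by
            rw [← smul_eq_mul]; exact Finset.sum_le_card_nsmul _ _ _ fun f hf => hR.card f hf
    have h1R : (X.card : ℝ) * C ≤ F.card * (L + 1) := by exact_mod_cast h1
    have h2 : (X.card : ℝ) * C ≤ (δ * N / 2) * C := by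
      calc (X.card : ℝ) * C ≤ F.card * (L + 1) := h1R
        _ ≤ (N ^ 2 / 400) * (L + 1) := by gcongr; linarith
        _ = N / 400 * (N * (L + 1)) := by ring
        _ ≤ N / 400 * (200 * δ * C) := by gcongr
        _ = _ := by ring
    exact le_of_mul_le_mul_right h2 hCpos
  -- linked relation
  set T : ι → ι → Prop := fun u v => ∃ f ∈ F, f.1 = (u, v) ∨ f.1 = (v, u) with hT
  have hlink : ∀ u v, u ≠ v → ¬ T u v → ∀ S : Finset ι, (∀ x ∈ S, x ∉ X) → S.card ≤ L + 1 → Lk I u v S → False := by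
    intro u v huv hnT S hSX hSc hlk
    have hnF : ∀ f ∈ F, f.1 ≠ (u, v) ∧ f.1 ≠ (v, u) := by
      intro f hf
      exact ⟨fun h => hnT ⟨f, hf, Or.inl h⟩, fun h => hnT ⟨f, hf, Or.inr h⟩⟩
    have hnot : ((u, v), S) ∉ F := fun h => (hnF _ h).1 rfl
    have : Rt I L C (insert ((u, v), S) F) := by
      refine ⟨?_, ?_, ?_, ?_, ?_, ?_⟩
      · intro f hf; rcases Finset.mem_insert.1 hf with rfl | hf
        · exact huv
        · exact hR.ne f hf
      · intro f hf; rcases Finset.mem_insert.1 hf with rfl | hf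
        · exact hlk
        · exact hR.lk f hf
      · intro f hf; rcases Finset.mem_insert.1 hf with rfl | hf
        · exact hSc
        · exact hR.card f hf
      · intro f hf g hg hfg
        rcases Finset.mem_insert.1 hf with rfl | hf <;> rcases Finset.mem_insert.1 hg with rfl | hg
        · rfl
        · exact absurd hfg.symm (hnF g hg).1
        · exact absurd hfg (hnF f hf).1
        · exact hR.inj f hf g hg hfg
      · intro f hf g hg hfg
        rcases Finset.mem_insert.1 hf with rfl | hf <;> rcases Finset.mem_insert.1 hg with rfl | hg
        · simp only [Prod.swap_prod_mk, Prod.mk.injEq] at hfg; exact huv hfg.1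
        · have h2 : g.1 = (v, u) := by rw [← Prod.swap_swap g.1, ← hfg]; rfl
          exact (hnF g hg).2 h2
        · exact (hnF f hf).2 hfg
        · exact hR.sw f hf g hg hfg
      · intro x
        rw [Finset.filter_insert]
        split_ifs with hx
        · have hx' := hSX x hx
          simp only [hX, Finset.mem_filter, Finset.mem_univ, true_and, not_le] at hx'
          exact (Finset.card_insert_le _ _).trans hx'
        · exact hR.cong x
    have h1 := hmax _ this
    rw [Finset.card_insert_of_notMem hnot] at h1
    omega
  set Y : Finset ι := Finset.univ.filter (fun v => (N : ℝ) / 20 ≤ (Finset.univ.filter (fun u => T v u)).card) with hY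
  have hYc : (Y.card : ℝ) ≤ N / 10 := by
    have h1 : (∑ v : ι, (Finset.univ.filter (fun u => T v u)).card) ≤ 2 * F.card := by
      have h2 : (∑ v : ι, (Finset.univ.filter (fun u => T v u)).card) =
          (Finset.univ.filter (fun q : ι × ι => T q.1 q.2)).card := by
        simp only [Finset.card_filter]
        rw [← Finset.univ_product_univ, Finset.sum_product]
      rw [h2]
      calc _ ≤ (F.image (fun f => f.1) ∪ F.image (fun f => f.1.swap)).card := by
            refine Finset.card_le_card ?_
            rintro ⟨u, v⟩ hq
            obtain ⟨f, hf, h | h⟩ := (Finset.mem_filter.1 hq).2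
            · exact Finset.mem_union_left _ (Finset.mem_image.2 ⟨f, hf, h⟩)
            · refine Finset.mem_union_right _ (Finset.mem_image.2 ⟨f, hf, ?_⟩)
              rw [h]; rfl
        _ ≤ F.card + F.card := (Finset.card_union_le _ _).trans (add_le_add Finset.card_image_le Finset.card_image_le)
        _ = _ := by ring
    have h3 : (Y.card : ℝ) * (N / 20) ≤ 2 * F.card := by
      calc (Y.card : ℝ) * (N / 20) ≤ ∑ v ∈ Y, ((Finset.univ.filter (fun u => T v u)).card : ℝ) := by
            rw [← nsmul_eq_mul]; exact Finset.card_nsmul_le_sum _ _ _ fun x hx => (Finset.mem_filter.1 hx).2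
        _ ≤ ∑ v : ι, ((Finset.univ.filter (fun u => T v u)).card : ℝ) :=
            Finset.sum_le_univ_sum_of_nonneg (fun _ => Nat.cast_nonneg _)
        _ ≤ _ := by exact_mod_cast h1
    nlinarith
  -- maximal pair
  set G : Finset (Finset ι × Finset ι) := Finset.univ.filter (fun z => Disjoint z.1 z.2 ∧ Disjoint z.1 X ∧ Disjoint z.2 X ∧
    (∀ a ∈ z.1, ∀ b, b ∉ X → I a b → b ∈ z.1 ∪ z.2) ∧ (z.2.card : ℝ) ≤ δ / 2 * z.1.card ∧ (z.1.card : ℝ) ≤ N / 2) with hG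
  have hGn : G.Nonempty := by
    refine ⟨(∅, ∅), ?_⟩
    simp [hG]; positivity
  obtain ⟨⟨A, S⟩, hAS, hAmax⟩ := Finset.exists_max_image G (fun z => z.1.card) hGn
  simp only [hG, Finset.mem_filter, Finset.mem_univ, true_and] at hAS
  obtain ⟨dAS, dAX, dSX, hedge, hSc, hAc⟩ := hAS
  have hAN : (A.card : ℝ) ≤ N := by linarith
  by_cases hAbig : 0.2 * (N:ℝ) ≤ A.card
  · -- separator
    refine hsep A (S ∪ X) (Finset.univ \ (A ∪ (S ∪ X))) ?_ ?_ ?_ ?_ ?_ ?_ ?_ ?_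
    · rw [Finset.union_sdiff_self_eq_union, Finset.union_eq_right]; exact Finset.subset_univ _
    · rw [Finset.disjoint_union_right]; exact ⟨dAS, dAX⟩
    · exact Finset.disjoint_sdiff.mono_left Finset.subset_union_left
    · exact Finset.disjoint_sdiff.mono_left Finset.subset_union_right
    · intro a ha b hb hab
      simp only [Finset.mem_sdiff, Finset.mem_univ, true_and, Finset.mem_union, not_or] at hb
      have := hedge a ha b hb.2.2 hab
      rw [Finset.mem_union] at this
      tauto
    · have h1 : ((S ∪ X).card : ℝ) ≤ S.card + X.card := by exact_mod_cast Finset.card_union_le _ _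
      nlinarith
    · linarith
    · have h1 : (Finset.univ \ (A ∪ (S ∪ X))).card ≤ (Finset.univ \ A).card :=
        Finset.card_le_card (Finset.sdiff_subset_sdiff le_rfl Finset.subset_union_left)
      have h2 : (Finset.univ \ A).card + A.card = N := by
        rw [Finset.card_sdiff_add_card_eq_card (Finset.subset_univ _), Finset.card_univ]
      have h1R : ((Finset.univ \ (A ∪ (S ∪ X))).card : ℝ) ≤ (Finset.univ \ A).card := by exact_mod_cast h1
      have h2R : ((Finset.univ \ A).card : ℝ) + A.card = N := by exact_mod_cast h2
      linarith
  push Not at hAbig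
  set W : Finset ι := Finset.univ \ (A ∪ (S ∪ X)) with hW
  have hWmem : ∀ x, x ∈ W ↔ x ∉ A ∧ x ∉ S ∧ x ∉ X := by
    intro x; simp [hW]
  have hWY : ∃ v ∈ W, v ∉ Y := by
    by_contra hc
    push Not at hc
    have h1 : W.card ≤ Y.card := Finset.card_le_card hc
    have h2 : W.card + (A ∪ (S ∪ X)).card = N := by
      rw [Finset.card_sdiff_add_card_eq_card (Finset.subset_univ _), Finset.card_univ]
    have h3 : (A ∪ (S ∪ X)).card ≤ A.card + (S.card + X.card) :=
      (Finset.card_union_le _ _).trans (Nat.add_le_add_left (Finset.card_union_le _ _) _)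
    have h1R : (W.card : ℝ) ≤ Y.card := by exact_mod_cast h1
    have h23 : (N : ℝ) ≤ W.card + (A.card + (S.card + X.card)) := by
      have : N ≤ W.card + (A.card + (S.card + X.card)) := by omega
      exact_mod_cast this
    nlinarith
  obtain ⟨v, hvW, hvY⟩ := hWY
  have hvd : ((Finset.univ.filter (fun u => T v u)).card : ℝ) < N / 20 := by
    by_contra h; push Not at h; exact hvY (by rw [hY, Finset.mem_filter]; exact ⟨Finset.mem_univ _, h⟩)
  have hball : ∀ r ≤ L, ((bll I W v r).card : ℝ) ≤ 1 + N / 20 := by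
    intro r hr
    have h1 : bll I W v r ⊆ insert v (Finset.univ.filter (fun u => T v u)) := by
      intro w hw
      rw [Finset.mem_insert]
      by_cases hwv : w = v
      · exact Or.inl hwv
      right
      rw [Finset.mem_filter]
      refine ⟨Finset.mem_univ _, ?_⟩
      by_contra hnT
      obtain ⟨S', h1, h2, h3⟩ := bll_lk hvW r w hw
      exact hlink v w (Ne.symm hwv) hnT S' (fun x hx => ((hWmem x).1 (h1 hx)).2.2) (by omega) h3
    have h2 := (Finset.card_le_card h1).trans (Finset.card_insert_le _ _)
    have h2R : ((bll I W v r).card : ℝ) ≤ (Finset.univ.filter (fun u => T v u)).card + 1 := by exact_mod_cast h2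
    linarith
  have hr : ∃ r < L, ((bll I W v (r+1)).card : ℝ) ≤ (1 + δ / 2) * (bll I W v r).card := by
    by_contra hc
    push Not at hc
    have : ∀ r ≤ L, (1 + δ / 2) ^ r ≤ ((bll I W v r).card : ℝ) := by
      intro r
      induction r with
      | zero => intro _; simp [bll]
      | succ r ih =>
        intro hr
        have h1 := ih (by omega)
        have h2 := hc r (by omega)
        rw [pow_succ]
        nlinarith
    have h1 := this L le_rfl
    have h2 := hball L le_rfl
    nlinarith
  obtain ⟨r, hrL, hr⟩ := hr
  set B := bll I W v r with hB
  set B' := bll I W v (r + 1) with hB'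
  have hBB' : B ⊆ B' := Finset.subset_union_left
  have hB'W : B' ⊆ W := bll_sub hvW _
  have hBne : v ∈ B := by
    have : ∀ r, v ∈ bll I W v r := by
      intro r; induction r with
      | zero => simp [bll]
      | succ r ih => exact Finset.mem_union_left _ ih
    exact this r
  have dAB : Disjoint A B := by
    rw [Finset.disjoint_left]; intro x hx hx'; exact ((hWmem x).1 (hB'W (hBB' hx'))).1 hx
  have hcardA' : (A ∪ B).card = A.card + B.card := Finset.card_union_of_disjoint dAB
  have hBpos : 0 < B.card := Finset.card_pos.2 ⟨v, hBne⟩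
  have hmem : (A ∪ B, S ∪ (B' \ B)) ∈ G := by
    simp only [hG, Finset.mem_filter, Finset.mem_univ, true_and]
    refine ⟨?_, ?_, ?_, ?_, ?_, ?_⟩
    · rw [Finset.disjoint_left]
      intro x hx hx'
      rw [Finset.mem_union] at hx hx'
      rcases hx with hx | hx <;> rcases hx' with hx' | hx'
      · exact Finset.disjoint_left.1 dAS hx hx'
      · exact ((hWmem x).1 (hB'W (Finset.mem_sdiff.1 hx').1)).1 hx
      · exact ((hWmem x).1 (hB'W (hBB' hx))).2.1 hx'
      · exact (Finset.mem_sdiff.1 hx').2 hx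
    · rw [Finset.disjoint_left]
      intro x hx hx'
      rcases Finset.mem_union.1 hx with hx | hx
      · exact Finset.disjoint_left.1 dAX hx hx'
      · exact ((hWmem x).1 (hB'W (hBB' hx))).2.2 hx'
    · rw [Finset.disjoint_left]
      intro x hx hx'
      rcases Finset.mem_union.1 hx with hx | hx
      · exact Finset.disjoint_left.1 dSX hx hx'
      · exact ((hWmem x).1 (hB'W (Finset.mem_sdiff.1 hx).1)).2.2 hx'
    · intro a ha b hb hab
      simp only [Finset.mem_union, Finset.mem_sdiff]
      rcases Finset.mem_union.1 ha with ha | ha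
      · have := hedge a ha b hb hab
        rw [Finset.mem_union] at this; tauto
      · by_cases h1 : b ∈ A
        · tauto
        by_cases h2 : b ∈ S
        · tauto
        have h3 : b ∈ B' := by
          rw [hB', mem_bll_succ]
          exact Or.inr ⟨(hWmem b).2 ⟨h1, h2, hb⟩, a, ha, hab⟩
        tauto
    · have h1 : ((S ∪ (B' \ B)).card : ℝ) ≤ S.card + (B' \ B).card := by exact_mod_cast Finset.card_union_le _ _
      have h2 : ((B' \ B).card : ℝ) + B.card = B'.card := by
        exact_mod_cast Finset.card_sdiff_add_card_eq_card hBB'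
      rw [hcardA']
      push_cast
      linarith
    · rw [hcardA']; push_cast
      have := hball r hrL.le
      linarith
  have := hAmax _ hmem
  simp only at this
  omega
end
end CBP

namespace CBP
section
variable {ι : Type*}

/-- two sets meet -/
def Hit (S T : Set P) : Prop := (S ∩ T).Nonempty
lemma Hit.symm {S T : Set P} (h : Hit S T) : Hit T S := by
  unfold Hit at *; rwa [Set.inter_comm]

/-- nonempty connected lattice set -/
def IsStr (S : Set P) : Prop := S.Nonempty ∧ ∀ x ∈ S, ∀ y ∈ S, Conn S x y

open Classical in
/-- ordered hitting pairs within `V` -/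
noncomputable def hp (S : ι → Set P) (V : Finset ι) : Finset (ι × ι) :=
  (V ×ˢ V).filter (fun q => Hit (S q.1) (S q.2))

/-- the log scale -/
noncomputable def ell (x : ℝ) : ℝ := Real.log (x + 3)

lemma one_lt_ell {x : ℝ} (hx : 0 ≤ x) : 1 < ell x := by
  unfold ell
  rw [Real.lt_log_iff_exp_lt (by linarith)]
  have := Real.exp_one_lt_d9
  linarith

lemma Lk.conn [DecidableEq ι] {S : ι → Set P} (hS : ∀ i, IsStr (S i)) {a b : ι} {F : Finset ι}
    (h : Lk (fun x y => Hit (S x) (S y)) a b F) :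
    ∀ x ∈ S a, ∀ y ∈ S b, Conn {p | ∃ z ∈ F, p ∈ S z} x y := by
  induction h with
  | nil =>
    intro x hx y hy
    exact ((hS _).2 x hx y hy).mono (fun p hp => ⟨_, by simp, hp⟩)
  | @snoc b c F hab hbc ih =>
    intro x hx y hy
    obtain ⟨z, hz1, hz2⟩ := hbc
    refine ((ih x hx z hz1).mono ?_).trans (((hS _).2 z hz2 y hy).mono ?_)
    · rintro p ⟨w, hw, hp⟩; exact ⟨w, by simp [hw], hp⟩
    · intro p hp; exact ⟨_, by simp, hp⟩

open Classical in
theorem dense_of_routing [Fintype ι] {S : ι → Set P} (hS : ∀ i, IsStr (S i)) {L C : ℕ} {F : Finset ((ι × ι) × Finset ι)}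
    (hF : Rt (fun x y => Hit (S x) (S y)) L C F) (h8 : 8 * Fintype.card ι ≤ F.card)
    (hpos : 0 < Fintype.card ι) :
    F.card ^ 3 ≤ 512 * Fintype.card ι ^ 2 * (C ^ 2 * (hp S Finset.univ).card) := by
  choose p hp' using fun i => (hS i).1
  set E : Finset (ι × ι) := F.image Prod.fst with hE
  have hEc : E.card = F.card := Finset.card_image_of_injOn (fun f hf g hg h => hF.inj f hf g hg h)
  set W : ι × ι → Set P := fun q => {x | ∃ f ∈ F, f.1 = q ∧ ∃ z ∈ f.2, x ∈ S z} with hW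
  have hcl := crossing_lemma (E := E) (W := W) (p := p) ?_ ?_ ?_ hpos (by rw [hEc]; exact h8)
  · rw [hEc] at hcl
    refine hcl.trans (Nat.mul_le_mul_left _ ?_)
    have hsub : crs E W ⊆ (hp S Finset.univ).biUnion (fun z =>
        ((F.filter (fun f => z.1 ∈ f.2)) ×ˢ (F.filter (fun f => z.2 ∈ f.2))).image (fun g => (g.1.1, g.2.1))) := by
      rintro ⟨q, q'⟩ hq
      obtain ⟨-, -, hnd⟩ := mem_crs.1 hq
      rw [Set.not_disjoint_iff] at hnd
      obtain ⟨x, ⟨f, hf, hfq, z, hz, hxz⟩, ⟨f', hf', hfq', z', hz', hxz'⟩⟩ := hnd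
      simp only at hfq hfq'
      rw [Finset.mem_biUnion]
      refine ⟨(z, z'), ?_, ?_⟩
      · rw [hp, Finset.mem_filter]; exact ⟨by simp, x, hxz, hxz'⟩
      · refine Finset.mem_image.2 ⟨(f, f'), ?_, by rw [← hfq, ← hfq']⟩
        simp [hf, hf', hz, hz']
    calc _ ≤ _ := Finset.card_le_card hsub
      _ ≤ (hp S Finset.univ).card * C ^ 2 := by
        refine Finset.card_biUnion_le_card_mul _ _ _ fun z _ => ?_
        refine Finset.card_image_le.trans ?_
        rw [Finset.card_product, pow_two]
        exact Nat.mul_le_mul (hF.cong _) (hF.cong _)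
      _ = _ := mul_comm _ _
  · intro q hq; obtain ⟨f, hf, rfl⟩ := Finset.mem_image.1 hq; exact hF.ne f hf
  · intro q hq hq'
    obtain ⟨f, hf, rfl⟩ := Finset.mem_image.1 hq
    obtain ⟨g, hg, h⟩ := Finset.mem_image.1 hq'
    exact hF.sw g hg f hf h
  · intro q hq
    obtain ⟨f, hf, rfl⟩ := Finset.mem_image.1 hq
    refine ((hF.lk f hf).conn hS _ (hp' _) _ (hp' _)).mono ?_
    rintro x ⟨z, hz, hx⟩
    exact ⟨f, hf, rfl, z, hz, hx⟩

open Classical in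
theorem dense_of_nosep [Fintype ι] {S : ι → Set P} (hS : ∀ i, IsStr (S i)) (hN : 3200 ≤ Fintype.card ι)
    (hsep : ∀ A T B : Finset ι, A ∪ T ∪ B = Finset.univ → Disjoint A T → Disjoint A B → Disjoint T B →
      (∀ a ∈ A, ∀ b ∈ B, ¬ Hit (S a) (S b)) →
      (T.card : ℝ) ≤ 1 / (25 * ell (Fintype.card ι) ^ 2) * Fintype.card ι →
      (A.card : ℝ) ≤ 0.8 * Fintype.card ι → (B.card : ℝ) ≤ 0.8 * Fintype.card ι → False) :
    (Fintype.card ι : ℝ) ^ 2 ≤ 10 ^ 14 * ell (Fintype.card ι) ^ 10 * (hp S Finset.univ).card := by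
  set n := Fintype.card ι with hn
  set l := ell n with hl
  have hl1 : 1 < l := one_lt_ell (Nat.cast_nonneg _)
  have hnR : (3200:ℝ) ≤ n := by exact_mod_cast hN
  set δ : ℝ := 1 / (25 * l ^ 2) with hδ
  have hl2 : 1 ≤ l ^ 2 := by nlinarith
  have hδ0 : 0 < δ := by positivity
  have hδ1 : δ ≤ 1 / 25 := by
    rw [hδ]; apply one_div_le_one_div_of_le <;> linarith
  set L := ⌈4 * l / δ⌉₊ + 1 with hL
  have hLlow : 4 * l / δ < L := by
    rw [hL]; push_cast; have := Nat.le_ceil (4 * l / δ); linarith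
  have hLup : (L:ℝ) + 1 ≤ 7 * l / δ := by
    have h1 := (Nat.ceil_lt_add_one (show 0 ≤ 4 * l / δ by positivity)).le
    have h2 : 1 ≤ l / δ := by rw [le_div_iff₀ hδ0]; linarith
    rw [hL]; push_cast
    have e1 : 4 * l / δ = 4 * (l / δ) := by ring
    have e2 : 7 * l / δ = 7 * (l / δ) := by ring
    rw [e2]; linarith
  have hpow : (n:ℝ) < (1 + δ / 2) ^ L := by
    have h1 : Real.log n < L * Real.log (1 + δ / 2) := by
      have h2 : δ / 4 ≤ Real.log (1 + δ / 2) := by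
        have h3 := Real.one_sub_inv_le_log_of_pos (show 0 < 1 + δ / 2 by linarith)
        have h4 : δ / 4 ≤ 1 - (1 + δ / 2)⁻¹ := by
          rw [inv_eq_one_div, le_sub_iff_add_le, ← le_sub_iff_add_le', div_le_iff₀ (by linarith)]
          nlinarith
        linarith
      have h5 : Real.log n ≤ l := by
        rw [hl, ell]; exact Real.log_le_log (by linarith) (by linarith)
      have h6 : l < L * (δ / 4) := by
        have h7 : 4 * l < L * δ := by rwa [div_lt_iff₀ hδ0] at hLlow
        linarith
      have h8 : L * (δ / 4) ≤ L * Real.log (1 + δ / 2) := by gcongr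
      linarith
    rw [← Real.log_pow] at h1
    exact (Real.log_lt_log_iff (by linarith) (by positivity)).1 h1
  set C := ⌈(n:ℝ) * (L + 1) / (200 * δ)⌉₊ with hC
  have hClow : (n:ℝ) * (L + 1) ≤ 200 * δ * C := by
    have := Nat.le_ceil ((n:ℝ) * (L + 1) / (200 * δ))
    rw [div_le_iff₀ (by positivity)] at this
    rw [hC]; linarith
  have hCup : (C:ℝ) ≤ n * (7 * l / δ) / (100 * δ) := by
    have h1 := (Nat.ceil_lt_add_one (show 0 ≤ (n:ℝ) * (L + 1) / (200 * δ) by positivity)).le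
    have h2 : (n:ℝ) * (L + 1) / (200 * δ) ≤ n * (7 * l / δ) / (200 * δ) := by gcongr
    have h3 : 1 ≤ n * (7 * l / δ) / (200 * δ) := by
      rw [le_div_iff₀ (by positivity), ]
      have h4 : 1 ≤ 7 * l / δ := by rw [le_div_iff₀ hδ0]; linarith
      nlinarith
    have e : n * (7 * l / δ) / (100 * δ) = n * (7 * l / δ) / (200 * δ) + n * (7 * l / δ) / (200 * δ) := by
      field_simp; ring
    rw [e]; linarith
  obtain ⟨F, hF, hFc⟩ := routing (fun x y => Hit (S x) (S y)) (fun a b h => h.symm) δ hδ0 hδ1 L C hpow hClow (by omega) hsep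
  have hd := dense_of_routing hS hF (by nlinarith) (by omega)
  rw [← hn] at hFc hd
  have hFR : (n:ℝ) ^ 2 / 400 ≤ F.card := by
    have : (n:ℝ) ^ 2 ≤ 400 * F.card := by exact_mod_cast hFc
    linarith
  have hdR : (F.card:ℝ) ^ 3 ≤ 512 * n ^ 2 * (C ^ 2 * (hp S Finset.univ).card) := by exact_mod_cast hd
  set H : ℝ := ((hp S Finset.univ).card : ℝ) with hH
  have hH0 : 0 ≤ H := Nat.cast_nonneg _
  have h1 : ((n:ℝ) ^ 2 / 400) ^ 3 ≤ 512 * n ^ 2 * ((n * (7 * l / δ) / (100 * δ)) ^ 2 * H) := by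
    refine le_trans (by gcongr) (hdR.trans ?_)
    gcongr
  have e2 : n * (7 * l / δ) / (100 * δ) = n * (7 * 625 / 100 * l ^ 5) := by
    rw [hδ]; field_simp; ring
  rw [e2] at h1
  have hn4 : (0:ℝ) < (n:ℝ) ^ 4 := by positivity
  have h2 : (n:ℝ) ^ 4 * n ^ 2 ≤ n ^ 4 * (10 ^ 14 * l ^ 10 * H) := by
    have : (n:ℝ) ^ 4 * n ^ 2 ≤ 400 ^ 3 * (512 * n ^ 2 * ((n * (7 * 625 / 100 * l ^ 5)) ^ 2 * H)) := by
      calc (n:ℝ) ^ 4 * n ^ 2 = 400 ^ 3 * ((n:ℝ) ^ 2 / 400) ^ 3 := by ring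
        _ ≤ _ := by gcongr
    refine this.trans ?_
    have e3 : 400 ^ 3 * (512 * (n:ℝ) ^ 2 * ((n * (7 * 625 / 100 * l ^ 5)) ^ 2 * H)) =
      (400 ^ 3 * 512 * (7 * 625 / 100) ^ 2) * (n ^ 4 * l ^ 10 * H) := by ring
    have e4 : (n:ℝ) ^ 4 * (10 ^ 14 * l ^ 10 * H) = 10 ^ 14 * (n ^ 4 * l ^ 10 * H) := by ring
    rw [e3, e4]
    apply mul_le_mul_of_nonneg_right _ (by positivity)
    norm_num
  exact le_of_mul_le_mul_left h2 hn4

/-- ordered off-diagonal hitting pairs -/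
noncomputable def eo (S : ι → Set P) (V : Finset ι) : ℕ := by
  classical exact ((hp S V).filter (fun q => q.1 ≠ q.2)).card

lemma mem_hp {S : ι → Set P} {V : Finset ι} {q : ι × ι} : q ∈ hp S V ↔ (q.1 ∈ V ∧ q.2 ∈ V) ∧ Hit (S q.1) (S q.2) := by
  simp [hp]

set_option maxHeartbeats 1000000 in
open Classical in
theorem to_dense [Fintype ι] {S : ι → Set P} (hS : ∀ i, IsStr (S i)) (D : ℝ) (hD : 3200 ≤ D)
    (hne : 0 < Fintype.card ι)
    (he : 2 * D * Fintype.card ι ≤ eo S Finset.univ) :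
    ∃ V : Finset ι, D ≤ V.card ∧ (V.card : ℝ) ^ 2 ≤ 10 ^ 14 * ell V.card ^ 10 * (hp S V).card := by
  set h : ℝ → ℝ := fun x => D * (2 - 1 / ell x) with hh
  have hD0 : 0 < D := by linarith
  have hup : ∀ x, 0 ≤ x → h x ≤ 2 * D := by
    intro x hx
    have := one_lt_ell hx
    have h1 : 0 < 1 / ell x := by positivity
    simp only [hh]; nlinarith
  have hlow : ∀ x, 0 ≤ x → D ≤ h x := by
    intro x hx
    have := one_lt_ell hx
    have h1 : 1 / ell x ≤ 1 := by rw [div_le_one (by linarith)]; linarith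
    simp only [hh]; nlinarith
  have hmono : ∀ x y, 0 ≤ x → x ≤ y → h x ≤ h y := by
    intro x y hx hxy
    have h1 := one_lt_ell hx
    have h2 : ell x ≤ ell y := Real.log_le_log (by linarith) (by linarith)
    have h3 : 1 / ell y ≤ 1 / ell x := one_div_le_one_div_of_le (by linarith) h2
    simp only [hh]; nlinarith
  have hex : ∃ k : ℕ, ∃ V : Finset ι, V.Nonempty ∧ V.card = k ∧ (k:ℝ) * h k ≤ eo S V := by
    refine ⟨_, Finset.univ, Finset.card_pos.1 (by simpa using hne), rfl, ?_⟩
    rw [Finset.card_univ]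
    have := hup (Fintype.card ι) (Nat.cast_nonneg _)
    have h0 : (0:ℝ) ≤ Fintype.card ι := Nat.cast_nonneg _
    nlinarith
  obtain ⟨V, hVn, hVk, hVe⟩ := Nat.find_spec hex
  have hmin : ∀ V' : Finset ι, V'.card < V.card → (eo S V' : ℝ) ≤ V'.card * h V'.card := by
    intro V' hV'
    rcases V'.eq_empty_or_nonempty with rfl | hn'
    · simp [eo, hp]
    by_contra hc
    push Not at hc
    rw [hVk] at hV'
    exact Nat.find_min hex hV' ⟨V', hn', rfl, hc.le⟩
  rw [← hVk] at hVe
  set N := V.card with hN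
  have hNpos : 0 < N := hVn.card_pos
  have hNR : (0:ℝ) < N := by exact_mod_cast hNpos
  have hNB : D ≤ N := by
    have h1 : eo S V ≤ N * N := by
      unfold eo
      refine (Finset.card_filter_le _ _).trans ((Finset.card_filter_le _ _).trans ?_)
      rw [Finset.card_product]
    have h1R : (eo S V : ℝ) ≤ N * N := by exact_mod_cast h1
    have h2 : (N:ℝ) * h N ≤ N * N := hVe.trans h1R
    exact (hlow N hNR.le).trans (le_of_mul_le_mul_left h2 hNR)
  refine ⟨V, hNB, ?_⟩
  have hcard : Fintype.card V = N := by simp [hN]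
  have hd := dense_of_nosep (ι := V) (S := fun i => S i) (fun i => hS i) (by rw [hcard]; exact_mod_cast hD.trans hNB) ?_
  · rw [hcard] at hd
    have : (hp (fun i : V => S i) Finset.univ).card ≤ (hp S V).card := by
      refine Finset.card_le_card_of_injOn (fun q => (q.1.1, q.2.1)) ?_ ?_
      · rintro ⟨x, y⟩ hq
        rw [Finset.mem_coe, mem_hp] at *
        exact ⟨⟨x.2, y.2⟩, hq.2⟩
      · rintro ⟨x, y⟩ _ ⟨x', y'⟩ _ h
        simp only [Prod.mk.injEq] at h
        exact Prod.ext (Subtype.ext h.1) (Subtype.ext h.2)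
    have hR : ((hp (fun i : V => S i) Finset.univ).card : ℝ) ≤ (hp S V).card := by exact_mod_cast this
    refine hd.trans ?_
    have := one_lt_ell hNR.le
    gcongr
  · rw [hcard]
    intro A T B hun0 dAT dAB dTB hno hTc hAc hBc
    have hun' : ∀ z : V, z ∈ A ∨ z ∈ T ∨ z ∈ B := by
      intro z
      have h0 := Finset.mem_univ z
      rw [← hun0] at h0
      simpa [Finset.mem_union, or_assoc] using h0
    have hun : A ∪ T ∪ B = Finset.univ := by
      ext z; simpa [Finset.mem_union, or_assoc] using hun' z
    have hl1 := one_lt_ell hNR.le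
    have hN3 : (3200:ℝ) ≤ N := hD.trans hNB
    set l := ell N with hl
    -- lift
    let m : Finset V → Finset ι := fun X => X.map (Function.Embedding.subtype _)
    have hmc : ∀ X, (m X).card = X.card := fun X => Finset.card_map _
    have hsplit : eo S V ≤ eo S (m (A ∪ T)) + eo S (m (B ∪ T)) := by
      unfold eo
      refine le_trans (Finset.card_le_card ?_) (Finset.card_union_le _ _)
      rintro ⟨x, y⟩ hq
      rw [Finset.mem_filter, mem_hp] at hq
      obtain ⟨⟨⟨hx, hy⟩, hxy⟩, hnexy⟩ := hq
      simp only at hx hy hxy hnexy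
      have hxu : (⟨x, hx⟩ : V) ∈ A ∪ T ∪ B := by rw [hun]; simp
      have hyu : (⟨y, hy⟩ : V) ∈ A ∪ T ∪ B := by rw [hun]; simp
      have hmm : ∀ (X : Finset V) (z : ι) (hz : z ∈ V), (⟨z, hz⟩ : V) ∈ X → z ∈ m X := by
        intro X z hz hzX
        exact Finset.mem_map.2 ⟨⟨z, hz⟩, hzX, rfl⟩
      have key : ((⟨x, hx⟩ : V) ∈ A ∪ T ∧ (⟨y, hy⟩ : V) ∈ A ∪ T) ∨ ((⟨x, hx⟩ : V) ∈ B ∪ T ∧ (⟨y, hy⟩ : V) ∈ B ∪ T) := by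
        have n1 := hno ⟨x, hx⟩
        have n2 := fun h => hno ⟨y, hy⟩ h ⟨x, hx⟩
        simp only [Finset.mem_union] at *
        have hyx := hxy.symm
        tauto
      rw [Finset.mem_union, Finset.mem_filter, Finset.mem_filter, mem_hp, mem_hp]
      rcases key with ⟨k1, k2⟩ | ⟨k1, k2⟩
      · left; exact ⟨⟨⟨hmm _ _ _ k1, hmm _ _ _ k2⟩, hxy⟩, hnexy⟩
      · right; exact ⟨⟨⟨hmm _ _ _ k1, hmm _ _ _ k2⟩, hxy⟩, hnexy⟩
    have cAT : (A ∪ T).card = A.card + T.card := Finset.card_union_of_disjoint dAT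
    have cBT : (B ∪ T).card = B.card + T.card := Finset.card_union_of_disjoint dTB.symm
    have ctot : A.card + T.card + B.card = N := by
      rw [← cAT, ← Finset.card_union_of_disjoint, hun, Finset.card_univ, hcard]
      rw [Finset.disjoint_union_left]; exact ⟨dAB, dTB⟩
    have ctotR : (A.card : ℝ) + T.card + B.card = N := by exact_mod_cast ctot
    have hδ : 1 / (25 * l ^ 2) ≤ 1 / 25 := one_div_le_one_div_of_le (by norm_num) (by nlinarith)
    have hT4 : (T.card : ℝ) ≤ 0.04 * N := by
      refine hTc.trans ?_
      nlinarith
    have s1 : ∀ X : Finset V, (X.card : ℝ) ≤ 0.84 * N → (eo S (m X) : ℝ) ≤ X.card * h (0.84 * N) := by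
      intro X hX
      have h1 : (m X).card < V.card := by
        rw [hmc, ← hN]
        have : (X.card : ℝ) < N := by linarith
        exact_mod_cast this
      refine (hmin _ h1).trans ?_
      rw [hmc]
      have := hmono X.card (0.84 * N) (Nat.cast_nonneg _) hX
      gcongr
    have s2 := s1 (A ∪ T) (by rw [cAT]; push_cast; linarith)
    have s3 := s1 (B ∪ T) (by rw [cBT]; push_cast; linarith)
    rw [cAT] at s2; rw [cBT] at s3
    push_cast at s2 s3
    have hsR : (eo S V : ℝ) ≤ eo S (m (A ∪ T)) + eo S (m (B ∪ T)) := by exact_mod_cast hsplit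
    have hl'1 := one_lt_ell (show 0 ≤ 0.84 * (N:ℝ) by positivity)
    have hbig : (N:ℝ) * h N ≤ (N + T.card) * h (0.84 * N) := by
      have : (N + T.card) * h (0.84 * N) = (A.card + T.card) * h (0.84 * N) + (B.card + T.card) * h (0.84 * N) := by
        rw [← ctotR]; ring
      rw [this]; linarith
    have hpos84 : 0 < h (0.84 * N) := lt_of_lt_of_le hD0 (hlow _ (by positivity))
    have hbig2 : h N ≤ (1 + 1 / (25 * l ^ 2)) * h (0.84 * N) := by
      have : (N:ℝ) * h N ≤ N * ((1 + 1 / (25 * l ^ 2)) * h (0.84 * N)) := by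
        calc (N:ℝ) * h N ≤ (N + T.card) * h (0.84 * N) := hbig
          _ ≤ (N + 1 / (25 * l ^ 2) * N) * h (0.84 * N) := by gcongr
          _ = _ := by ring
      exact le_of_mul_le_mul_left this hNR
    simp only [hh] at hbig2
    rw [← hl] at hbig2
    set l' := ell (0.84 * N) with hl'
    have hll : l' + 0.08 ≤ l := by
      have h1 := Real.one_sub_inv_le_log_of_pos (show 0 < ((N:ℝ) + 3) / (0.84 * N + 3) by positivity)
      rw [Real.log_div (by positivity) (by positivity), inv_div] at h1
      have h2 : (0.84 * (N:ℝ) + 3) / (N + 3) ≤ 0.92 := by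
        rw [div_le_iff₀ (by positivity)]; linarith
      have h3 : l - l' = Real.log ((N:ℝ) + 3) - Real.log (0.84 * N + 3) := rfl
      linarith
    have hb3 : 2 - 1 / l ≤ (1 + 1 / (25 * l ^ 2)) * (2 - 1 / l') := by
      have : D * (2 - 1 / l) ≤ D * ((1 + 1 / (25 * l ^ 2)) * (2 - 1 / l')) := by linarith
      exact le_of_mul_le_mul_left this hD0
    have h5 : 1 / l' - 1 / l ≥ 0.08 / l ^ 2 := by
      rw [div_sub_div _ _ (by positivity) (by positivity), ge_iff_le, div_le_div_iff₀ (by positivity) (by positivity)]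
      have : l' * l ≤ l ^ 2 := by nlinarith
      nlinarith
    have h6 : 0.08 / l ^ 2 = 2 * (1 / (25 * l ^ 2)) := by field_simp; norm_num
    have h7 : 0 < 1 / (25 * l ^ 2) * (1 / l') := by positivity
    nlinarith
end
end CBP

namespace CBP
section
variable {ι : Type*}

/-- two lists share a vertex -/
def HitL (l m : List P) : Prop := ∃ x, x ∈ l ∧ x ∈ m
lemma HitL.symm {l m : List P} (h : HitL l m) : HitL m l := by
  obtain ⟨x, h1, h2⟩ := h; exact ⟨x, h2, h1⟩

/-- part of `l` before `c` -/
def pre (l c : List P) : List P := l.takeWhile (fun x => decide (x ∉ c))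

lemma pre_sub {l c : List P} {x : P} (h : x ∈ pre l c) : x ∈ l :=
  (List.takeWhile_sublist _).subset h

lemma pre_avoid {l c : List P} {x : P} (h : x ∈ pre l c) : x ∉ c := by
  have := List.mem_takeWhile_imp h; simpa using this

lemma pre_cons_notMem {a : P} {l c : List P} (h : a ∉ c) : pre (a :: l) c = a :: pre l c := by
  simp [pre, h]

lemma trich {l c d : List P} (hc : HitL l c) (hd : HitL l d) :
    HitL (pre l d) c ∨ HitL (pre l c) d ∨ ∃ y, l.find? (fun x => decide (x ∈ d)) = some y ∧ y ∈ c := by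
  induction l with
  | nil => obtain ⟨x, hx, _⟩ := hc; simp at hx
  | cons a l ih =>
    by_cases h1 : a ∈ d
    · by_cases h2 : a ∈ c
      · right; right; exact ⟨a, by simp [h1], h2⟩
      · right; left; exact ⟨a, by simp [pre, h2], h1⟩
    · by_cases h2 : a ∈ c
      · left; exact ⟨a, by simp [pre, h1], h2⟩
      · have hc' : HitL l c := by
          obtain ⟨x, hx, hx'⟩ := hc
          rcases List.mem_cons.1 hx with rfl | hx
          · exact absurd hx' h2
          · exact ⟨x, hx, hx'⟩
        have hd' : HitL l d := by
          obtain ⟨x, hx, hx'⟩ := hd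
          rcases List.mem_cons.1 hx with rfl | hx
          · exact absurd hx' h1
          · exact ⟨x, hx, hx'⟩
        rcases ih hc' hd' with ⟨x, h3, h4⟩ | ⟨x, h3, h4⟩ | ⟨y, h3, h4⟩
        · left; exact ⟨x, by rw [pre_cons_notMem h1]; exact List.mem_cons_of_mem _ h3, h4⟩
        · right; left; exact ⟨x, by rw [pre_cons_notMem h2]; exact List.mem_cons_of_mem _ h3, h4⟩
        · right; right; exact ⟨y, by simpa [h1] using h3, h4⟩

lemma pre_wk {l c : List P} {a b : P} (h : Wk a b l) (hne : pre l c ≠ []) (hc : HitL l c) :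
    ∃ v y, Wk a v (pre l c) ∧ LAdj v y ∧ y ∈ c := by
  induction h with
  | nil a =>
    obtain ⟨x, hx, hx'⟩ := hc
    simp only [List.mem_singleton] at hx; subst hx
    simp [pre, hx'] at hne
  | @cons a b e l hab hl ih =>
    have ha : a ∉ c := by
      intro ha; simp [pre, ha] at hne
    have hpre : pre (a :: l) c = a :: pre l c := by simp [pre, ha]
    have hc' : HitL l c := by
      obtain ⟨x, hx, hx'⟩ := hc
      rcases List.mem_cons.1 hx with rfl | hx
      · exact absurd hx' ha
      · exact ⟨x, hx, hx'⟩
    by_cases hn : pre l c = []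
    · rw [hpre, hn]
      refine ⟨a, b, Wk.nil a, hab, ?_⟩
      obtain ⟨l', rfl⟩ := hl.head
      by_contra hb; simp [pre, hb] at hn
    · obtain ⟨v, y, h1, h2, h3⟩ := ih hn hc'
      rw [hpre]
      exact ⟨v, y, Wk.cons hab h1, h2, h3⟩

lemma pre_wk_all {l c : List P} {a b : P} (h : Wk a b l) (hne : pre l c ≠ []) :
    ∃ v, Wk a v (pre l c) := by
  by_cases hc : HitL l c
  · obtain ⟨v, y, h1, _⟩ := pre_wk h hne hc; exact ⟨v, h1⟩
  · have : pre l c = l := by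
      unfold pre; rw [List.takeWhile_eq_self_iff]
      intro x hx; simp only [decide_eq_true_eq]; exact fun h => hc ⟨x, hx, h⟩
    rw [this]; exact ⟨b, h⟩

open Classical in
/-- hitting pairs rows/columns -/
noncomputable def hc (R C : Finset ι) (f c : ι → List P) : Finset (ι × ι) :=
  (R ×ˢ C).filter (fun q => HitL (f q.1) (c q.2))

lemma mem_hc {R C : Finset ι} {f c : ι → List P} {q : ι × ι} :
    q ∈ hc R C f c ↔ (q.1 ∈ R ∧ q.2 ∈ C) ∧ HitL (f q.1) (c q.2) := by simp [hc]

open Classical in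
theorem T1core {R C : Finset ι} {f c : ι → List P} {bad : ι → ι → Prop} {N t : ℕ} {d η : ℝ}
    (hd : 0 < d) (hη : η ≤ d ^ 2 / 8) (ht : (t : ℝ) ≤ d ^ 2 * N / 4) (hN : 0 < N) (hR : R.card ≤ N) (hC : C.card ≤ N)
    (hthin : ∀ x, (C.filter (fun i => x ∈ c i)).card ≤ t)
    (hbad : (((C ×ˢ C).filter (fun q => bad q.1 q.2)).card : ℝ) ≤ η * N ^ 2)
    (hhits : d * N ^ 2 ≤ (hc R C f c).card) :
    ∃ i0 ∈ C, d ^ 2 / 4 * N ^ 2 ≤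
      (((R ×ˢ C).filter (fun q => HitL (f q.1) (c i0) ∧ ¬ bad q.2 i0 ∧ HitL (pre (f q.1) (c i0)) (c q.2))).card : ℝ) := by
  have hNR : (0:ℝ) < N := by exact_mod_cast hN
  set T : ι → ι → ι → Prop := fun b i i0 => HitL (f b) (c i0) ∧ HitL (pre (f b) (c i0)) (c i) with hT
  set M : ι → ℕ := fun i0 => ((R ×ˢ C).filter (fun q => HitL (f q.1) (c i0) ∧ ¬ bad q.2 i0 ∧ HitL (pre (f q.1) (c i0)) (c q.2))).card with hM
  set h : ι → ℕ := fun b => (C.filter (fun i => HitL (f b) (c i))).card with hh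
  have hsum : (hc R C f c).card = ∑ b ∈ R, h b := by
    simp only [hc, hh, Finset.card_filter, Finset.sum_product]
  have hCn : C.Nonempty := by
    by_contra hcn
    rw [Finset.not_nonempty_iff_eq_empty] at hcn
    have : (hc R C f c).card = 0 := by simp [hc, hcn]
    rw [this] at hhits
    have : 0 < d * (N:ℝ) ^ 2 := by positivity
    simp at hhits; linarith
  obtain ⟨i0, hi0, hmax⟩ := Finset.exists_max_image C M hCn
  refine ⟨i0, hi0, ?_⟩
  change _ ≤ (M i0 : ℝ)
  set T' : ι → ℕ := fun b => ((C ×ˢ C).filter (fun q => T b q.1 q.2 ∧ ¬ bad q.1 q.2)).card with hT'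
  set bd := ((C ×ˢ C).filter (fun q => bad q.1 q.2)).card with hbd
  have hrow : ∀ b ∈ R, h b ^ 2 ≤ 2 * T' b + 2 * bd + N * t := by
    intro b hb
    have e1 : h b ^ 2 = ((C.filter (fun i => HitL (f b) (c i))) ×ˢ (C.filter (fun i => HitL (f b) (c i)))).card := by
      rw [Finset.card_product, pow_two]
    set TT := (C ×ˢ C).filter (fun q => T b q.1 q.2) with hTT
    set Zp : ι → ι → Prop := fun i j => ∃ y, (f b).find? (fun x => decide (x ∈ c j)) = some y ∧ y ∈ c i with hZp
    have hZps : ∀ i j, HitL (f b) (c i) → HitL (f b) (c j) → HitL (pre (f b) (c j)) (c i) ∨ HitL (pre (f b) (c i)) (c j) ∨ Zp i j := by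
      intro i j h1 h2
      rcases trich h1 h2 with h3 | h3 | ⟨y, h3, h4⟩
      · exact Or.inl h3
      · exact Or.inr (Or.inl h3)
      · refine Or.inr (Or.inr ⟨y, ?_, h4⟩); convert h3
    set Z := (C ×ˢ C).filter (fun q => Zp q.1 q.2) with hZ
    have hsub : (C.filter (fun i => HitL (f b) (c i))) ×ˢ (C.filter (fun i => HitL (f b) (c i))) ⊆
        TT ∪ (TT.image Prod.swap ∪ Z) := by
      rintro ⟨i, j⟩ hij
      simp only [Finset.mem_product, Finset.mem_filter] at hij
      obtain ⟨⟨hi, hbi⟩, ⟨hj, hbj⟩⟩ := hij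
      simp only [Finset.mem_union]
      rcases hZps i j hbi hbj with h1 | h1 | h1
      · left; rw [hTT, Finset.mem_filter]; exact ⟨by simp [hi, hj], hbj, h1⟩
      · right; left
        refine Finset.mem_image.2 ⟨(j, i), ?_, rfl⟩
        rw [hTT, Finset.mem_filter]; exact ⟨by simp [hi, hj], hbi, h1⟩
      · right; right; rw [hZ, Finset.mem_filter]; exact ⟨by simp [hi, hj], h1⟩
    have hTTc : TT.card ≤ T' b + bd := by
      have : TT ⊆ (C ×ˢ C).filter (fun q => T b q.1 q.2 ∧ ¬ bad q.1 q.2) ∪ (C ×ˢ C).filter (fun q => bad q.1 q.2) := by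
        intro q hq
        rw [hTT, Finset.mem_filter] at hq
        rw [Finset.mem_union, Finset.mem_filter, Finset.mem_filter]
        by_cases hbq : bad q.1 q.2
        · exact Or.inr ⟨hq.1, hbq⟩
        · exact Or.inl ⟨hq.1, hq.2, hbq⟩
      exact (Finset.card_le_card this).trans (Finset.card_union_le _ _)
    have hZc : Z.card ≤ N * t := by
      have : Z.card = ∑ j ∈ C, (C.filter (fun i => Zp i j)).card := by
        simp only [hZ, Finset.card_filter, Finset.sum_product]
        rw [Finset.sum_comm]
      rw [this]
      refine (Finset.sum_le_card_nsmul C _ t fun j hj => ?_).trans (by rw [smul_eq_mul]; exact Nat.mul_le_mul_right _ hC)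
      by_cases hex : ∃ y, (f b).find? (fun x => decide (x ∈ c j)) = some y
      swap
      · rw [Finset.card_eq_zero.2]
        · exact Nat.zero_le _
        · rw [Finset.filter_eq_empty_iff]
          rintro i _ ⟨y, h1, _⟩; exact hex ⟨y, h1⟩
      · obtain ⟨y, hf⟩ := hex
        refine le_trans (Finset.card_le_card ?_) (hthin y)
        intro i hi
        rw [Finset.mem_filter] at hi ⊢
        obtain ⟨h1, y', h2, h3⟩ := hi
        rw [hf] at h2; cases h2; exact ⟨h1, h3⟩
    rw [e1]
    have h1 := Finset.card_le_card hsub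
    have h2 := Finset.card_union_le TT (TT.image Prod.swap ∪ Z)
    have h3 := Finset.card_union_le (TT.image Prod.swap) Z
    have h4 : (TT.image Prod.swap).card ≤ TT.card := Finset.card_image_le
    omega
  have hT'sum : ∑ b ∈ R, T' b = ∑ i ∈ C, M i := by
    simp only [hT', hM, Finset.card_filter, Finset.sum_product]
    rw [Finset.sum_comm (s := C) (t := R)]
    refine Finset.sum_congr rfl fun b _ => ?_
    rw [Finset.sum_comm]
    refine Finset.sum_congr rfl fun i _ => Finset.sum_congr rfl fun j _ => ?_
    congr 1
    simp only [hT, eq_iff_iff]; tauto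
  have hMs : ∑ i ∈ C, M i ≤ N * M i0 :=
    (Finset.sum_le_card_nsmul C _ _ hmax).trans (by rw [smul_eq_mul]; exact Nat.mul_le_mul_right _ hC)
  have hsq : (∑ b ∈ R, h b) ^ 2 ≤ R.card * ∑ b ∈ R, h b ^ 2 := sq_sum_le_card_mul_sum_sq
  have hs2 : ∑ b ∈ R, h b ^ 2 ≤ 2 * (N * M i0) + N * (2 * bd + N * t) := by
    calc ∑ b ∈ R, h b ^ 2 ≤ ∑ b ∈ R, (2 * T' b + (2 * bd + N * t)) :=
          Finset.sum_le_sum fun b hb => by have := hrow b hb; omega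
      _ = 2 * ∑ b ∈ R, T' b + R.card * (2 * bd + N * t) := by
          rw [Finset.sum_add_distrib, ← Finset.mul_sum, Finset.sum_const, smul_eq_mul]
      _ ≤ _ := by
          rw [hT'sum]
          exact Nat.add_le_add (Nat.mul_le_mul_left _ hMs) (Nat.mul_le_mul_right _ hR)
  have hfin : (hc R C f c).card ^ 2 ≤ N * (2 * (N * M i0) + N * (2 * bd + N * t)) := by
    rw [hsum]; exact hsq.trans (Nat.mul_le_mul hR hs2)
  have hfinR : ((hc R C f c).card : ℝ) ^ 2 ≤ N * (2 * (N * M i0) + N * (2 * bd + N * t)) := by exact_mod_cast hfin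
  have h1 : (d * (N:ℝ) ^ 2) ^ 2 ≤ ((hc R C f c).card : ℝ) ^ 2 := by gcongr
  have h2 : (N:ℝ) ^ 2 * (d ^ 2 * N ^ 2) ≤ (N:ℝ) ^ 2 * (2 * (M i0:ℝ) + 2 * (η * (N:ℝ) ^ 2) + (N:ℝ) * t) := by
    calc (N:ℝ) ^ 2 * (d ^ 2 * N ^ 2) = (d * (N:ℝ) ^ 2) ^ 2 := by ring
      _ ≤ (N:ℝ) * (2 * ((N:ℝ) * (M i0:ℝ)) + (N:ℝ) * (2 * (bd:ℝ) + (N:ℝ) * (t:ℝ))) := h1.trans hfinR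
      _ = (N:ℝ) ^ 2 * (2 * (M i0:ℝ) + 2 * (bd:ℝ) + (N:ℝ) * t) := by ring
      _ ≤ _ := by gcongr
  have h3 := le_of_mul_le_mul_left h2 (by positivity)
  have h4 : η * (N:ℝ) ^ 2 ≤ d ^ 2 / 8 * N ^ 2 := by gcongr
  have h5 : (N:ℝ) * t ≤ N * (d ^ 2 * N / 4) := by gcongr
  nlinarith

open Classical in
theorem T1 {R C : Finset ι} {f c : ι → List P} {bad : ι → ι → Prop} {N t : ℕ} {d η : ℝ}
    (hd : 0 < d) (hη : η ≤ d ^ 2 / 8) (ht : (t : ℝ) ≤ d ^ 2 * N / 4) (hN : 0 < N) (hR : R.card ≤ N) (hC : C.card ≤ N)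
    (hthin : ∀ x, (C.filter (fun i => x ∈ c i)).card ≤ t)
    (hbad : (((C ×ˢ C).filter (fun q => bad q.1 q.2)).card : ℝ) ≤ η * N ^ 2)
    (s : ι → P) (hw : ∀ b ∈ R, ∃ v, Wk (s b) v (f b))
    (hhits : d * N ^ 2 ≤ (hc R C f c).card) :
    ∃ i0 ∈ C, ∃ R' ⊆ R, ∃ C' ⊆ C, ∃ f' : ι → List P, ∃ s' : ι → P,
      (∀ b ∈ R', f' b = (pre (f b) (c i0)).reverse ∧ Wk (s' b) (s b) (f' b) ∧ HitL (f b) (c i0) ∧ (∀ x ∈ f' b, x ∈ f b) ∧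
        (∀ x ∈ f' b, x ∉ c i0) ∧ ∃ y ∈ c i0, LAdj (s' b) y) ∧
      (∀ i ∈ C', ¬ bad i i0) ∧ d ^ 2 / 4 * N ^ 2 ≤ (hc R' C' f' c).card := by
  obtain ⟨i0, hi0, hM⟩ := T1core hd hη ht hN hR hC hthin hbad hhits
  set R' := R.filter (fun b => HitL (f b) (c i0) ∧ pre (f b) (c i0) ≠ []) with hR'
  have hex : ∀ b, ∃ v, b ∈ R' → Wk (s b) v (pre (f b) (c i0)) ∧ ∃ y ∈ c i0, LAdj v y := by
    intro b
    by_cases hb : b ∈ R'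
    · obtain ⟨hb1, hb2, hb3⟩ := Finset.mem_filter.1 hb
      obtain ⟨v, hv⟩ := hw b hb1
      obtain ⟨u, y, h1, h2, h3⟩ := pre_wk hv hb3 hb2
      exact ⟨u, fun _ => ⟨h1, y, h3, h2⟩⟩
    · exact ⟨(0, 0), fun h => absurd h hb⟩
  choose s' hs' using hex
  refine ⟨i0, hi0, R', Finset.filter_subset _ _, C.filter (fun i => ¬ bad i i0), Finset.filter_subset _ _,
    fun b => (pre (f b) (c i0)).reverse, s', ?_, ?_, ?_⟩
  · intro b hb
    obtain ⟨h1, h2⟩ := hs' b hb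
    refine ⟨rfl, h1.reverse, (Finset.mem_filter.1 hb).2.1, ?_, ?_, h2⟩
    · intro x hx; exact pre_sub (List.mem_reverse.1 hx)
    · intro x hx; exact pre_avoid (List.mem_reverse.1 hx)
  · intro i hi; exact (Finset.mem_filter.1 hi).2
  · refine hM.trans ?_
    norm_cast
    refine Finset.card_le_card ?_
    rintro ⟨b, i⟩ hq
    rw [Finset.mem_filter, Finset.mem_product] at hq
    obtain ⟨⟨hb, hi⟩, h1, h2, x, h3, h4⟩ := hq
    rw [mem_hc]
    refine ⟨⟨Finset.mem_filter.2 ⟨hb, h1, List.ne_nil_of_mem h3⟩, Finset.mem_filter.2 ⟨hi, h2⟩⟩, x, List.mem_reverse.2 h3, h4⟩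
end
end CBP

namespace CBP

/-- darts: a base point and a direction E,N,W,S -/
abbrev Dart := P × Fin 4

def hd (d : Dart) : P :=
  match d.2 with
  | 0 => (d.1.1 + 1, d.1.2)
  | 1 => (d.1.1, d.1.2 + 1)
  | 2 => (d.1.1 - 1, d.1.2)
  | 3 => (d.1.1, d.1.2 - 1)

/-- face to the left (lower left corner) -/
def lf (d : Dart) : P :=
  match d.2 with
  | 0 => (d.1.1, d.1.2)
  | 1 => (d.1.1 - 1, d.1.2)
  | 2 => (d.1.1 - 1, d.1.2 - 1)
  | 3 => (d.1.1, d.1.2 - 1)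

def rt (d : Dart) : P :=
  match d.2 with
  | 0 => (d.1.1, d.1.2 - 1)
  | 1 => (d.1.1, d.1.2)
  | 2 => (d.1.1 - 1, d.1.2)
  | 3 => (d.1.1 - 1, d.1.2 - 1)

lemma hd_adj (d : Dart) : LAdj d.1 (hd d) := by
  obtain ⟨⟨x, y⟩, e⟩ := d
  fin_cases e <;> simp [hd, LAdj]

lemma adj_hd {a b : P} (h : LAdj a b) : ∃ e, b = hd (a, e) := by
  obtain ⟨x, y⟩ := a; obtain ⟨s, t⟩ := b
  simp only [LAdj] at h
  rcases h with ⟨h1, h2 | h2⟩ | ⟨h1, h2 | h2⟩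
  · exact ⟨3, by simp [hd]; omega⟩
  · exact ⟨1, by simp [hd]; omega⟩
  · exact ⟨2, by simp [hd]; omega⟩
  · exact ⟨0, by simp [hd]; omega⟩

lemma hd_inj {a : P} {e e' : Fin 4} (h : hd (a, e) = hd (a, e')) : e = e' := by
  obtain ⟨x, y⟩ := a
  fin_cases e <;> fin_cases e' <;> simp [hd] at h ⊢ <;> omega

/-- edge indicator -/
def ee (a b u v : P) : ZMod 2 := if (a = u ∧ b = v) ∨ (a = v ∧ b = u) then 1 else 0

lemma ee_symm (a b u v : P) : ee a b u v = ee b a u v := by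
  unfold ee; congr 1; apply propext; tauto

/-- parity of traversals -/
def ec : List P → P → P → ZMod 2
  | [], _, _ => 0
  | [_], _, _ => 0
  | a :: b :: l, u, v => ee a b u v + ec (b :: l) u v

/-- indicator for telescoping -/
def ti (d : Dart) (p : P) : ZMod 2 :=
  match d.2 with
  | 0 => if p.2 = d.1.2 ∧ p.1 > d.1.1 then 1 else 0
  | 1 => 0
  | 2 => if p.2 = d.1.2 ∧ p.1 ≥ d.1.1 then 1 else 0
  | 3 => 0

lemma step_jump_nrm {a b : P} (h : Nrm a b) (d : Dart) :
    st a b (lf d) + st a b (rt d) = ee a b d.1 (hd d) + (ti d a + ti d b) := by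
  obtain ⟨⟨x, y⟩, e⟩ := d
  obtain ⟨p, q⟩ := a
  rcases h with rfl | rfl
  · rw [st_H, st_H]
    fin_cases e <;> simp only [lf, rt, hd, ti, ee, Prod.mk.injEq] <;>
      split_ifs <;> first | rfl | (exfalso; omega)
  · rw [st_V, st_V]
    have h6 : ¬ y = y - 1 := by omega
    have h7 : ¬ y + 1 = y - 1 := by omega
    have z : (1 : ZMod 2) + 1 = 0 := rfl
    fin_cases e <;> simp only [lf, rt, hd, ti, ee, Prod.mk.injEq] <;>
      by_cases h1 : q = y <;> by_cases h2 : q = y - 1 <;> by_cases h3 : p > x <;> by_cases h4 : p = x <;>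
      by_cases h5 : x ≤ p <;>
      first | (exfalso; omega) | (simp [h1, h2, h3, h4, h5, h6, h7, z]; done) | (simp [h1, h2, h3, h4, h5, h6, h7, z]; omega)

lemma step_jump {a b : P} (h : LAdj a b) (d : Dart) :
    st a b (lf d) + st a b (rt d) = ee a b d.1 (hd d) + (ti d a + ti d b) := by
  rcases h.nrm with h | h
  · exact step_jump_nrm h d
  · rw [st_symm a b, st_symm a b, ee_symm, add_comm (ti d a)]; exact step_jump_nrm h d

lemma z2 (x : ZMod 2) : x + x = 0 := by revert x; decide

lemma walk_jump {a b : P} {l : List P} (h : Wk a b l) (d : Dart) :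
    om l (lf d) + om l (rt d) = ec l d.1 (hd d) + (ti d a + ti d b) := by
  induction h with
  | nil a => simp [om, ec, z2]
  | @cons a b c l hab hl ih =>
    obtain ⟨l', rfl⟩ := hl.head
    have := step_jump hab d
    simp only [om, ec]
    have h2 := z2 (ti d b)
    linear_combination this + ih + h2

lemma closed_jump {a : P} {l : List P} (h : Wk a a l) (d : Dart) :
    om l (lf d) + om l (rt d) = ec l d.1 (hd d) := by
  rw [walk_jump h, z2, add_zero]

lemma ec_append {a b c : P} {l l' : List P} (h : Wk a b l) (h' : Wk b c l') (u v : P) :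
    ec (l ++ l'.tail) u v = ec l u v + ec l' u v := by
  induction h with
  | nil a => obtain ⟨m, rfl⟩ := h'.head; simp [ec]
  | @cons a b e l hab hl ih =>
    have := ih h'
    obtain ⟨m, rfl⟩ := hl.head
    simp only [List.cons_append, ec] at this ⊢
    rw [this, add_assoc]

lemma ec_zero {l : List P} {u v : P} (h : u ∉ l ∨ v ∉ l) : ec l u v = 0 := by
  induction l with
  | nil => rfl
  | cons a l ih =>
    cases l with
    | nil => rfl
    | cons b l =>
      simp only [ec]
      rw [ih (by rcases h with h | h
                 · exact Or.inl fun h' => h (List.mem_cons_of_mem _ h')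
                 · exact Or.inr fun h' => h (List.mem_cons_of_mem _ h')), add_zero, ee, if_neg]
      rintro (⟨rfl, rfl⟩ | ⟨rfl, rfl⟩) <;> simp at h

structure Inv (S : Finset P) (L : List Dart) : Prop where
  base : ∀ d ∈ L, d.1 ∈ S
  bnd : ∀ v ∈ S, ∀ e, hd (v, e) ∉ S → (v, e) ∈ L
  nd : L.Nodup
  ch : L.IsChain (fun a b => lf a = rt b)
  path : ∀ a ∈ S, ∀ b ∈ S, ∃ l, Wk a b l ∧ (∀ x ∈ l, x ∈ S) ∧ ∀ d ∈ L, ec l d.1 (hd d) = 0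

lemma inv_single (v : P) : Inv {v} [(v, 0), (v, 1), (v, 2), (v, 3)] where
  base := by simp
  bnd := by
    intro w hw e _
    rw [Finset.mem_singleton] at hw; subst hw
    fin_cases e <;> simp
  nd := by simp
  ch := by simp [lf, rt]
  path := by
    intro a ha b hb
    rw [Finset.mem_singleton] at ha hb; subst ha; subst hb
    exact ⟨[_], Wk.nil _, by simp, fun d _ => rfl⟩

/-- the three new darts -/
def nw (d : Dart) : List Dart := [(hd d, d.2 + 3), (hd d, d.2), (hd d, d.2 + 1)]

lemma nw_hd (d : Dart) : ∀ x ∈ nw d, hd x ≠ d.1 := by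
  obtain ⟨⟨x, y⟩, e⟩ := d
  intro z hz
  simp only [nw, List.mem_cons, List.not_mem_nil, or_false] at hz
  rcases hz with rfl | rfl | rfl <;> fin_cases e <;> simp [hd, Prod.ext_iff] <;> omega

lemma nw_all (d : Dart) (e : Fin 4) (h : hd (hd d, e) ≠ d.1) : (hd d, e) ∈ nw d := by
  obtain ⟨⟨x, y⟩, f⟩ := d
  fin_cases f <;> fin_cases e <;> simp [hd, nw, Prod.ext_iff] at h ⊢

lemma nw_ch (d : Dart) : lf (hd d, d.2 + 3) = rt (hd d, d.2) ∧ lf (hd d, d.2) = rt (hd d, d.2 + 1) ∧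
    rt (hd d, d.2 + 3) = rt d ∧ lf (hd d, d.2 + 1) = lf d := by
  obtain ⟨⟨x, y⟩, f⟩ := d
  fin_cases f <;> simp [hd, lf, rt]

lemma nw_nd (d : Dart) : (nw d).Nodup := by
  obtain ⟨⟨x, y⟩, f⟩ := d
  fin_cases f <;> simp [nw]

lemma nw_base {d x : Dart} (h : x ∈ nw d) : x.1 = hd d := by
  simp only [nw, List.mem_cons, List.not_mem_nil, or_false] at h
  rcases h with rfl | rfl | rfl <;> rfl

lemma Inv.grow {S : Finset P} {L1 L2 : List Dart} {d : Dart} (h : Inv S (L1 ++ d :: L2)) (hw : hd d ∉ S) :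
    Inv (insert (hd d) S) (L1 ++ (nw d ++ L2)) := by
  have hdS : d.1 ∈ S := h.base d (by simp)
  have hnd := h.nd
  have hold : ∀ x, x ∈ L1 ∨ x ∈ L2 → x ∈ L1 ++ d :: L2 ∧ x ≠ d := by
    intro x hx
    refine ⟨by simp; tauto, ?_⟩
    rintro rfl
    rw [List.nodup_append] at hnd
    obtain ⟨_, h2, h3⟩ := hnd
    rcases hx with hx | hx
    · exact h3 x hx x (by simp) rfl
    · exact (List.nodup_cons.1 h2).1 hx
  have hmem : ∀ x, x ∈ L1 ++ (nw d ++ L2) → (x ∈ L1 ∨ x ∈ L2) ∨ x ∈ nw d := by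
    intro x hx; simp only [List.mem_append] at hx; tauto
  refine ⟨?_, ?_, ?_, ?_, ?_⟩
  · intro x hx
    rcases hmem x hx with hx | hx
    · exact Finset.mem_insert_of_mem (h.base x (hold x hx).1)
    · rw [nw_base hx]; exact Finset.mem_insert_self _ _
  · intro v hv e hve
    rw [Finset.mem_insert, not_or] at hve
    rcases Finset.mem_insert.1 hv with rfl | hv
    · have := nw_all d e (fun hh => hve.2 (hh ▸ hdS))
      simp [this]
    · have h1 := h.bnd v hv e hve.2
      have h2 : (v, e) ≠ d := by rintro rfl; exact hve.1 rfl
      simp only [List.mem_append, List.mem_cons] at h1 ⊢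
      tauto
  · rw [List.nodup_append, List.nodup_append]
    rw [List.nodup_append, List.nodup_cons] at hnd
    obtain ⟨h1, ⟨h2, h2'⟩, h3⟩ := hnd
    refine ⟨h1, ⟨nw_nd d, h2', ?_⟩, ?_⟩
    · rintro a ha b hb rfl
      apply hw; rw [← nw_base ha]; exact h.base a (hold a (Or.inr hb)).1
    · rintro a ha b hb rfl
      rcases List.mem_append.1 hb with hb | hb
      · apply hw; rw [← nw_base hb]; exact h.base a (hold a (Or.inl ha)).1
      · exact h3 a ha a (List.mem_cons_of_mem _ hb) rfl
  · obtain ⟨c1, c2, c3, c4⟩ := nw_ch d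
    have hc := h.ch
    rw [List.isChain_append] at hc ⊢
    obtain ⟨h1, h2, h3⟩ := hc
    refine ⟨h1, ?_, ?_⟩
    · simp only [nw, List.cons_append, List.nil_append]
      rw [List.isChain_cons_cons, List.isChain_cons_cons]
      refine ⟨c1, c2, ?_⟩
      rw [List.isChain_cons] at h2 ⊢
      exact ⟨fun y hy => c4.trans (h2.1 y hy), h2.2⟩
    · intro x hx y hy
      simp only [nw, List.cons_append, List.head?_cons, Option.mem_def, Option.some.injEq] at hy
      subst hy
      rw [c3]; exact h3 x hx d (by simp)
  · have hnz : ∀ l : List P, (∀ x ∈ l, x ∈ S) → (∀ x ∈ L1 ++ d :: L2, ec l x.1 (hd x) = 0) →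
        ∀ x ∈ L1 ++ (nw d ++ L2), ec l x.1 (hd x) = 0 := by
      intro l hl hl' x hx
      rcases hmem x hx with hx | hx
      · exact hl' x (hold x hx).1
      · refine ec_zero (Or.inl fun hh => hw ?_)
        rw [← nw_base hx]; exact hl _ hh
    have hst : ∀ x ∈ L1 ++ (nw d ++ L2), ec [d.1, hd d] x.1 (hd x) = 0 := by
      intro x hx
      simp only [ec, add_zero, ee]
      rw [if_neg]
      rcases hmem x hx with hx | hx
      · rintro (⟨h1, h2⟩ | ⟨h1, h2⟩)
        · apply (hold x hx).2
          obtain ⟨v, e⟩ := x; obtain ⟨v', e'⟩ := d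
          simp only at h1; subst h1
          rw [hd_inj h2]
        · apply hw; rw [h2]; exact h.base x (hold x hx).1
      · rintro (⟨h1, h2⟩ | ⟨h1, h2⟩)
        · apply hw; rw [← nw_base hx, ← h1]; exact hdS
        · exact nw_hd d x hx h1.symm
    have hst' : ∀ x ∈ L1 ++ (nw d ++ L2), ec [hd d, d.1] x.1 (hd x) = 0 := by
      intro x hx
      have := hst x hx
      simp only [ec] at this ⊢
      rw [ee_symm]; exact this
    have w1 : Wk d.1 (hd d) [d.1, hd d] := Wk.cons (hd_adj d) (Wk.nil _)
    have w2 : Wk (hd d) d.1 [hd d, d.1] := Wk.cons (hd_adj d).symm (Wk.nil _)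
    intro a ha b hb
    rcases Finset.mem_insert.1 ha with rfl | ha
    · rcases Finset.mem_insert.1 hb with rfl | hb
      · exact ⟨[hd d], Wk.nil _, by simp, fun d _ => rfl⟩
      · obtain ⟨l, hl1, hl2, hl3⟩ := h.path d.1 hdS b hb
        refine ⟨_, w2.append hl1, ?_, ?_⟩
        · intro x hx
          rcases List.mem_append.1 hx with hx | hx
          · simp at hx; rcases hx with rfl | rfl <;> simp [hdS]
          · exact Finset.mem_insert_of_mem (hl2 x (List.mem_of_mem_tail hx))
        · intro x hx
          rw [ec_append w2 hl1, hst' x hx, hnz l hl2 hl3 x hx, add_zero]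
    · obtain ⟨l, hl1, hl2, hl3⟩ := h.path a ha d.1 hdS
      rcases Finset.mem_insert.1 hb with rfl | hb
      · refine ⟨_, hl1.append w1, ?_, ?_⟩
        · intro x hx
          rcases List.mem_append.1 hx with hx | hx
          · exact Finset.mem_insert_of_mem (hl2 x hx)
          · simp at hx; simp [hx]
        · intro x hx
          rw [ec_append hl1 w1, hst x hx, hnz l hl2 hl3 x hx, add_zero]
      · obtain ⟨l, hl1, hl2, hl3⟩ := h.path a ha b hb
        exact ⟨l, hl1, fun x hx => Finset.mem_insert_of_mem (hl2 x hx), hnz l hl2 hl3⟩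

lemma wk_exit {A : Set P} {a b : P} {l : List P} (h : Wk a b l) (ha : a ∈ A) (hb : b ∉ A) :
    ∃ v w, v ∈ l ∧ w ∈ l ∧ v ∈ A ∧ w ∉ A ∧ LAdj v w := by
  induction h with
  | nil a => exact absurd ha hb
  | @cons a b c l hab hl ih =>
    by_cases hbA : b ∈ A
    · obtain ⟨v, w, h1, h2, h3⟩ := ih hbA hb
      exact ⟨v, w, List.mem_cons_of_mem _ h1, List.mem_cons_of_mem _ h2, h3⟩
    · exact ⟨a, b, by simp, List.mem_cons_of_mem _ hl.left_mem, ha, hbA, hab⟩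

lemma grow_all (Z X : Finset P) (hd' : Disjoint Z X) (hX : ∀ a ∈ X, ∀ b ∈ X, Conn (↑X) a b) (n : ℕ) :
    ∀ (A : Finset P) (L1 M L2 : List Dart), A ⊆ X → A.Nonempty → (X \ A).card = n → Inv (Z ∪ A) (L1 ++ (M ++ L2)) →
      (∀ x ∈ M, x.1 ∈ X) → (∀ x ∈ L1, x.1 ∈ Z) → (∀ x ∈ L2, x.1 ∈ Z) →
      ∃ M', Inv (Z ∪ X) (L1 ++ (M' ++ L2)) ∧ ∀ x ∈ M', x.1 ∈ X := by
  induction n with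
  | zero =>
    intro A L1 M L2 hA _ hn hI hM _ _
    have : X = A := by
      rw [Finset.card_eq_zero, Finset.sdiff_eq_empty_iff_subset] at hn
      exact Finset.Subset.antisymm hn hA
    subst this; exact ⟨M, hI, hM⟩
  | succ n ih =>
    intro A L1 M L2 hA hne hn hI hM h1 h2
    obtain ⟨a, ha⟩ := hne
    have : (X \ A).Nonempty := by rw [← Finset.card_pos]; omega
    obtain ⟨b, hb⟩ := this
    rw [Finset.mem_sdiff] at hb
    obtain ⟨l, hl, hlX⟩ := hX a (hA ha) b hb.1
    obtain ⟨v, w, hv, hw, hvA, hwA, hvw⟩ := wk_exit (A := (↑A : Set P)) hl ha hb.2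
    obtain ⟨e, rfl⟩ := adj_hd hvw
    have hwX := hlX _ hw
    have hwZ : hd (v, e) ∉ Z ∪ A := by
      rw [Finset.mem_union, not_or]
      exact ⟨fun h => Finset.disjoint_left.1 hd' h hwX, hwA⟩
    have hvX : v ∈ X := hA hvA
    have hvZ : v ∉ Z := fun h => Finset.disjoint_left.1 hd' h hvX
    have hmem := hI.bnd v (Finset.mem_union_right _ hvA) e hwZ
    have hmM : (v, e) ∈ M := by
      rcases List.mem_append.1 hmem with h | h
      · exact absurd (h1 _ h) hvZ
      · rcases List.mem_append.1 h with h | h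
        · exact h
        · exact absurd (h2 _ h) hvZ
    obtain ⟨M1, M2, rfl⟩ := List.append_of_mem hmM
    have hI2 : Inv (Z ∪ A) ((L1 ++ M1) ++ (v, e) :: (M2 ++ L2)) := by simpa using hI
    have hI3 := hI2.grow hwZ
    refine ih (insert (hd (v, e)) A) L1 (M1 ++ (nw (v, e) ++ M2)) L2 ?_ ⟨_, Finset.mem_insert_self _ _⟩ ?_ ?_ ?_ h1 h2
    · intro x hx
      rcases Finset.mem_insert.1 hx with rfl | hx
      · exact hwX
      · exact hA hx
    · have : X \ insert (hd (v, e)) A = (X \ A).erase (hd (v, e)) := by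
        ext x; simp only [Finset.mem_sdiff, Finset.mem_insert, Finset.mem_erase]; tauto
      rw [this, Finset.card_erase_of_mem (Finset.mem_sdiff.2 ⟨hwX, hwA⟩), hn]; rfl
    · rw [Finset.union_insert]; simpa using hI3
    · intro x hx
      simp only [List.mem_append] at hx
      rcases hx with hx | hx | hx
      · exact hM x (by simp [hx])
      · rw [nw_base hx]; exact hwX
      · exact hM x (by simp [hx])

lemma contour (X Y : Finset P) (hXY : Disjoint X Y) (hX : ∀ a ∈ X, ∀ b ∈ X, Conn (↑X) a b)
    (hY : ∀ a ∈ Y, ∀ b ∈ Y, Conn (↑Y) a b) (hadj : ∃ x ∈ X, ∃ y ∈ Y, LAdj x y) :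
    ∃ L1 M L2, Inv (Y ∪ X) (L1 ++ (M ++ L2)) ∧ (∀ d ∈ M, d.1 ∈ X) ∧ (∀ d ∈ L1, d.1 ∈ Y) ∧ (∀ d ∈ L2, d.1 ∈ Y) := by
  obtain ⟨x, hx, y, hy, hxy⟩ := hadj
  obtain ⟨L, hL, hLY⟩ := grow_all ∅ Y (by simp) hY _ {y} [] [(y, 0), (y, 1), (y, 2), (y, 3)] [] (by simpa using hy)
    (by simp) rfl (by simpa using inv_single y) (by simp [hy]) (by simp) (by simp)
  simp only [Finset.empty_union, List.nil_append, List.append_nil] at hL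
  obtain ⟨e, rfl⟩ := adj_hd hxy.symm
  have hxY : hd (y, e) ∉ Y := fun h => Finset.disjoint_left.1 hXY hx h
  obtain ⟨L1, L2, rfl⟩ := List.append_of_mem (hL.bnd y hy e hxY)
  have h1 := hL.grow hxY
  have h3 : ∀ d ∈ L1, d.1 ∈ Y := fun d hd => hLY d (by simp [hd])
  have h4 : ∀ d ∈ L2, d.1 ∈ Y := fun d hd => hLY d (by simp [hd])
  obtain ⟨M, hM, hMX⟩ := grow_all Y X hXY.symm hX _ {hd (y, e)} L1 (nw (y, e)) L2 (by simpa using hx) (by simp) rfl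
    (by rw [Finset.union_comm, ← Finset.insert_eq]; exact h1) (by intro d hd; rw [nw_base hd]; exact hx) h3 h4
  exact ⟨L1, M, L2, hM, hMX, h3, h4⟩
end CBP

namespace CBP

lemma ch_om (F : P → ZMod 2) : ∀ (B : List Dart) (d d' : Dart),
    (d :: (B ++ [d'])).IsChain (fun a b => lf a = rt b) → (∀ x ∈ B, F (lf x) = F (rt x)) → F (lf d) = F (rt d') := by
  intro B
  induction B with
  | nil => intro d d' h _; simp at h; rw [h]
  | cons b B ih =>
    intro d d' h hB
    rw [List.cons_append, List.isChain_cons_cons] at h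
    rw [h.1, ← hB b (by simp)]
    exact ih b d' h.2 fun x hx => hB x (by simp [hx])

lemma idx_after {U C : List Dart} {a b : Dart} (hn : (U ++ a :: C).Nodup) (hb : b ∈ U ++ a :: C)
    (h : (U ++ a :: C).idxOf a < (U ++ a :: C).idxOf b) : b ∈ C := by
  have haU : a ∉ U := by
    intro ha; rw [List.nodup_append] at hn; exact hn.2.2 a ha a (by simp) rfl
  rcases List.mem_append.1 hb with hU | hU
  · rw [List.idxOf_append_of_notMem haU, List.idxOf_append_of_mem hU] at h
    have := List.idxOf_lt_length_iff.2 hU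
    omega
  · rcases List.mem_cons.1 hU with rfl | hU
    · omega
    · exact hU

lemma lf_hd (d : Dart) : ∃ e, lf d = lf (hd d, e) := by
  obtain ⟨⟨x, y⟩, f⟩ := d
  fin_cases f
  · exact ⟨1, by simp [lf, hd]⟩
  · exact ⟨2, by simp [lf, hd]⟩
  · exact ⟨3, by simp [lf, hd]⟩
  · exact ⟨0, by simp [lf, hd]⟩

lemma rt_hd (d : Dart) : ∃ e, rt d = lf (hd d, e) := by
  obtain ⟨⟨x, y⟩, f⟩ := d
  fin_cases f
  · exact ⟨2, by simp [lf, hd, rt]⟩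
  · exact ⟨3, by simp [lf, hd, rt]⟩
  · exact ⟨0, by simp [lf, hd, rt]⟩
  · exact ⟨1, by simp [lf, hd, rt]⟩

lemma around {a p : P} {l : List P} (h : Wk a a l) (hp : p ∉ l) (e : Fin 4) : om l (lf (p, e)) = om l (lf (p, 0)) := by
  have key : ∀ f : Fin 4, om l (lf (p, f)) = om l (rt (p, f)) := by
    intro f
    have h1 := closed_jump h (p, f)
    rw [ec_zero (Or.inl hp)] at h1
    have h2 := z2 (om l (rt (p, f)))
    linear_combination h1 - h2
  have h1 := key 1
  have h2 := key 2
  have h3 := key 3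
  have e1 : rt (p, 1) = lf (p, 0) := rfl
  have e2 : rt (p, 2) = lf (p, 1) := rfl
  have e3 : rt (p, 3) = lf (p, 2) := rfl
  rw [e1] at h1; rw [e2] at h2; rw [e3] at h3
  fin_cases e
  · rfl
  · exact h1
  · exact h2.trans h1
  · exact h3.trans (h2.trans h1)

lemma around_walk {a p q : P} {l m : List P} (h : Wk a a l) (hm : Wk p q m) (hd' : ∀ x ∈ m, x ∉ l) :
    om l (lf (p, 0)) = om l (lf (q, 0)) := by
  induction hm with
  | nil => rfl
  | @cons p b c m hab hl ih =>
    rw [← ih fun x hx => hd' x (by simp [hx])]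
    obtain ⟨e, rfl⟩ := adj_hd hab
    obtain ⟨f, hf⟩ := lf_hd (p, e)
    rw [← around h (hd' p (by simp)) e, hf]
    exact around h (hd' _ (List.mem_cons_of_mem _ hl.left_mem)) f

theorem strip (X Y : Finset P) (hXY : Disjoint X Y) (hX : ∀ a ∈ X, ∀ b ∈ X, Conn (↑X) a b)
    (hY : ∀ a ∈ Y, ∀ b ∈ Y, Conn (↑Y) a b) (hadj : ∃ x ∈ X, ∃ y ∈ Y, LAdj x y) :
    ∃ pos : Dart → ℕ,
      (∀ d d' : Dart, d.1 ∈ X → d'.1 ∈ X → hd d ∉ Y ∪ X → hd d' ∉ Y ∪ X → pos d = pos d' → d = d') ∧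
      ∀ d d' d'' : Dart, d.1 ∈ X → d'.1 ∈ X → d''.1 ∈ X → hd d ∉ Y ∪ X → hd d' ∉ Y ∪ X → hd d'' ∉ Y ∪ X →
        pos d < pos d' → pos d' < pos d'' → ∀ (k r : Set P), (∀ x ∈ k, x ∉ Y ∪ X) → (∀ x ∈ r, x ∉ Y ∪ X) →
        (∃ y1, Conn r (hd d') y1 ∧ ∃ y ∈ Y, LAdj y1 y) → Conn k (hd d) (hd d'') → (k ∩ r).Nonempty := by
  obtain ⟨L1, M, L2, hI, hM, hL1, hL2⟩ := contour X Y hXY hX hY hadj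
  have hin : ∀ d : Dart, d.1 ∈ X → hd d ∉ Y ∪ X → d ∈ M := by
    intro d h1 h2
    have h3 := hI.bnd d.1 (Finset.mem_union_right _ h1) d.2 h2
    rcases List.mem_append.1 h3 with h | h
    · exact absurd (hL1 _ h) (Finset.disjoint_left.1 hXY h1)
    · rcases List.mem_append.1 h with h | h
      · exact h
      · exact absurd (hL2 _ h) (Finset.disjoint_left.1 hXY h1)
  have hML : ∀ d ∈ M, d ∈ L1 ++ (M ++ L2) := fun d hd => by simp [hd]
  have hnd : M.Nodup := by
    have := hI.nd; rw [List.nodup_append, List.nodup_append] at this; exact this.2.1.1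
  have hch : M.IsChain (fun a b => lf a = rt b) := by
    have := hI.ch; rw [List.isChain_append, List.isChain_append] at this; exact this.2.1.1
  refine ⟨fun d => M.idxOf d, ?_, ?_⟩
  · intro d d' h1 h2 h3 h4 h
    exact (List.idxOf_inj (hin d h1 h3)).1 h
  · intro d d' d'' hd1 hd2 hd3 hh1 hh2 hh3 hlt1 hlt2 k r hk hr hry hkc
    by_contra hdis
    have hdis' : ∀ x ∈ k, x ∉ r := fun x h1 h2 => hdis ⟨x, h1, h2⟩
    obtain ⟨y1, ⟨lr, hlr, hlrr⟩, y, hy, hyy⟩ := hry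
    obtain ⟨lk, hlk, hlkk⟩ := hkc
    obtain ⟨lt, hlt, hltS, hlt0⟩ := hI.path y (Finset.mem_union_left _ hy) d'.1 (Finset.mem_union_right _ hd2)
    have w1 : Wk d'.1 (hd d') [d'.1, hd d'] := Wk.cons (hd_adj d') (Wk.nil _)
    have w2 : Wk y1 y [y1, y] := Wk.cons hyy (Wk.nil _)
    have w3 := w1.append hlr
    have w4 := w3.append w2
    have w5 := w4.append hlt
    have hy1r : y1 ∈ r := hlrr _ hlr.right_mem
    have hnX : ∀ x ∈ r, x ∉ X := fun x hx hx' => hr x hx (Finset.mem_union_right _ hx')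
    have hec : ∀ x ∈ M, ec ((([d'.1, hd d'] ++ lr.tail) ++ [y1, y].tail) ++ lt.tail) x.1 (hd x) = if x = d' then 1 else 0 := by
      intro x hx
      rw [ec_append w4 hlt, ec_append w3 w2, ec_append w1 hlr, hlt0 x (hML x hx),
        ec_zero (l := lr) (Or.inl fun h => hnX _ (hlrr _ h) (hM x hx)),
        ec_zero (l := [y1, y]), add_zero, add_zero, add_zero]
      · simp only [ec, add_zero, ee]
        congr 1
        apply propext
        constructor
        · rintro (⟨h1, h2⟩ | ⟨h1, h2⟩)
          · obtain ⟨v, e⟩ := x; obtain ⟨v', e'⟩ := d'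
            simp only at h1; subst h1
            rw [hd_inj h2]
          · exact absurd (h2 ▸ Finset.mem_union_right _ (hM x hx)) hh2
        · rintro rfl; exact Or.inl ⟨rfl, rfl⟩
      · left
        intro h
        simp only [List.mem_cons, List.not_mem_nil, or_false] at h
        rcases h with h | h
        · exact hnX _ hy1r (h ▸ hM x hx)
        · exact Finset.disjoint_left.1 hXY (hM x hx) (h ▸ hy)
    set Λ := (([d'.1, hd d'] ++ lr.tail) ++ [y1, y].tail) ++ lt.tail with hΛ
    have hav : ∀ x ∈ k, x ∉ Λ := by
      intro x hx hxΛ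
      simp only [hΛ, List.mem_append, List.mem_cons, List.not_mem_nil, or_false, List.tail_cons] at hxΛ
      rcases hxΛ with (((h | h) | h) | h) | h
      · exact hk x hx (h ▸ Finset.mem_union_right _ hd2)
      · exact hdis' x hx (h ▸ hlrr _ hlr.left_mem)
      · exact hdis' x hx (hlrr _ (List.mem_of_mem_tail h))
      · exact hk x hx (h ▸ Finset.mem_union_left _ hy)
      · exact hk x hx (hltS _ (List.mem_of_mem_tail h))
    have hconst := around_walk w5 hlk fun x hx => hav x (hlkk x hx)
    have hvk : hd d ∈ k := hlkk _ hlk.left_mem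
    have hvk' : hd d'' ∈ k := hlkk _ hlk.right_mem
    obtain ⟨e1, he1⟩ := lf_hd d
    obtain ⟨e2, he2⟩ := rt_hd d''
    have hcon2 : om Λ (lf d) = om Λ (rt d'') := by
      rw [he1, he2, around w5 (hav _ hvk), around w5 (hav _ hvk'), hconst]
    have hjump : ∀ x ∈ M, x ≠ d' → om Λ (lf x) = om Λ (rt x) := by
      intro x hx hxd
      have h1 := closed_jump w5 x
      rw [hec x hx, if_neg hxd] at h1
      have h2 := z2 (om Λ (rt x))
      linear_combination h1 - h2
    have hjump' : om Λ (lf d') + om Λ (rt d') = 1 := by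
      have h1 := closed_jump w5 d'
      rwa [hec d' (hin d' hd2 hh2), if_pos rfl] at h1
    obtain ⟨A, R, hAR⟩ := List.append_of_mem (hin d hd1 hh1)
    have m2 := hin d' hd2 hh2
    have m3 := hin d'' hd3 hh3
    simp only at hlt1 hlt2
    have hd'R : d' ∈ R := by
      rw [hAR] at hnd m2 hlt1; exact idx_after hnd m2 hlt1
    obtain ⟨B, C, rfl⟩ := List.append_of_mem hd'R
    have hAR2 : M = (A ++ d :: B) ++ d' :: C := by rw [hAR]; simp
    have hd3C : d'' ∈ C := by
      rw [hAR2] at hnd m3 hlt2; exact idx_after hnd m3 hlt2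
    obtain ⟨D, E, rfl⟩ := List.append_of_mem hd3C
    have hndB : d' ∉ B := by
      rw [hAR2, List.nodup_append] at hnd
      intro h; exact hnd.2.2 d' (by simp [h]) d' (by simp) rfl
    have hndD : d' ∉ D := by
      rw [hAR2, List.nodup_append, List.nodup_cons] at hnd
      intro h; exact hnd.2.1.1 (by simp [h])
    have c1 : (d :: (B ++ [d'])).IsChain (fun a b => lf a = rt b) := by
      refine List.IsChain.left_of_append (l₂ := D ++ d'' :: E) (List.IsChain.right_of_append (l₁ := A) ?_)
      rw [hAR] at hch; simpa using hch
    have c2 : (d' :: (D ++ [d''])).IsChain (fun a b => lf a = rt b) := by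
      refine List.IsChain.left_of_append (l₂ := E) (List.IsChain.right_of_append (l₁ := A ++ d :: B) ?_)
      rw [hAR2] at hch; simpa using hch
    have f1 := ch_om (om Λ) B d d' c1 fun x hx => hjump x (by rw [hAR]; simp [hx]) (fun h => hndB (h ▸ hx))
    have f2 := ch_om (om Λ) D d' d'' c2 fun x hx => hjump x (by rw [hAR]; simp [hx]) (fun h => hndD (h ▸ hx))
    rw [← hcon2, f1] at f2
    rw [f2, z2] at hjump'
    exact zero_ne_one hjump'
end CBP

namespace CBP
section
variable {α : Type*}

open Classical in
noncomputable def US (D : α → α → Prop) (Blk : ℕ → Finset α) (S : Finset α) (k : ℕ) : Finset α :=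
  (Blk k).filter (fun y => ∃ x ∈ S, D x y)

lemma mem_US {D : α → α → Prop} {Blk : ℕ → Finset α} {S : Finset α} {k : ℕ} {y : α} :
    y ∈ US D Blk S k ↔ y ∈ Blk k ∧ ∃ x ∈ S, D x y := by simp [US]

structure BP (D : α → α → Prop) (Blk : ℕ → Finset α) (m b t : ℕ) : Prop where
  tr : ∀ x y z, D x y → D y z → D x z
  card : ∀ k < m, (Blk k).card = b
  nb : ∀ k l, k < l → l < m → ∀ A ⊆ Blk k, ∀ C ⊆ Blk l, t ≤ A.card → t ≤ C.card → ∃ a ∈ A, ∃ c ∈ C, D a c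

variable {D : α → α → Prop} {Blk : ℕ → Finset α} {m b t : ℕ}

lemma BP.dual (h : BP D Blk m b t) : BP (fun x y => D y x) (fun k => Blk (m - 1 - k)) m b t where
  tr := fun x y z h1 h2 => h.tr z y x h2 h1
  card := fun k hk => h.card _ (by omega)
  nb := by
    intro k l hkl hl A hA C hC h1 h2
    obtain ⟨c, hc, a, ha, hca⟩ := h.nb (m - 1 - l) (m - 1 - k) (by omega) (by omega) C hC A hA h2 h1
    exact ⟨a, ha, c, hc, hca⟩

lemma BP.miss (h : BP D Blk m b t) {k l : ℕ} (hkl : k < l) (hl : l < m) {T : Finset α} (hT : T ⊆ Blk k)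
    (ht : t ≤ T.card) : b < (US D Blk T l).card + t := by
  classical
  by_contra hc
  have h1 : US D Blk T l ⊆ Blk l := fun y hy => (mem_US.1 hy).1
  have h2 : (Blk l \ US D Blk T l).card = b - (US D Blk T l).card := by
    rw [Finset.card_sdiff_of_subset h1, h.card l hl]
  obtain ⟨a, ha, c, hc, hac⟩ := h.nb k l hkl hl T hT (Blk l \ US D Blk T l) Finset.sdiff_subset ht (by omega)
  rw [Finset.mem_sdiff] at hc
  exact hc.2 (mem_US.2 ⟨hc.1, a, ha, hac⟩)

lemma BP.split (h : BP D Blk m b t) (ht : 0 < t) (hb : 3 * t ≤ b) : ∀ (j k : ℕ) (S : Finset α), S.card ≤ 2 ^ j →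
    t ≤ (US D Blk S k).card → k + j < m → ∃ x ∈ S, t ≤ (US D Blk {x} (k + j)).card := by
  classical
  intro j
  induction j with
  | zero =>
    intro k S hS hU hk
    have hne : S.Nonempty := by
      obtain ⟨y, hy⟩ := Finset.card_pos.1 (lt_of_lt_of_le ht hU)
      obtain ⟨x, hx, _⟩ := (mem_US.1 hy).2
      exact ⟨x, hx⟩
    have : S.card = 1 := by have := Finset.card_pos.2 hne; simp at hS; omega
    obtain ⟨x, rfl⟩ := Finset.card_eq_one.1 this
    exact ⟨x, by simp, hU⟩
  | succ j ih =>
    intro k S hS hU hk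
    obtain ⟨S1, hS1, hc1⟩ := Finset.exists_subset_card_eq (Nat.div_le_self S.card 2)
    have hm := h.miss (k := k) (l := k + 1) (by omega) (by omega) (T := US D Blk S k)
      (fun y hy => (mem_US.1 hy).1) hU
    have hsub : US D Blk (US D Blk S k) (k + 1) ⊆ US D Blk S1 (k + 1) ∪ US D Blk (S \ S1) (k + 1) := by
      intro y hy
      obtain ⟨hy1, z, hz, hzy⟩ := mem_US.1 hy
      obtain ⟨hz1, x, hx, hxz⟩ := mem_US.1 hz
      have := h.tr _ _ _ hxz hzy
      rw [Finset.mem_union, mem_US, mem_US]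
      by_cases hx1 : x ∈ S1
      · exact Or.inl ⟨hy1, x, hx1, this⟩
      · exact Or.inr ⟨hy1, x, Finset.mem_sdiff.2 ⟨hx, hx1⟩, this⟩
    have h1 := (Finset.card_le_card hsub).trans (Finset.card_union_le _ _)
    have h2 : (S \ S1).card = S.card - S.card / 2 := by rw [Finset.card_sdiff_of_subset hS1, hc1]
    rw [pow_succ] at hS
    have e : k + (j + 1) = k + 1 + j := by ring
    rw [e]
    by_cases h3 : t ≤ (US D Blk S1 (k + 1)).card
    · obtain ⟨x, hx, hx'⟩ := ih (k + 1) S1 (by omega) h3 (by omega)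
      exact ⟨x, hS1 hx, hx'⟩
    · obtain ⟨x, hx, hx'⟩ := ih (k + 1) (S \ S1) (by omega) (by omega) (by omega)
      exact ⟨x, (Finset.mem_sdiff.1 hx).1, hx'⟩

open Classical in
noncomputable def badU (D : α → α → Prop) (Blk : ℕ → Finset α) (t J k : ℕ) : Finset α :=
  (Blk k).filter (fun x => (US D Blk {x} (k + 1 + J)).card < t)

lemma BP.bad (h : BP D Blk m b t) (ht : 0 < t) (hb : 3 * t ≤ b) {J : ℕ} (hJ : t ≤ 2 ^ J) {k : ℕ} (hk : k + 1 + J < m) :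
    (badU D Blk t J k).card < t := by
  by_contra hc
  obtain ⟨S, hS, hSc⟩ := Finset.exists_subset_card_eq (not_lt.1 hc)
  have hSB : S ⊆ Blk k := fun x hx => (Finset.mem_filter.1 (hS hx)).1
  have h1 := h.miss (k := k) (l := k + 1) (by omega) (by omega) hSB hSc.ge
  obtain ⟨x, hx, hx'⟩ := h.split ht hb J (k + 1) S (by omega) (by omega) hk
  have := (Finset.mem_filter.1 (hS hx)).2
  omega

lemma BP.later (h : BP D Blk m b t) {x : α} {l l' : ℕ} (hl : l < l') (hl' : l' < m) (hx : t ≤ (US D Blk {x} l).card) :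
    b < (US D Blk {x} l').card + t := by
  have h1 := h.miss hl hl' (T := US D Blk {x} l) (fun y hy => (mem_US.1 hy).1) hx
  have : US D Blk (US D Blk {x} l) l' ⊆ US D Blk {x} l' := by
    intro y hy
    obtain ⟨hy1, z, hz, hzy⟩ := mem_US.1 hy
    obtain ⟨hz1, w, hw, hxz⟩ := mem_US.1 hz
    exact mem_US.2 ⟨hy1, w, hw, h.tr _ _ _ hxz hzy⟩
  have := Finset.card_le_card this
  omega

/-- good pairs are comparable -/
lemma BP.comp (h : BP D Blk m b t) (hb : 3 * t ≤ b) {J k k' : ℕ} {x y : α}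
    (hk : k + 2 * J + 4 ≤ k') (hk' : k' < m) (hx : x ∈ Blk k) (hy : y ∈ Blk k')
    (hx' : x ∉ badU D Blk t J k) (hy' : y ∉ badU (fun x y => D y x) (fun k => Blk (m - 1 - k)) t J (m - 1 - k')) : D x y := by
  classical
  have hx2 : t ≤ (US D Blk {x} (k + 1 + J)).card := by
    by_contra hc; exact hx' (Finset.mem_filter.2 ⟨hx, not_le.1 hc⟩)
  have hy2 : t ≤ (US (fun x y => D y x) (fun k => Blk (m - 1 - k)) {y} (m - 1 - k' + 1 + J)).card := by
    by_contra hc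
    refine hy' (Finset.mem_filter.2 ⟨?_, not_le.1 hc⟩)
    have : m - 1 - (m - 1 - k') = k' := by omega
    simp only [this]; exact hy
  have h1 := h.later (l' := k + J + 2) (by omega) (by omega) hx2
  have h2 := h.dual.later (l' := m - 1 - (k + J + 2)) (by omega) (by omega) hy2
  set A := US D Blk {x} (k + J + 2)
  set B := US (fun x y => D y x) (fun k => Blk (m - 1 - k)) {y} (m - 1 - (k + J + 2))
  have hA : A ⊆ Blk (k + J + 2) := fun z hz => (mem_US.1 hz).1
  have hB : B ⊆ Blk (k + J + 2) := fun z hz => by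
    have := (mem_US.1 hz).1
    have e : m - 1 - (m - 1 - (k + J + 2)) = k + J + 2 := by omega
    rwa [e] at this
  have hc := h.card (k + J + 2) (by omega)
  have h3 := Finset.card_le_card (Finset.union_subset hA hB)
  have h4 := Finset.card_union_add_card_inter A B
  have : 0 < (A ∩ B).card := by omega
  obtain ⟨z, hz⟩ := Finset.card_pos.1 this
  rw [Finset.mem_inter] at hz
  obtain ⟨_, w, hw, hxz⟩ := mem_US.1 hz.1
  obtain ⟨_, w', hw', hzy⟩ := mem_US.1 hz.2
  rw [Finset.mem_singleton] at hw hw'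
  subst hw; subst hw'
  exact h.tr _ _ _ hxz hzy
end

open Classical in
theorem Plem (H : ℕ → ℕ → Prop) (n t b J : ℕ) (hsym : ∀ i j, H i j → H j i)
    (htr : ∀ i j k, i < j → j < k → k < n → H i k → H i j ∨ H j k)
    (ht : 0 < t) (hb : 3 * t ≤ b) (hJ : t ≤ 2 ^ J)
    (hNB : ∀ A ⊆ Finset.range n, ∀ B ⊆ Finset.range n, t ≤ A.card → t ≤ B.card → ¬ ∀ x ∈ A, ∀ y ∈ B, H x y) :
    ((Finset.range n ×ˢ Finset.range n).filter (fun q => H q.1 q.2)).card ≤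
      n * (4 * t * (n / b) + 2 * b + (4 * J + 8) * b) := by
  set m := n / b with hm
  have hb0 : 0 < b := by omega
  have hmb : m * b ≤ n := Nat.div_mul_le_self n b
  set D : ℕ → ℕ → Prop := fun i j => i < j ∧ j < n ∧ ¬ H i j with hD
  set Blk : ℕ → Finset ℕ := fun k => Finset.Ico (k * b) (k * b + b) with hBlk
  have hsubn : ∀ k < m, Blk k ⊆ Finset.range n := by
    intro k hk x hx
    rw [hBlk, Finset.mem_Ico] at hx
    rw [Finset.mem_range]
    have : k * b + b ≤ m * b := by rw [← Nat.succ_mul]; exact Nat.mul_le_mul_right _ hk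
    omega
  have hBP : BP D Blk m b t := by
    refine ⟨?_, ?_, ?_⟩
    · rintro x y z ⟨h1, h2, h3⟩ ⟨h4, h5, h6⟩
      refine ⟨by omega, h5, fun h => ?_⟩
      rcases htr x y z h1 h4 h5 h with h | h
      · exact h3 h
      · exact h6 h
    · intro k hk; simp [hBlk]
    · intro k l hkl hl A hA C hC h1 h2
      have := hNB A (hA.trans (hsubn k (by omega))) C (hC.trans (hsubn l hl)) h1 h2
      push Not at this
      obtain ⟨a, ha, c, hc, hac⟩ := this
      refine ⟨a, ha, c, hc, ?_, ?_, hac⟩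
      · have e1 := hA ha
        have e2 := hC hc
        rw [hBlk, Finset.mem_Ico] at e1 e2
        have : k * b + b ≤ l * b := by rw [← Nat.succ_mul]; exact Nat.mul_le_mul_right _ hkl
        omega
      · exact Finset.mem_range.1 (hsubn l hl (hC hc))
  set BU := (Finset.range m).biUnion (fun k => if k + 1 + J < m then badU D Blk t J k else ∅) with hBU
  set BD := (Finset.range m).biUnion (fun k => if k + 1 + J < m then badU (fun x y => D y x) (fun k => Blk (m - 1 - k)) t J k else ∅) with hBD
  set W := BU ∪ (BD ∪ Finset.Ico (m * b) n) with hW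
  have hBUc : BU.card ≤ m * t := by
    refine (Finset.card_biUnion_le_card_mul _ _ t fun k hk => ?_).trans (by simp)
    split_ifs with h
    · exact (hBP.bad ht hb hJ h).le
    · simp
  have hBDc : BD.card ≤ m * t := by
    refine (Finset.card_biUnion_le_card_mul _ _ t fun k hk => ?_).trans (by simp)
    split_ifs with h
    · exact (hBP.dual.bad ht hb hJ h).le
    · simp
  have hrem : (Finset.Ico (m * b) n).card ≤ b := by
    rw [Nat.card_Ico]
    have := Nat.lt_div_mul_add (a := n) hb0
    rw [← hm] at this
    omega
  have hWc : W.card ≤ 2 * t * m + b := by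
    have h1 := Finset.card_union_le BU (BD ∪ Finset.Ico (m * b) n)
    have h2 := Finset.card_union_le BD (Finset.Ico (m * b) n)
    calc W.card ≤ m * t + (m * t + b) := by
          rw [hW]; refine h1.trans (Nat.add_le_add hBUc (h2.trans (Nat.add_le_add hBDc hrem)))
      _ = _ := by ring
  set w := (2 * J + 4) * b with hw
  have hmain : ∀ i j, i < n → j < n → i ≤ j → H i j → i ∈ W ∨ j ∈ W ∨ j < i + w := by
    intro i j hi hj hij hH
    by_contra hc
    push Not at hc
    obtain ⟨hc1, hc2, hc3⟩ := hc
    simp only [hW, Finset.mem_union, not_or, Finset.mem_Ico, not_and, not_lt] at hc1 hc2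
    have hi2 : i < m * b := by by_contra h; have := hc1.2.2 (not_lt.1 h); omega
    have hj2 : j < m * b := by by_contra h; have := hc2.2.2 (not_lt.1 h); omega
    have hk : i / b < m := (Nat.div_lt_iff_lt_mul hb0).2 hi2
    have hk' : j / b < m := (Nat.div_lt_iff_lt_mul hb0).2 hj2
    have hsep : i / b + 2 * J + 4 ≤ j / b := by
      have : i / b + (2 * J + 4) ≤ j / b := by
        rw [Nat.le_div_iff_mul_le hb0, add_mul]
        have := Nat.div_mul_le_self i b
        omega
      omega
    have hib : i ∈ Blk (i / b) := by
      rw [hBlk, Finset.mem_Ico]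
      exact ⟨Nat.div_mul_le_self i b, Nat.lt_div_mul_add hb0⟩
    have hjb : j ∈ Blk (j / b) := by
      rw [hBlk, Finset.mem_Ico]
      exact ⟨Nat.div_mul_le_self j b, Nat.lt_div_mul_add hb0⟩
    generalize j / b = jb at *
    generalize i / b = ib at *
    have := hBP.comp hb hsep hk' hib hjb ?_ ?_
    · exact this.2.2 hH
    · intro h
      apply hc1.1
      rw [hBU, Finset.mem_biUnion]
      exact ⟨ib, Finset.mem_range.2 hk, by rw [if_pos (by omega)]; exact h⟩
    · intro h
      apply hc2.2.1
      rw [hBD, Finset.mem_biUnion]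
      exact ⟨m - 1 - jb, Finset.mem_range.2 (by omega), by rw [if_pos (by omega)]; exact h⟩
  have hcov : (Finset.range n ×ˢ Finset.range n).filter (fun q => H q.1 q.2) ⊆
      (W ×ˢ Finset.range n ∪ Finset.range n ×ˢ W) ∪
        (Finset.range n).biUnion (fun i => (Finset.Ico (i + 1 - w) (i + w)).image (fun j => (i, j))) := by
    rintro ⟨i, j⟩ hq
    simp only [Finset.mem_filter, Finset.mem_product, Finset.mem_range] at hq
    obtain ⟨⟨hi, hj⟩, hH⟩ := hq
    simp only [Finset.mem_union, Finset.mem_product, Finset.mem_range, Finset.mem_biUnion, Finset.mem_image, Finset.mem_Ico,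
      Prod.mk.injEq]
    have fin : j < i + w → i < j + w → ∃ a < n, ∃ x, (a + 1 - w ≤ x ∧ x < a + w) ∧ a = i ∧ x = j := by
      intro h1 h2; exact ⟨i, hi, j, ⟨by omega, h1⟩, rfl, rfl⟩
    have hw0 : 0 < w := by positivity
    rcases le_total i j with hij | hij
    · rcases hmain i j hi hj hij hH with h | h | h
      · exact Or.inl (Or.inl ⟨h, hj⟩)
      · exact Or.inl (Or.inr ⟨hi, h⟩)
      · exact Or.inr (fin h (by omega))
    · rcases hmain j i hj hi hij (hsym _ _ hH) with h | h | h
      · exact Or.inl (Or.inr ⟨hi, h⟩)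
      · exact Or.inl (Or.inl ⟨h, hj⟩)
      · exact Or.inr (fin (by omega) h)
  have hcl : ((Finset.range n).biUnion (fun i => (Finset.Ico (i + 1 - w) (i + w)).image (fun j => (i, j)))).card ≤ n * (2 * w) := by
    refine (Finset.card_biUnion_le_card_mul _ _ (2 * w) fun i hi => ?_).trans (by simp)
    refine Finset.card_image_le.trans ?_
    rw [Nat.card_Ico]; omega
  have h1 := Finset.card_le_card hcov
  have h2 := Finset.card_union_le (W ×ˢ Finset.range n ∪ Finset.range n ×ˢ W) ((Finset.range n).biUnion (fun i => (Finset.Ico (i + 1 - w) (i + w)).image (fun j => (i, j))))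
  have h3 := Finset.card_union_le (W ×ˢ Finset.range n) (Finset.range n ×ˢ W)
  rw [Finset.card_product, Finset.card_product, Finset.card_range] at h3
  have h4 : W.card * n ≤ (2 * t * m + b) * n := Nat.mul_le_mul_right _ hWc
  have h5 : n * W.card ≤ n * (2 * t * m + b) := Nat.mul_le_mul_left _ hWc
  calc _ ≤ (2 * t * m + b) * n + n * (2 * t * m + b) + n * (2 * w) := by omega
    _ = _ := by rw [hw]; ring
end CBP

namespace CBP

open Classical in
theorem Qlem {κ : Type*} (H : ℕ → ℕ → Prop) (K : ℕ → κ → Prop) (C : Finset κ) (n N t : ℕ) (δ : ℝ)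
    (hsym : ∀ i j, H i j → H j i)
    (hQ : ∀ i j k, i < j → j < k → k < n → ∀ c ∈ C, ¬ H i j → ¬ H j k → K i c → K k c → K j c)
    (hδ : 0 < δ) (ht : 0 < t) (htN : (t : ℝ) ≤ δ ^ 2 * N / 64) (hn : n ≤ N) (hC : C.card ≤ N)
    (hself : (((Finset.range n ×ˢ Finset.range n).filter (fun q => H q.1 q.2)).card : ℝ) ≤ δ ^ 4 / 512 * N ^ 2)
    (hhits : δ * N ^ 2 ≤ (((Finset.range n ×ˢ C).filter (fun q => K q.1 q.2)).card : ℝ)) :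
    ∃ A ⊆ Finset.range n, ∃ B ⊆ C, t ≤ A.card ∧ t ≤ B.card ∧ ∀ a ∈ A, ∀ c ∈ B, K a c := by
  have hN : (0:ℝ) < N := by
    by_contra h
    have : (N:ℝ) = 0 := le_antisymm (not_lt.1 h) (by positivity)
    rw [this] at htN
    have : (0:ℝ) < t := by exact_mod_cast ht
    simp at htN; linarith
  have ht1 : (1:ℝ) ≤ t := by exact_mod_cast ht
  have hnR : (n:ℝ) ≤ N := by exact_mod_cast hn
  have hCR : (C.card:ℝ) ≤ N := by exact_mod_cast hC
  set β : ℝ := δ ^ 2 / 32 with hβ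
  have hβ0 : 0 < β := by positivity
  set dg : ℕ → ℕ := fun i => ((Finset.range n).filter (fun j => H i j)).card with hdg
  set hv := (Finset.range n).filter (fun i => β * N < dg i) with hhv
  have hselfsum : ((Finset.range n ×ˢ Finset.range n).filter (fun q => H q.1 q.2)).card = ∑ i ∈ Finset.range n, dg i := by
    simp only [hdg, Finset.card_filter, Finset.sum_product]
  have hhvc : (hv.card : ℝ) ≤ δ ^ 2 / 16 * N := by
    have h1 : (hv.card : ℝ) * (β * N) ≤ ∑ i ∈ Finset.range n, (dg i : ℝ) := by
      calc (hv.card : ℝ) * (β * N) = ∑ i ∈ hv, β * N := by rw [Finset.sum_const, nsmul_eq_mul]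
        _ ≤ ∑ i ∈ hv, (dg i : ℝ) := Finset.sum_le_sum fun i hi => (Finset.mem_filter.1 hi).2.le
        _ ≤ _ := Finset.sum_le_sum_of_subset_of_nonneg (Finset.filter_subset _ _) fun _ _ _ => by positivity
    rw [hselfsum] at hself
    push_cast at hself
    have h2 : (hv.card : ℝ) * (β * N) ≤ (δ ^ 2 / 16 * N) * (β * N) := by
      rw [hβ] at *
      calc _ ≤ _ := h1.trans hself
        _ = _ := by ring
    exact le_of_mul_le_mul_right h2 (by positivity)
  set w := ⌊2 * β * N⌋₊ + t + 2 with hw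
  have hwle : (w : ℝ) ≤ 2 * β * N + 3 * t := by
    have := Nat.floor_le (show 0 ≤ 2 * β * N by positivity)
    rw [hw]; push_cast; linarith
  have hwge : 2 * β * N + t + 1 ≤ (w : ℝ) := by
    have := (Nat.lt_floor_add_one (2 * β * N)).le
    rw [hw]; push_cast; linarith
  set G : ℕ × ℕ → ℕ := fun q => (C.filter (fun c => K q.1 c ∧ K q.2 c)).card with hG
  have hgood : ∀ i k, i < n → k < n → i ∉ hv → k ∉ hv → i + w ≤ k → t ≤ G (i, k) →
      ∃ A ⊆ Finset.range n, ∃ B ⊆ C, t ≤ A.card ∧ t ≤ B.card ∧ ∀ a ∈ A, ∀ c ∈ B, K a c := by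
    intro i k hi hk hiv hkv hik hGt
    refine ⟨(Finset.Ioo i k).filter (fun j => ¬ H i j ∧ ¬ H j k), ?_, C.filter (fun c => K i c ∧ K k c), Finset.filter_subset _ _, ?_, hGt, ?_⟩
    · intro j hj
      have := Finset.mem_Ioo.1 (Finset.mem_filter.1 hj).1
      exact Finset.mem_range.2 (by omega)
    · have hi1 : (dg i : ℝ) ≤ β * N := by
        by_contra h; exact hiv (Finset.mem_filter.2 ⟨Finset.mem_range.2 hi, not_le.1 h⟩)
      have hk1 : (dg k : ℝ) ≤ β * N := by
        by_contra h; exact hkv (Finset.mem_filter.2 ⟨Finset.mem_range.2 hk, not_le.1 h⟩)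
      have hsub : Finset.Ioo i k ⊆ (Finset.Ioo i k).filter (fun j => ¬ H i j ∧ ¬ H j k) ∪
          ((Finset.range n).filter (fun j => H i j) ∪ (Finset.range n).filter (fun j => H k j)) := by
        intro j hj
        have hj' := Finset.mem_Ioo.1 hj
        have hjn : j ∈ Finset.range n := Finset.mem_range.2 (by omega)
        rw [Finset.mem_union, Finset.mem_union, Finset.mem_filter, Finset.mem_filter, Finset.mem_filter]
        by_cases h1 : H i j
        · exact Or.inr (Or.inl ⟨hjn, h1⟩)
        · by_cases h2 : H j k
          · exact Or.inr (Or.inr ⟨hjn, hsym _ _ h2⟩)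
          · exact Or.inl ⟨hj, h1, h2⟩
      have h1 := (Finset.card_le_card hsub).trans (Finset.card_union_le _ _)
      have h2 := Finset.card_union_le ((Finset.range n).filter (fun j => H i j)) ((Finset.range n).filter (fun j => H k j))
      have h3 : (k - i - 1 : ℕ) ≤ ((Finset.Ioo i k).filter (fun j => ¬ H i j ∧ ¬ H j k)).card + (dg i + dg k) := by
        rw [Nat.card_Ioo] at h1; exact h1.trans (Nat.add_le_add_left h2 _)
      have h4 : w ≤ ((Finset.Ioo i k).filter (fun j => ¬ H i j ∧ ¬ H j k)).card + (dg i + dg k) + 1 := by omega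
      have h5 : (w:ℝ) ≤ ((Finset.Ioo i k).filter (fun j => ¬ H i j ∧ ¬ H j k)).card + (dg i + dg k) + 1 := by exact_mod_cast h4
      have h6 : (t:ℝ) ≤ ((Finset.Ioo i k).filter (fun j => ¬ H i j ∧ ¬ H j k)).card := by linarith
      exact_mod_cast h6
    · intro j hj c hc
      obtain ⟨hj1, hj2, hj3⟩ := Finset.mem_filter.1 hj
      obtain ⟨hc1, hc2, hc3⟩ := Finset.mem_filter.1 hc
      have := Finset.mem_Ioo.1 hj1
      exact hQ i j k this.1 this.2 hk c hc1 hj2 hj3 hc2 hc3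
  by_contra hno
  set Bd := (hv ×ˢ Finset.range n ∪ Finset.range n ×ˢ hv) ∪
        (Finset.range n).biUnion (fun i => (Finset.Ico (i + 1 - w) (i + w)).image (fun j => (i, j))) with hBd
  have hBdc : (Bd.card : ℝ) ≤ δ ^ 2 * (3 / 8) * N ^ 2 := by
    have h1 := Finset.card_union_le (hv ×ˢ Finset.range n ∪ Finset.range n ×ˢ hv) ((Finset.range n).biUnion (fun i => (Finset.Ico (i + 1 - w) (i + w)).image (fun j => (i, j))))
    have h2 := Finset.card_union_le (hv ×ˢ Finset.range n) (Finset.range n ×ˢ hv)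
    rw [Finset.card_product, Finset.card_product, Finset.card_range] at h2
    have h3 : ((Finset.range n).biUnion (fun i => (Finset.Ico (i + 1 - w) (i + w)).image (fun j => (i, j)))).card ≤ n * (2 * w) := by
      refine (Finset.card_biUnion_le_card_mul _ _ (2 * w) fun i hi => ?_).trans (by simp)
      refine Finset.card_image_le.trans ?_
      rw [Nat.card_Ico]; omega
    have h4 : Bd.card ≤ hv.card * n + n * hv.card + n * (2 * w) := by rw [hBd]; omega
    have h5 : (Bd.card:ℝ) ≤ hv.card * n + n * hv.card + n * (2 * w) := by exact_mod_cast h4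
    calc (Bd.card:ℝ) ≤ hv.card * n + n * hv.card + n * (2 * w) := h5
      _ ≤ (δ ^ 2 / 16 * N) * N + N * (δ ^ 2 / 16 * N) + N * (2 * (2 * β * N + 3 * (δ ^ 2 * N / 64))) := by
          gcongr; linarith
      _ ≤ _ := by rw [hβ]; nlinarith [mul_nonneg (sq_nonneg δ) (sq_nonneg (N:ℝ))]
  have hsm : ∀ q ∈ Finset.range n ×ˢ Finset.range n, q ∉ Bd → G q ≤ t := by
    rintro ⟨i, k⟩ hq hqB
    rw [Finset.mem_product, Finset.mem_range, Finset.mem_range] at hq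
    obtain ⟨hi, hk⟩ := hq
    simp only [hBd, Finset.mem_union, Finset.mem_product, Finset.mem_range, Finset.mem_biUnion, Finset.mem_image, Finset.mem_Ico,
      Prod.mk.injEq, not_or, not_exists, not_and] at hqB
    have hiv : i ∉ hv := fun h => hqB.1.1 h hk
    have hkv : k ∉ hv := fun h => hqB.1.2 hi h
    have hfar : i + w ≤ k ∨ k + w ≤ i := by
      by_contra h
      push Not at h
      exact hqB.2 i hi k ⟨by omega, by omega⟩ rfl rfl
    by_contra hG'
    apply hno
    rcases hfar with h | h
    · exact hgood i k hi hk hiv hkv h (by omega)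
    · refine hgood k i hk hi hkv hiv h ?_
      have : G (k, i) = G (i, k) := by
        simp only [hG]; congr 1; ext c; simp only [Finset.mem_filter]; tauto
      omega
  have hGN : ∀ q, G q ≤ N := fun q => (Finset.card_filter_le _ _).trans hC
  have hsumG : (∑ q ∈ Finset.range n ×ˢ Finset.range n, G q) ≤ Bd.card * N + n * n * t := by
    calc ∑ q ∈ Finset.range n ×ˢ Finset.range n, G q
        ≤ ∑ q ∈ Finset.range n ×ˢ Finset.range n, ((if q ∈ Bd then N else 0) + t) := by
          refine Finset.sum_le_sum fun q hq => ?_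
          by_cases h : q ∈ Bd
          · rw [if_pos h]; have := hGN q; omega
          · rw [if_neg h]; have := hsm q hq h; omega
      _ = (∑ q ∈ Finset.range n ×ˢ Finset.range n, (if q ∈ Bd then N else 0)) + n * n * t := by
          rw [Finset.sum_add_distrib, Finset.sum_const, Finset.card_product, Finset.card_range, smul_eq_mul]
      _ ≤ _ := by
          rw [← Finset.sum_filter, Finset.sum_const, smul_eq_mul]
          gcongr
          intro q hq; exact (Finset.mem_filter.1 hq).2
  set h : κ → ℕ := fun c => ((Finset.range n).filter (fun i => K i c)).card with hh
  have hGsq : ∑ q ∈ Finset.range n ×ˢ Finset.range n, G q = ∑ c ∈ C, h c ^ 2 := by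
    have : ∀ c, h c ^ 2 = ∑ q ∈ Finset.range n ×ˢ Finset.range n, if K q.1 c ∧ K q.2 c then 1 else 0 := by
      intro c
      rw [← Finset.card_filter, pow_two, ← Finset.card_product]
      congr 1
      ext q; simp only [Finset.mem_filter, Finset.mem_product]; tauto
    simp only [this, hG, Finset.card_filter]
    rw [Finset.sum_comm]
  have hhit : ((Finset.range n ×ˢ C).filter (fun q => K q.1 q.2)).card = ∑ c ∈ C, h c := by
    simp only [hh, Finset.card_filter, Finset.sum_product]
    rw [Finset.sum_comm]
  have hcs : (∑ c ∈ C, h c) ^ 2 ≤ C.card * ∑ c ∈ C, h c ^ 2 := sq_sum_le_card_mul_sum_sq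
  rw [← hGsq, ← hhit] at hcs
  have hcs2 : ((Finset.range n ×ˢ C).filter (fun q => K q.1 q.2)).card ^ 2 ≤ N * (Bd.card * N + n * n * t) :=
    hcs.trans (Nat.mul_le_mul hC hsumG)
  have hcs3 : (((Finset.range n ×ˢ C).filter (fun q => K q.1 q.2)).card : ℝ) ^ 2 ≤ N * (Bd.card * N + n * n * t) := by exact_mod_cast hcs2
  have f1 : (δ * (N:ℝ) ^ 2) ^ 2 ≤ (((Finset.range n ×ˢ C).filter (fun q => K q.1 q.2)).card : ℝ) ^ 2 := by gcongr
  have f2 : (N:ℝ) * (Bd.card * N + n * n * t) ≤ N * (δ ^ 2 * (3 / 8) * N ^ 2 * N + N * N * (δ ^ 2 * N / 64)) := by gcongr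
  have f3 := f1.trans (hcs3.trans f2)
  have f4 : 0 < δ ^ 2 * (N:ℝ) ^ 4 := by positivity
  nlinarith
end CBP

namespace CBP
section
variable {ι : Type*}

lemma chords_order (X Y : Finset P) (hXY : Disjoint X Y) (hX : ∀ a ∈ X, ∀ b ∈ X, Conn (↑X) a b)
    (hY : ∀ a ∈ Y, ∀ b ∈ Y, Conn (↑Y) a b) (hadj : ∃ x ∈ X, ∃ y ∈ Y, LAdj x y) (R : Finset ι) (r : ι → List P) (s : ι → P)
    (hr : ∀ b ∈ R, (∃ e, Wk (s b) e (r b) ∧ ∃ y ∈ Y, LAdj e y) ∧ (∃ x ∈ X, LAdj (s b) x) ∧ ∀ p ∈ r b, p ∉ Y ∪ X) :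
    ∃ pos : ι → ℕ, ∀ a ∈ R, ∀ b ∈ R, ∀ c ∈ R, pos a ≤ pos b → pos b ≤ pos c → ¬ HitL (r a) (r b) → ¬ HitL (r b) (r c) →
      ∀ κ : Set P, (∀ x ∈ κ, x ∉ Y ∪ X) → Conn κ (s a) (s c) → ∃ x ∈ κ, x ∈ r b := by
  classical
  obtain ⟨pos, hp1, hp2⟩ := strip X Y hXY hX hY hadj
  have hex : ∀ b, ∃ d : Dart, b ∈ R → d.1 ∈ X ∧ hd d = s b := by
    intro b
    by_cases hb : b ∈ R
    · obtain ⟨x, hx, hxs⟩ := (hr b hb).2.1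
      obtain ⟨e, he⟩ := adj_hd hxs.symm
      exact ⟨(x, e), fun _ => ⟨hx, he.symm⟩⟩
    · exact ⟨((0, 0), 0), fun h => absurd h hb⟩
  choose d hd' using hex
  have hs : ∀ b ∈ R, s b ∈ r b := fun b hb => by
    obtain ⟨e, he, _⟩ := (hr b hb).1; exact he.left_mem
  have hout : ∀ b ∈ R, hd (d b) ∉ Y ∪ X := fun b hb => by
    rw [(hd' b hb).2]; exact (hr b hb).2.2 _ (hs b hb)
  have hstrict : ∀ a ∈ R, ∀ b ∈ R, ¬ HitL (r a) (r b) → pos (d a) ≠ pos (d b) := by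
    intro a ha b hb hn he
    have := hp1 _ _ (hd' a ha).1 (hd' b hb).1 (hout a ha) (hout b hb) he
    apply hn
    refine ⟨s a, hs a ha, ?_⟩
    rw [← (hd' a ha).2, this, (hd' b hb).2]; exact hs b hb
  refine ⟨fun b => pos (d b), ?_⟩
  intro a ha b hb c hc h1 h2 h3 h4 κ hκ hcon
  have := hp2 (d a) (d b) (d c) (hd' a ha).1 (hd' b hb).1 (hd' c hc).1 (hout a ha) (hout b hb) (hout c hc)
    (lt_of_le_of_ne h1 (hstrict a ha b hb h3)) (lt_of_le_of_ne h2 (hstrict b hb c hc h4)) κ {x | x ∈ r b} hκ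
    (fun x hx => (hr b hb).2.2 x hx) ?_ ?_
  · obtain ⟨x, hx1, hx2⟩ := this; exact ⟨x, hx1, hx2⟩
  · rw [(hd' b hb).2]
    obtain ⟨e, he, hy⟩ := (hr b hb).1
    exact ⟨e, ⟨r b, he, fun x hx => hx⟩, hy⟩
  · rw [(hd' a ha).2, (hd' c hc).2]; exact hcon

lemma sort_ex [Nonempty ι] (R : Finset ι) (pos : ι → ℕ) : ∃ σ : ℕ → ι, (∀ i < R.card, σ i ∈ R) ∧
    (∀ i j, i < R.card → j < R.card → σ i = σ j → i = j) ∧ (∀ b ∈ R, ∃ i < R.card, σ i = b) ∧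
    ∀ i j, i ≤ j → j < R.card → pos (σ i) ≤ pos (σ j) := by
  classical
  set e := R.equivFin.symm
  set f : Fin R.card → ℕ := fun i => pos (e i) with hf
  have hm := Tuple.monotone_sort f
  set g : Fin R.card → R := fun i => e (Tuple.sort f i)
  refine ⟨fun i => if h : i < R.card then (g ⟨i, h⟩ : ι) else Classical.arbitrary ι, ?_, ?_, ?_, ?_⟩
  · intro i hi; simp [hi]
  · intro i j hi hj h
    simp only [hi, hj, dif_pos] at h
    have := e.injective (Subtype.ext h)
    simpa using (Tuple.sort f).injective this
  · intro b hb
    refine ⟨((Tuple.sort f).symm (e.symm ⟨b, hb⟩)).1, Fin.isLt _, ?_⟩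
    simp [g]
  · intro i j hij hj
    have hi : i < R.card := by omega
    simp only [hi, hj, dif_pos]
    exact hm (show (⟨i, hi⟩ : Fin R.card) ≤ ⟨j, hj⟩ from hij)

/-- a biclique of size t -/
def Bic (w : ι → List P) (t : ℕ) : Prop := ∃ A B : Finset ι, t ≤ A.card ∧ t ≤ B.card ∧ ∀ a ∈ A, ∀ b ∈ B, HitL (w a) (w b)

lemma HitL.mono {l m l' m' : List P} (h : HitL l m) (h1 : ∀ x ∈ l, x ∈ l') (h2 : ∀ x ∈ m, x ∈ m') : HitL l' m' := by
  obtain ⟨x, a, b⟩ := h; exact ⟨x, h1 x a, h2 x b⟩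

structure Strip (X Y : Finset P) (R : Finset ι) (r : ι → List P) (s : ι → P) : Prop where
  disj : Disjoint X Y
  cX : ∀ a ∈ X, ∀ b ∈ X, Conn (↑X) a b
  cY : ∀ a ∈ Y, ∀ b ∈ Y, Conn (↑Y) a b
  adj : ∃ x ∈ X, ∃ y ∈ Y, LAdj x y
  chord : ∀ b ∈ R, (∃ e, Wk (s b) e (r b) ∧ ∃ y ∈ Y, LAdj e y) ∧ (∃ x ∈ X, LAdj (s b) x) ∧ ∀ p ∈ r b, p ∉ Y ∪ X

/-- connected list -/
def CL (l : List P) : Prop := ∃ u v, Wk u v l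

lemma wk_conn_mem {u v : P} {l : List P} (h : Wk u v l) {x : P} (hx : x ∈ l) : Conn {y | y ∈ l} u x := by
  induction h with
  | nil a => simp at hx; subst hx; exact Conn.refl (by simp)
  | @cons a b c l hab hl ih =>
    have ha : a ∈ {y | y ∈ a :: l} := by simp
    rcases List.mem_cons.1 hx with rfl | hx
    · exact Conn.refl ha
    · refine Conn.trans (Conn.adj ha (show b ∈ {y | y ∈ a :: l} from List.mem_cons_of_mem _ hl.left_mem) hab) ((ih hx).mono ?_)
      intro y hy; exact List.mem_cons_of_mem _ hy

lemma CL.conn {l : List P} (h : CL l) {x y : P} (hx : x ∈ l) (hy : y ∈ l) : Conn {z | z ∈ l} x y := by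
  obtain ⟨u, v, h⟩ := h
  exact (wk_conn_mem h hx).symm.trans (wk_conn_mem h hy)

open Classical in
theorem Pgeo [Nonempty ι] {X Y : Finset P} {R : Finset ι} {r : ι → List P} {s : ι → P} (hS : Strip X Y R r s)
    {t b J : ℕ} (ht : 0 < t) (hb : 3 * t ≤ b) (hJ : t ≤ 2 ^ J) (hno : ¬ Bic r t) :
    (hc R R r r).card ≤ R.card * (4 * t * (R.card / b) + 2 * b + (4 * J + 8) * b) := by
  obtain ⟨pos, hpos⟩ := chords_order X Y hS.disj hS.cX hS.cY hS.adj R r s hS.chord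
  obtain ⟨σ, s1, s2, s3, s4⟩ := sort_ex R pos
  have hP := Plem (fun i j => HitL (r (σ i)) (r (σ j))) R.card t b J (fun i j h => h.symm) ?_ ht hb hJ ?_
  · refine le_trans ?_ hP
    have : hc R R r r ⊆ ((Finset.range R.card ×ˢ Finset.range R.card).filter (fun q => HitL (r (σ q.1)) (r (σ q.2)))).image
        (fun q => (σ q.1, σ q.2)) := by
      rintro ⟨b, c⟩ h
      obtain ⟨⟨hb, hc⟩, h⟩ := mem_hc.1 h
      obtain ⟨i, hi, rfl⟩ := s3 b hb
      obtain ⟨j, hj, rfl⟩ := s3 c hc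
      refine Finset.mem_image.2 ⟨(i, j), ?_, rfl⟩
      rw [Finset.mem_filter, Finset.mem_product, Finset.mem_range, Finset.mem_range]
      exact ⟨⟨hi, hj⟩, h⟩
    exact (Finset.card_le_card this).trans Finset.card_image_le
  · intro i j k hij hjk hk hH
    by_contra hc
    push Not at hc
    have hiR := s1 i (by omega)
    have hjR := s1 j (by omega)
    have hkR := s1 k hk
    obtain ⟨x, hx1, hx2⟩ := hH
    obtain ⟨e1, w1, _⟩ := (hS.chord _ hiR).1
    obtain ⟨e2, w2, _⟩ := (hS.chord _ hkR).1
    obtain ⟨z, hz1, hz2⟩ := hpos _ hiR _ hjR _ hkR (s4 i j hij.le (by omega)) (s4 j k hjk.le hk) hc.1 hc.2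
      ({y | y ∈ r (σ i)} ∪ {y | y ∈ r (σ k)}) (by
        rintro x (hx | hx)
        · exact (hS.chord _ hiR).2.2 x hx
        · exact (hS.chord _ hkR).2.2 x hx)
      (((wk_conn_mem w1 hx1).mono Set.subset_union_left).trans ((wk_conn_mem w2 hx2).symm.mono Set.subset_union_right))
    rcases hz1 with hz1 | hz1
    · exact hc.1 ⟨z, hz1, hz2⟩
    · exact hc.2 ⟨z, hz2, hz1⟩
  · intro A hA B hB h1 h2 hAB
    apply hno
    have inj : ∀ A ⊆ Finset.range R.card, (A.image σ).card = A.card := by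
      intro A hA
      refine Finset.card_image_of_injOn fun i hi j hj h => s2 i j (Finset.mem_range.1 (hA hi)) (Finset.mem_range.1 (hA hj)) h
    refine ⟨A.image σ, B.image σ, by rw [inj A hA]; exact h1, by rw [inj B hB]; exact h2, ?_⟩
    intro a ha b hb
    obtain ⟨i, hi, rfl⟩ := Finset.mem_image.1 ha
    obtain ⟨j, hj, rfl⟩ := Finset.mem_image.1 hb
    exact hAB i hi j hj

open Classical in
theorem Qgeo [Nonempty ι] {X Y : Finset P} {R C : Finset ι} {r k : ι → List P} {s : ι → P} (hS : Strip X Y R r s)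
    (hk : ∀ i ∈ C, CL (k i) ∧ ∀ x ∈ k i, x ∉ Y ∪ X) {t N : ℕ} {δ : ℝ}
    (hδ : 0 < δ) (ht : 0 < t) (htN : (t : ℝ) ≤ δ ^ 2 * N / 64) (hn : R.card ≤ N) (hC : C.card ≤ N)
    (hself : ((hc R R r r).card : ℝ) ≤ δ ^ 4 / 512 * N ^ 2)
    (hhits : δ * N ^ 2 ≤ ((hc R C r k).card : ℝ)) :
    ∃ A ⊆ R, ∃ B ⊆ C, t ≤ A.card ∧ t ≤ B.card ∧ ∀ a ∈ A, ∀ c ∈ B, HitL (r a) (k c) := by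
  obtain ⟨pos, hpos⟩ := chords_order X Y hS.disj hS.cX hS.cY hS.adj R r s hS.chord
  obtain ⟨σ, s1, s2, s3, s4⟩ := sort_ex R pos
  have hQ := Qlem (fun i j => HitL (r (σ i)) (r (σ j))) (fun i c => HitL (r (σ i)) (k c)) C R.card N t δ
    (fun i j h => h.symm) ?_ hδ ht htN hn hC ?_ ?_
  · obtain ⟨A, hA, B, hB, h1, h2, hAB⟩ := hQ
    refine ⟨A.image σ, ?_, B, hB, ?_, h2, ?_⟩
    · intro a ha
      obtain ⟨i, hi, rfl⟩ := Finset.mem_image.1 ha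
      exact s1 i (Finset.mem_range.1 (hA hi))
    · rw [Finset.card_image_of_injOn fun i hi j hj h => s2 i j (Finset.mem_range.1 (hA hi)) (Finset.mem_range.1 (hA hj)) h]
      exact h1
    · intro a ha c hc
      obtain ⟨i, hi, rfl⟩ := Finset.mem_image.1 ha
      exact hAB i hi c hc
  · intro i j l hij hjl hl c hc hn1 hn2 ⟨x, hx1, hx2⟩ ⟨y, hy1, hy2⟩
    have hiR := s1 i (by omega)
    have hjR := s1 j (by omega)
    have hlR := s1 l hl
    obtain ⟨e1, w1, _⟩ := (hS.chord _ hiR).1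
    obtain ⟨e2, w2, _⟩ := (hS.chord _ hlR).1
    obtain ⟨z, hz1, hz2⟩ := hpos _ hiR _ hjR _ hlR (s4 i j hij.le (by omega)) (s4 j l hjl.le hl) hn1 hn2
      ({y | y ∈ r (σ i)} ∪ ({y | y ∈ k c} ∪ {y | y ∈ r (σ l)})) (by
        rintro x (hx | hx | hx)
        · exact (hS.chord _ hiR).2.2 x hx
        · exact (hk c hc).2 x hx
        · exact (hS.chord _ hlR).2.2 x hx)
      (((wk_conn_mem w1 hx1).mono Set.subset_union_left).trans
        ((((hk c hc).1.conn hx2 hy2).mono (Set.subset_union_left.trans Set.subset_union_right)).trans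
          ((wk_conn_mem w2 hy1).symm.mono (Set.subset_union_right.trans Set.subset_union_right))))
    rcases hz1 with hz1 | hz1 | hz1
    · exact absurd ⟨z, hz1, hz2⟩ hn1
    · exact ⟨z, hz2, hz1⟩
    · exact absurd ⟨z, hz2, hz1⟩ hn2
  · refine le_trans ?_ hself
    norm_cast
    have hinj : Set.InjOn (fun q : ℕ × ℕ => (σ q.1, σ q.2)) ((Finset.range R.card ×ˢ Finset.range R.card).filter (fun q => HitL (r (σ q.1)) (r (σ q.2)))) := by
      rintro ⟨i, j⟩ h1 ⟨i', j'⟩ h2 h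
      simp only [Finset.coe_filter, Finset.mem_product, Finset.mem_range, Set.mem_setOf_eq] at h1 h2
      simp only [Prod.mk.injEq] at h ⊢
      exact ⟨s2 _ _ h1.1.1 h2.1.1 h.1, s2 _ _ h1.1.2 h2.1.2 h.2⟩
    rw [← Finset.card_image_of_injOn hinj]
    refine Finset.card_le_card ?_
    intro q hq
    obtain ⟨⟨i, j⟩, h1, rfl⟩ := Finset.mem_image.1 hq
    rw [Finset.mem_filter, Finset.mem_product, Finset.mem_range, Finset.mem_range] at h1
    exact mem_hc.2 ⟨⟨s1 _ h1.1.1, s1 _ h1.1.2⟩, h1.2⟩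
  · refine hhits.trans ?_
    norm_cast
    have : hc R C r k ⊆ ((Finset.range R.card ×ˢ C).filter (fun q => HitL (r (σ q.1)) (k q.2))).image
        (fun q => (σ q.1, q.2)) := by
      rintro ⟨b, c⟩ h
      obtain ⟨⟨hb, hc⟩, h⟩ := mem_hc.1 h
      obtain ⟨i, hi, rfl⟩ := s3 b hb
      refine Finset.mem_image.2 ⟨(i, c), ?_, rfl⟩
      rw [Finset.mem_filter, Finset.mem_product, Finset.mem_range]
      exact ⟨⟨hi, hc⟩, h⟩
    exact (Finset.card_le_card this).trans Finset.card_image_le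
end
end CBP

namespace CBP
section
variable {ι : Type*}

lemma PTarith {n N t b J : ℕ} {η L : ℝ} (hη : 0 < η) (hn : n ≤ N) (hN : 0 < N) (ht : 0 < t)
    (hL : 1 < L) (hb1 : 8 * t / η ≤ b) (hb2 : (b:ℝ) ≤ 9 * t / η) (hJ : (J:ℝ) ≤ 1.5 * L + 1)
    (hs : (t:ℝ) * L ≤ η ^ 2 / 10 ^ 6 * N) :
    ((n * (4 * t * (n / b) + 2 * b + (4 * J + 8) * b) : ℕ) : ℝ) < η * N ^ 2 := by
  have hNR : (0:ℝ) < N := by exact_mod_cast hN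
  have htR : (0:ℝ) < t := by exact_mod_cast ht
  have hnR : (n:ℝ) ≤ N := by exact_mod_cast hn
  have hbR : (0:ℝ) < b := lt_of_lt_of_le (by positivity) hb1
  have h1 : (((n / b : ℕ)) : ℝ) ≤ N * η / (8 * t) := by
    calc (((n / b : ℕ)) : ℝ) ≤ n / b := Nat.cast_div_le
      _ ≤ N / (8 * t / η) := by gcongr
      _ = _ := by field_simp
  have h2 : 4 * (t:ℝ) * ((n / b : ℕ) : ℝ) ≤ η * N / 2 := by
    calc 4 * (t:ℝ) * ((n / b : ℕ) : ℝ) ≤ 4 * (t:ℝ) * (N * η / (8 * t)) := by gcongr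
      _ = _ := by field_simp; ring
  have h3 : (2:ℝ) * b + (4 * J + 8) * b ≤ 180 * (t * L) / η := by
    calc (2:ℝ) * b + (4 * J + 8) * b = (4 * J + 10) * b := by ring
      _ ≤ (20 * L) * (9 * t / η) := by gcongr; linarith
      _ = _ := by ring
  have h4 : 180 * (t * L) / η ≤ 180 * (η ^ 2 / 10 ^ 6 * N) / η := by gcongr
  have h5 : 180 * (η ^ 2 / 10 ^ 6 * N) / η = η * N * (180 / 10 ^ 6) := by field_simp
  have hp : 0 < η * N := by positivity
  push_cast
  have h6 : 4 * (t:ℝ) * ((n / b : ℕ) : ℝ) + 2 * b + (4 * J + 8) * b ≤ η * N * (3/4) := by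
    have : η * N * (180 / 10 ^ 6) ≤ η * N * (1/4) := mul_le_mul_of_nonneg_left (by norm_num) hp.le
    linarith
  push_cast at h6
  calc (n:ℝ) * (4 * (t:ℝ) * ((n / b : ℕ) : ℝ) + 2 * b + (4 * J + 8) * b) ≤ N * (η * N * (3/4)) := by
        gcongr
    _ < η * N ^ 2 := by nlinarith

open Classical in
theorem PT0 [Nonempty ι] {X Y : Finset P} {R : Finset ι} {r : ι → List P} {s : ι → P} (hS : Strip X Y R r s)
    {t N : ℕ} {η : ℝ} (hη : 0 < η) (hη1 : η ≤ 1) (ht : 0 < t) (hN : 0 < N) (hn : R.card ≤ N)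
    (hs : (t:ℝ) * ell N ≤ η ^ 2 / 10 ^ 6 * N) (hself : η * N ^ 2 ≤ (hc R R r r).card) : Bic r t := by
  by_contra hno
  have htR : (1:ℝ) ≤ t := by exact_mod_cast ht
  have hL : 1 < ell N := one_lt_ell (Nat.cast_nonneg _)
  have hNR : (0:ℝ) < N := by exact_mod_cast hN
  have htN : (t:ℝ) ≤ N := by
    have : η ^ 2 ≤ 1 := pow_le_one₀ hη.le hη1
    have h1 : η ^ 2 / 10 ^ 6 * N ≤ 1 * N := by gcongr; linarith
    nlinarith
  have hb1 : 8 * t / η ≤ ((⌊8 * t / η⌋₊ + 1 : ℕ) : ℝ) := by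
    push_cast; exact (Nat.lt_floor_add_one _).le
  have hb2 : ((⌊8 * t / η⌋₊ + 1 : ℕ) : ℝ) ≤ 9 * t / η := by
    push_cast
    have h1 : (⌊8 * t / η⌋₊ : ℝ) ≤ 8 * t / η := Nat.floor_le (by positivity)
    have h2 : 1 ≤ t / η := by rw [le_div_iff₀ hη]; linarith
    have : 9 * t / η = 8 * t / η + t / η := by ring
    linarith
  have hJ : ((Nat.log 2 t + 1 : ℕ) : ℝ) ≤ 1.5 * ell N + 1 := by
    push_cast
    have h1 : (2:ℝ) ^ (Nat.log 2 t) ≤ t := by exact_mod_cast Nat.pow_log_le_self 2 ht.ne'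
    have h2 : (Nat.log 2 t : ℝ) * Real.log 2 ≤ Real.log t := by
      rw [← Real.log_pow]; exact Real.log_le_log (by positivity) h1
    have h3 : Real.log t ≤ ell N := Real.log_le_log (by linarith) (by linarith)
    have := Real.log_two_gt_d9
    have h4 : (0:ℝ) ≤ Nat.log 2 t := Nat.cast_nonneg _
    nlinarith
  have := Pgeo hS ht (b := ⌊8 * t / η⌋₊ + 1) (J := Nat.log 2 t + 1) ?_ (Nat.lt_pow_succ_log_self (by norm_num) t).le hno
  · have h1 := PTarith hη hn hN ht hL hb1 hb2 hJ hs
    have h2 : ((hc R R r r).card : ℝ) ≤ _ := Nat.cast_le.2 this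
    linarith
  · have : (3 * t : ℝ) ≤ 8 * t / η := by
      rw [le_div_iff₀ hη]; nlinarith
    exact_mod_cast this.trans hb1

open Classical in
theorem PT [Nonempty ι] {X Y : Finset P} {R : Finset ι} {r w : ι → List P} {s : ι → P} (hS : Strip X Y R r s)
    {t N : ℕ} {η : ℝ} (hη : 0 < η) (hη1 : η ≤ 1) (ht : 0 < t) (hN : 0 < N) (hn : R.card ≤ N)
    (hs : (t:ℝ) * ell N ≤ η ^ 2 / 10 ^ 6 * N) (hrw : ∀ i ∈ R, ∀ x ∈ r i, x ∈ w i)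
    (hself : η * N ^ 2 ≤ (hc R R r r).card) : Bic w t := by
  set r' : ι → List P := fun i => if i ∈ R then r i else [] with hr'
  have e : ∀ i ∈ R, r' i = r i := fun i hi => by simp [hr', hi]
  have e2 : hc R R r' r' = hc R R r r := by
    ext q
    rw [mem_hc, mem_hc]
    refine and_congr_right fun h => ?_
    rw [e _ h.1, e _ h.2]
  have hS' : Strip X Y R r' s := ⟨hS.disj, hS.cX, hS.cY, hS.adj, fun b hb => by rw [e b hb]; exact hS.chord b hb⟩
  have hw : ∀ i, ∀ x ∈ r' i, x ∈ w i := by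
    intro i x hx
    by_cases hi : i ∈ R
    · rw [e i hi] at hx; exact hrw i hi x hx
    · simp [hr', hi] at hx
  obtain ⟨A, B, h1, h2, h3⟩ := PT0 hS' hη hη1 ht hN hn hs (by rw [e2]; exact hself)
  exact ⟨A, B, h1, h2, fun a ha b hb => (h3 a ha b hb).mono (hw a) (hw b)⟩

open Classical in
theorem PQ [Nonempty ι] {X Y : Finset P} {R C : Finset ι} {r k w : ι → List P} {s : ι → P} (hS : Strip X Y R r s)
    (hk : ∀ i ∈ C, CL (k i) ∧ ∀ x ∈ k i, x ∉ Y ∪ X) {t N : ℕ} {δ : ℝ}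
    (hδ : 0 < δ) (hδ1 : δ ≤ 1) (ht : 0 < t) (hN : 0 < N) (hn : R.card ≤ N) (hC : C.card ≤ N)
    (hs : (t:ℝ) * ell N ≤ δ ^ 8 / 10 ^ 12 * N)
    (hrw : ∀ i ∈ R, ∀ x ∈ r i, x ∈ w i) (hkw : ∀ i ∈ C, ∀ x ∈ k i, x ∈ w i)
    (hhits : δ * N ^ 2 ≤ ((hc R C r k).card : ℝ)) : Bic w t := by
  have hL : 1 < ell N := one_lt_ell (Nat.cast_nonneg _)
  have hNR : (0:ℝ) < N := by exact_mod_cast hN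
  have htR : (1:ℝ) ≤ t := by exact_mod_cast ht
  by_cases hself : δ ^ 4 / 512 * N ^ 2 ≤ (hc R R r r).card
  · obtain ⟨A, B, h1, h2, h3⟩ := PT hS (η := δ ^ 4 / 512) (by positivity)
      (by have : δ ^ 4 ≤ 1 := pow_le_one₀ hδ.le hδ1
          linarith) ht hN hn (hs.trans (by
            have : 0 < δ ^ 8 := by positivity
            gcongr ?_ * _
            have e : (δ ^ 4 / 512) ^ 2 / 10 ^ 6 = δ ^ 8 * (1 / (512 ^ 2 * 10 ^ 6)) := by ring
            have e' : δ ^ 8 / 10 ^ 12 = δ ^ 8 * (1 / 10 ^ 12) := by ring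
            rw [e, e']
            exact mul_le_mul_of_nonneg_left (by norm_num) this.le)) hrw hself
    exact ⟨A, B, h1, h2, h3⟩
  · push Not at hself
    obtain ⟨A, hA, B, hB, h1, h2, h3⟩ := Qgeo hS hk hδ ht (by
      have h8 : δ ^ 8 ≤ δ ^ 2 := pow_le_pow_of_le_one hδ.le hδ1 (by norm_num)
      have : δ ^ 8 / 10 ^ 12 * N ≤ δ ^ 2 * N / 64 := by
        have h0 : 0 < δ ^ 2 * N := by positivity
        calc δ ^ 8 / 10 ^ 12 * N ≤ δ ^ 2 / 10 ^ 12 * N := by gcongr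
          _ = δ ^ 2 * N / 10 ^ 12 := by ring
          _ ≤ _ := by gcongr; norm_num
      nlinarith) hn hC hself.le hhits
    exact ⟨A, B, h1, h2, fun a ha b hb => (h3 a ha b hb).mono (hrw a (hA ha)) (hkw b (hB hb))⟩
end
end CBP

namespace CBP
section
variable {ι : Type*}

lemma CL.connF {l : List P} (h : CL l) : ∀ a ∈ l.toFinset, ∀ b ∈ l.toFinset, Conn (↑l.toFinset) a b := by
  intro a ha b hb
  refine (h.conn (List.mem_toFinset.1 ha) (List.mem_toFinset.1 hb)).mono ?_
  intro x hx; simpa using hx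

lemma conn_union {X Y : Finset P} (cX : ∀ a ∈ X, ∀ b ∈ X, Conn (↑X) a b) (cY : ∀ a ∈ Y, ∀ b ∈ Y, Conn (↑Y) a b)
    {x y : P} (hx : x ∈ X) (hy : y ∈ Y) (h : LAdj x y) :
    ∀ a ∈ X ∪ Y, ∀ b ∈ X ∪ Y, Conn (↑(X ∪ Y)) a b := by
  have key : ∀ a ∈ X ∪ Y, Conn (↑(X ∪ Y)) a x := by
    intro a ha
    rcases Finset.mem_union.1 ha with ha | ha
    · exact (cX a ha x hx).mono (by simp)
    · exact ((cY a ha y hy).mono (by simp)).trans (Conn.adj (by simp [hy]) (by simp [hx]) h.symm)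
  intro a ha b hb
  exact (key a ha).trans (key b hb).symm

open Classical in
def Thin [Fintype ι] (w : ι → List P) (t : ℕ) : Prop := ∀ x, (Finset.univ.filter (fun i => x ∈ w i)).card ≤ t

open Classical in
lemma thin_of_not_bic [Fintype ι] {w : ι → List P} {t : ℕ} (h : ¬ Bic w t) : Thin w t := by
  intro x
  by_contra hc
  push Not at hc
  refine h ⟨_, _, hc.le, hc.le, fun a ha b hb => ⟨x, (Finset.mem_filter.1 ha).2, (Finset.mem_filter.1 hb).2⟩⟩

open Classical in
theorem T1a [Fintype ι] {R C : Finset ι} {f c w : ι → List P} {t N : ℕ} {d : ℝ} (hNc : Fintype.card ι ≤ N)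
    (hd : 0 < d) (ht : (t : ℝ) ≤ d ^ 2 * N / 4) (hN : 0 < N) (hthin : Thin w t)
    (hcw : ∀ i ∈ C, ∀ x ∈ c i, x ∈ w i)
    (s : ι → P) (hw : ∀ b ∈ R, ∃ v, Wk (s b) v (f b))
    (hhits : d * N ^ 2 ≤ (hc R C f c).card) :
    ∃ i0 ∈ C, ∃ R' ⊆ R, ∃ C' ⊆ C, ∃ f' : ι → List P, ∃ s' : ι → P,
      (∀ b ∈ R', Wk (s' b) (s b) (f' b) ∧ (∀ x ∈ f' b, x ∈ f b) ∧
        (∀ x ∈ f' b, x ∉ c i0) ∧ ∃ y ∈ c i0, LAdj (s' b) y) ∧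
      d ^ 2 / 4 * N ^ 2 ≤ (hc R' C' f' c).card := by
  obtain ⟨i0, h1, R', h2, C', h3, f', s', h4, h5, h6⟩ := T1 (R := R) (C := C) (f := f) (c := c) (bad := fun _ _ => False) (η := 0) (t := t)
    hd (by positivity) ht hN
    ((Finset.card_le_univ R).trans hNc) ((Finset.card_le_univ C).trans hNc)
    (fun x => (Finset.card_le_card (fun i hi => by
      rw [Finset.mem_filter] at hi
      exact Finset.mem_filter.2 ⟨Finset.mem_univ _, hcw i hi.1 x hi.2⟩)).trans (hthin x)) (by simp) s hw hhits
  exact ⟨i0, h1, R', h2, C', h3, f', s', fun b hb => ⟨(h4 b hb).2.1, (h4 b hb).2.2.2⟩, h6⟩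

open Classical in
theorem T1b [Fintype ι] {R C : Finset ι} {f c w : ι → List P} {t N : ℕ} {d η : ℝ} (hNc : Fintype.card ι ≤ N)
    (hd : 0 < d) (hη : η ≤ d ^ 2 / 8) (ht : (t : ℝ) ≤ d ^ 2 * N / 4) (hN : 0 < N) (hthin : Thin w t)
    (hcw : ∀ i ∈ C, ∀ x ∈ c i, x ∈ w i) (hbad : ((hc C C c c).card : ℝ) ≤ η * N ^ 2)
    (s : ι → P) (hw : ∀ b ∈ R, ∃ v, Wk (s b) v (f b))
    (hhits : d * N ^ 2 ≤ (hc R C f c).card) :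
    ∃ i0 ∈ C, ∃ R' ⊆ R, ∃ C' ⊆ C, ∃ f' : ι → List P, ∃ s' : ι → P,
      (∀ b ∈ R', Wk (s' b) (s b) (f' b) ∧ (∀ x ∈ f' b, x ∈ f b) ∧
        (∀ x ∈ f' b, x ∉ c i0) ∧ ∃ y ∈ c i0, LAdj (s' b) y) ∧
      (∀ i ∈ C', ∀ x ∈ c i, x ∉ c i0) ∧ d ^ 2 / 4 * N ^ 2 ≤ (hc R' C' f' c).card := by
  obtain ⟨i0, h1, R', h2, C', h3, f', s', h4, h5, h6⟩ := T1 (R := R) (C := C) (f := f) (c := c) (t := t)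
    (bad := fun i j => HitL (c i) (c j)) hd hη ht hN
    ((Finset.card_le_univ R).trans hNc) ((Finset.card_le_univ C).trans hNc)
    (fun x => (Finset.card_le_card (fun i hi => by
      rw [Finset.mem_filter] at hi
      exact Finset.mem_filter.2 ⟨Finset.mem_univ _, hcw i hi.1 x hi.2⟩)).trans (hthin x)) (by convert hbad using 3; ext q; simp [mem_hc]) s hw hhits
  exact ⟨i0, h1, R', h2, C', h3, f', s', fun b hb => ⟨(h4 b hb).2.1, (h4 b hb).2.2.2⟩,
    fun i hi x hx hx' => h5 i hi ⟨x, hx, hx'⟩, h6⟩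

lemma hc_mono {R R' C C' : Finset ι} {f c : ι → List P} (h1 : R' ⊆ R) (h2 : C' ⊆ C) :
    (hc R' C' f c).card ≤ (hc R C f c).card := by
  refine Finset.card_le_card fun q hq => ?_
  rw [mem_hc] at hq ⊢
  exact ⟨⟨h1 hq.1.1, h2 hq.1.2⟩, hq.2⟩

lemma hc_mono' {R R' C C' : Finset ι} {f c f' c' : ι → List P} (h1 : R' ⊆ R) (h2 : C' ⊆ C)
    (h3 : ∀ b ∈ R', ∀ x ∈ f' b, x ∈ f b) (h4 : ∀ b ∈ C', ∀ x ∈ c' b, x ∈ c b) :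
    (hc R' C' f' c').card ≤ (hc R C f c).card := by
  refine Finset.card_le_card fun q hq => ?_
  rw [mem_hc] at hq ⊢
  exact ⟨⟨h1 hq.1.1, h2 hq.1.2⟩, hq.2.mono (h3 _ hq.1.1) (h4 _ hq.1.2)⟩

lemma hc_symm (R C : Finset ι) (f c : ι → List P) : (hc C R c f).card = (hc R C f c).card := by
  refine Finset.card_bij' (fun q _ => (q.2, q.1)) (fun q _ => (q.2, q.1)) ?_ ?_ ?_ ?_
  · intro q hq; rw [mem_hc] at hq ⊢; exact ⟨⟨hq.1.2, hq.1.1⟩, hq.2.symm⟩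
  · intro q hq; rw [mem_hc] at hq ⊢; exact ⟨⟨hq.1.2, hq.1.1⟩, hq.2.symm⟩
  · intro q hq; rfl
  · intro q hq; rfl

/-- rows hanging on a connected set -/
def Rows (Z : Finset P) (R : Finset ι) (f : ι → List P) (s : ι → P) (w : ι → List P) : Prop :=
  ∀ b ∈ R, (∃ v, Wk (s b) v (f b)) ∧ (∃ z ∈ Z, LAdj (s b) z) ∧ ∀ x ∈ f b, x ∉ Z ∧ x ∈ w b

lemma pow_small {a K κ : ℝ} {n m : ℕ} (ha : 0 < a) (ha1 : a ≤ 1) (hnm : m ≤ n) (hK : κ ≤ K) (hκ : 0 ≤ κ):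
    a ^ n * κ ≤ a ^ m * K := by
  have h1 : a ^ n ≤ a ^ m := pow_le_pow_of_le_one ha.le ha1 hnm
  have h2 : 0 < a ^ n := by positivity
  nlinarith [mul_le_mul h1 hK hκ (by positivity)]

theorem Gthm [Fintype ι] [Nonempty ι] {w : ι → List P} {t N : ℕ} {η : ℝ} {Z : Finset P} {R : Finset ι}
    {f : ι → List P} {s : ι → P} (hNc : Fintype.card ι ≤ N) (hη : 0 < η) (hη1 : η ≤ 1) (ht : 0 < t) (hN : 0 < N)
    (hthin : Thin w t) (hZ : ∀ a ∈ Z, ∀ b ∈ Z, Conn (↑Z) a b) (hR : Rows Z R f s w)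
    (hs : (t:ℝ) * ell N ≤ η ^ 64 / 2 ^ 160 * N)
    (hself : η * N ^ 2 ≤ (hc R R f f).card) : Bic w t := by
  have hL : 1 < ell N := one_lt_ell (Nat.cast_nonneg _)
  have hNR : (0:ℝ) < N := by exact_mod_cast hN
  have htR : (1:ℝ) ≤ t := by exact_mod_cast ht
  have htk : (t:ℝ) ≤ η ^ 64 / 2 ^ 160 * N := le_trans (by nlinarith) hs
  have hcard : ∀ A : Finset ι, A.card ≤ N := fun A => (Finset.card_le_univ A).trans hNc
  have sm : ∀ (m : ℕ) (K : ℝ), m ≤ 64 → 1 / 2 ^ 160 ≤ K → η ^ 64 / 2 ^ 160 * N ≤ η ^ m * K * N := by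
    intro m K hm hK
    have := pow_small hη hη1 hm hK (by positivity)
    gcongr
    rw [div_eq_mul_one_div]; exact this
  -- first cut
  obtain ⟨c0, hc0, R1, hR1, C1, hC1, r, s1, h1, h1h⟩ := T1a (R := R) (C := R) (f := f) (c := f) hNc hη (t := t)
    (htk.trans ((sm 2 (1/4) (by norm_num) (by norm_num)).trans (by linarith))) hN hthin (fun i hi x hx => ((hR i hi).2.2 x hx).2) s
    (fun b hb => (hR b hb).1) hself
  have hcl : ∀ i ∈ R, CL (f i) := fun i hi => let ⟨v, hv⟩ := (hR i hi).1; ⟨_, v, hv⟩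
  have hrw : ∀ i ∈ R1, ∀ x ∈ r i, x ∈ w i := fun i hi x hx => ((hR i (hR1 hi)).2.2 x ((h1 i hi).2.1 x hx)).2
  have hrZ : ∀ i ∈ R1, ∀ x ∈ r i, x ∉ Z := fun i hi x hx => ((hR i (hR1 hi)).2.2 x ((h1 i hi).2.1 x hx)).1
  have hrcl : ∀ i ∈ R1, CL (r i) := fun i hi => ⟨_, _, (h1 i hi).1⟩
  set e2 : ℝ := η ^ 8 / 2 ^ 15 with he2
  have e2pos : 0 < e2 := by positivity
  by_cases hs2 : e2 * N ^ 2 ≤ (hc R1 R1 r r).card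
  · refine PT (X := (f c0).toFinset) (Y := Z) (R := R1) (r := r) (s := s1) ?_ e2pos ?_ ht hN (hcard _) ?_ hrw hs2
    · refine ⟨?_, (hcl c0 hc0).connF, hZ, ?_, ?_⟩
      · rw [Finset.disjoint_left]; intro x hx; exact ((hR c0 hc0).2.2 x (List.mem_toFinset.1 hx)).1
      · obtain ⟨z, hz, hz'⟩ := (hR c0 hc0).2.1
        obtain ⟨v, hv⟩ := (hR c0 hc0).1
        exact ⟨s c0, List.mem_toFinset.2 hv.left_mem, z, hz, hz'⟩
      · intro b hb
        obtain ⟨g1, g2, g3, y, g4, g5⟩ := h1 b hb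
        refine ⟨⟨s b, g1, (hR b (hR1 hb)).2.1⟩, ⟨y, List.mem_toFinset.2 g4, g5⟩, ?_⟩
        intro p hp hp'
        rcases Finset.mem_union.1 hp' with h | h
        · exact hrZ b hb p hp h
        · exact g3 p hp (List.mem_toFinset.1 h)
    · have : η ^ 8 ≤ 1 := pow_le_one₀ hη.le hη1
      rw [he2]; linarith
    · refine hs.trans ((sm 16 (1 / (2^30 * 10^6)) (by norm_num) (by norm_num)).trans (le_of_eq ?_))
      rw [he2]; ring
  · push Not at hs2
    have hh : η ^ 2 / 4 * N ^ 2 ≤ (hc R R1 f r).card := by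
      rw [hc_symm]
      exact h1h.trans (by exact_mod_cast hc_mono (Finset.Subset.refl _) hC1)
    obtain ⟨k2, hk2, R2, hR2, C2, hC2, f2, s2, h2, h2b, h2h⟩ := T1b (R := R) (C := R1) (f := f) (c := r) (t := t) (η := e2) hNc
      (by positivity) (by
        have := pow_small hη hη1 (show 4 ≤ 8 by norm_num) (show (1:ℝ) / 2 ^ 15 ≤ 1 / 2 ^ 7 by norm_num) (by norm_num)
        calc e2 = η ^ 8 * (1 / 2 ^ 15) := by rw [he2]; ring
          _ ≤ _ := this
          _ = _ := by ring)
      (htk.trans ((sm 4 (1/64) (by norm_num) (by norm_num)).trans (by apply le_of_eq; ring))) hN hthin hrw hs2.le s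
      (fun b hb => (hR b hb).1) hh
    obtain ⟨k1, hk1, R3, hR3, C3, hC3, f3, s3, h3, h3b, h3h⟩ := T1b (R := R2) (C := C2) (f := f2) (c := r) (t := t) (η := e2) hNc
      (by positivity) (by
        apply le_of_eq; rw [he2]; ring)
      (htk.trans ((sm 8 (1/2^14) (by norm_num) (by norm_num)).trans (by apply le_of_eq; ring))) hN hthin
      (fun i hi => hrw i (hC2 hi)) ((Nat.cast_le.2 (hc_mono hC2 hC2)).trans hs2.le) s2
      (fun b hb => ⟨_, (h2 b hb).1⟩) h2h
    have hk1' := hC2 hk1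
    have adjZ : ∀ i ∈ R1, ∃ x ∈ (r i).toFinset, ∃ z ∈ Z, LAdj x z := by
      intro i hi
      obtain ⟨z, hz, hz'⟩ := (hR i (hR1 hi)).2.1
      exact ⟨s i, List.mem_toFinset.2 (h1 i hi).1.right_mem, z, hz, hz'⟩
    refine PQ (X := (r k1).toFinset) (Y := Z ∪ (r k2).toFinset) (R := R3) (C := C3) (r := f3) (k := r) (s := s3) (N := N)
      (δ := ((η ^ 2 / 4) ^ 2 / 4) ^ 2 / 4) ?_ ?_ (by positivity) ?_ ht hN (hcard _) (hcard _) ?_ ?_ ?_ h3h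
    · refine ⟨?_, (hrcl k1 hk1').connF, ?_, ?_, ?_⟩
      · rw [Finset.disjoint_left]; intro x hx hx'
        have hx := List.mem_toFinset.1 hx
        rcases Finset.mem_union.1 hx' with h | h
        · exact hrZ k1 hk1' x hx h
        · exact h2b k1 hk1 x hx (List.mem_toFinset.1 h)
      · obtain ⟨x, hx, z, hz, hxz⟩ := adjZ k2 hk2
        exact conn_union hZ (hrcl k2 hk2).connF hz hx hxz.symm
      · obtain ⟨x, hx, z, hz, hxz⟩ := adjZ k1 hk1'
        exact ⟨x, hx, z, Finset.mem_union_left _ hz, hxz⟩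
      · intro b hb
        obtain ⟨g1, g2, g3, y, g4, g5⟩ := h3 b hb
        obtain ⟨i1, i2, i3, y', i4, i5⟩ := h2 b (hR3 hb)
        refine ⟨⟨s2 b, g1, y', Finset.mem_union_right _ (List.mem_toFinset.2 i4), i5⟩, ⟨y, List.mem_toFinset.2 g4, g5⟩, ?_⟩
        intro p hp hp'
        rcases Finset.mem_union.1 hp' with h | h
        · rcases Finset.mem_union.1 h with h | h
          · exact ((hR b (hR2 (hR3 hb))).2.2 p (i2 p (g2 p hp))).1 h
          · exact i3 p (g2 p hp) (List.mem_toFinset.1 h)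
        · exact g3 p hp (List.mem_toFinset.1 h)
    · intro i hi
      have hi' := hC2 (hC3 hi)
      refine ⟨hrcl i hi', ?_⟩
      intro p hp hp'
      rcases Finset.mem_union.1 hp' with h | h
      · rcases Finset.mem_union.1 h with h | h
        · exact hrZ i hi' p hp h
        · exact h2b i (hC3 hi) p hp (List.mem_toFinset.1 h)
      · exact h3b i hi p hp (List.mem_toFinset.1 h)
    · have : η ^ 8 ≤ 1 := pow_le_one₀ hη.le hη1
      calc ((η ^ 2 / 4) ^ 2 / 4) ^ 2 / 4 = η ^ 8 / 2 ^ 14 := by ring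
        _ ≤ 1 := by linarith
    · refine hs.trans ((sm 64 (1 / (2^112 * 10^12)) (by norm_num) (by norm_num)).trans (le_of_eq ?_))
      ring
    · intro i hi x hx
      exact ((hR i (hR2 (hR3 hi))).2.2 x ((h2 i (hR3 hi)).2.1 x ((h3 i hi).2.1 x hx))).2
    · intro i hi; exact hrw i (hC2 (hC3 hi))
end
end CBP

namespace CBP
section
variable {ι : Type*}

theorem Dthm [Fintype ι] [Nonempty ι] {w : ι → List P} {t N : ℕ} {d : ℝ}
    (hNc : Fintype.card ι ≤ N) (hd : 0 < d) (hd1 : d ≤ 1) (ht : 0 < t) (hN : 0 < N)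
    (hw : ∀ i, CL (w i))
    (hs : (t:ℝ) * ell N ≤ (d ^ 16 / 2 ^ 31) ^ 64 / 2 ^ 160 * N)
    (hhits : d * N ^ 2 ≤ (hc Finset.univ Finset.univ w w).card) : Bic w t := by
  by_contra hno
  have hthin := thin_of_not_bic hno
  apply hno
  have hL : 1 < ell N := one_lt_ell (Nat.cast_nonneg _)
  have hNR : (0:ℝ) < N := by exact_mod_cast hN
  have htR : (1:ℝ) ≤ t := by exact_mod_cast ht
  have hcard : ∀ A : Finset ι, A.card ≤ N := fun A => (Finset.card_le_univ A).trans hNc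
  set η : ℝ := d ^ 16 / 2 ^ 31 with hη
  have ηpos : 0 < η := by positivity
  have d16 : d ^ 16 ≤ 1 := pow_le_one₀ hd.le hd1
  have η1 : η ≤ 1 := by rw [hη]; linarith
  have htk : (t:ℝ) ≤ η ^ 64 / 2 ^ 160 * N := le_trans (by nlinarith) hs
  have smη : ∀ (m : ℕ) (K : ℝ), m ≤ 64 → 1 / 2 ^ 160 ≤ K → η ^ 64 / 2 ^ 160 * N ≤ η ^ m * K * N := by
    intro m K hm hK
    have := pow_small ηpos η1 hm hK (by positivity)
    gcongr
    rw [div_eq_mul_one_div]; exact this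
  have sm : ∀ (m : ℕ) (K : ℝ), m ≤ 16 → 1 / 2 ^ 31 ≤ K → (t:ℝ) ≤ d ^ m * K * N := by
    intro m K hm hK
    refine htk.trans ((smη 1 1 (by norm_num) (by norm_num)).trans ?_)
    have := pow_small hd hd1 hm hK (by positivity)
    refine mul_le_mul_of_nonneg_right ?_ hNR.le
    calc η ^ 1 * 1 = d ^ 16 * (1 / 2 ^ 31) := by rw [hη]; ring
      _ ≤ _ := this
  choose s0 v0 hw0 using hw
  obtain ⟨z, -, A, -, C1, -, a, sa, h1, h1h⟩ := T1a (R := Finset.univ) (C := Finset.univ) (f := w) (c := w) (w := w) hNc hd (t := t)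
    ((sm 2 (1/4) (by norm_num) (by norm_num)).trans (by linarith)) hN hthin (fun i hi x hx => hx) s0
    (fun b hb => ⟨_, hw0 b⟩) hhits
  have haw : ∀ i ∈ A, ∀ x ∈ a i, x ∈ w i := fun i hi => (h1 i hi).2.1
  by_cases hc1 : η * N ^ 2 ≤ (hc A A a a).card
  · refine Gthm (Z := (w z).toFinset) (R := A) (f := a) (s := sa) hNc ηpos η1 ht hN hthin (CL.connF ⟨_, _, hw0 z⟩) ?_ hs hc1
    intro b hb
    obtain ⟨g1, g2, g3, y, g4, g5⟩ := h1 b hb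
    exact ⟨⟨_, g1⟩, ⟨y, List.mem_toFinset.2 g4, g5⟩, fun x hx => ⟨fun h => g3 x hx (List.mem_toFinset.1 h), g2 x hx⟩⟩
  push Not at hc1
  have hh : d ^ 2 / 4 * N ^ 2 ≤ (hc Finset.univ A w a).card := by
    rw [hc_symm]
    exact h1h.trans (by exact_mod_cast hc_mono (Finset.Subset.refl _) (Finset.subset_univ _))
  obtain ⟨k1, hk1, B, -, K, hK, b, sb, h2, h2b, h2h⟩ := T1b (R := Finset.univ) (C := A) (f := w) (c := a) (t := t) (η := η) hNc
    (by positivity) (by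
      have := pow_small hd hd1 (show 4 ≤ 16 by norm_num) (show (1:ℝ) / 2 ^ 31 ≤ 1 / 2 ^ 7 by norm_num) (by norm_num)
      calc η = d ^ 16 * (1 / 2 ^ 31) := by rw [hη]; ring
        _ ≤ _ := this
        _ = _ := by ring)
    ((sm 4 (1/64) (by norm_num) (by norm_num)).trans (by apply le_of_eq; ring)) hN hthin haw hc1.le s0
    (fun b hb => ⟨_, hw0 b⟩) hh
  have hbw : ∀ i ∈ B, ∀ x ∈ b i, x ∈ w i := fun i hi => (h2 i hi).2.1
  have hacl : ∀ i ∈ A, CL (a i) := fun i hi => ⟨_, _, (h1 i hi).1⟩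
  have hbcl : ∀ i ∈ B, CL (b i) := fun i hi => ⟨_, _, (h2 i hi).1⟩
  set θ : ℝ := d ^ 8 / 2 ^ 15 with hθ
  have θpos : 0 < θ := by positivity
  have d8 : d ^ 8 ≤ 1 := pow_le_one₀ hd.le hd1
  have θ1 : θ ≤ 1 := by rw [hθ]; linarith
  have hηθ : η ≤ θ := by
    have := pow_small hd hd1 (show 8 ≤ 16 by norm_num) (show (1:ℝ) / 2 ^ 31 ≤ 1 / 2 ^ 15 by norm_num) (by norm_num)
    calc η = d ^ 16 * (1 / 2 ^ 31) := by rw [hη]; ring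
      _ ≤ _ := this
      _ = θ := by rw [hθ]; ring
  by_cases hc2 : θ * N ^ 2 ≤ (hc B B b b).card
  · refine Gthm (Z := (a k1).toFinset) (R := B) (f := b) (s := sb) hNc θpos θ1 ht hN hthin (hacl k1 hk1).connF ?_ (hs.trans (by gcongr)) hc2
    intro b hb
    obtain ⟨g1, g2, g3, y, g4, g5⟩ := h2 b hb
    exact ⟨⟨_, g1⟩, ⟨y, List.mem_toFinset.2 g4, g5⟩, fun x hx => ⟨fun h => g3 x hx (List.mem_toFinset.1 h), g2 x hx⟩⟩
  push Not at hc2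
  obtain ⟨r0, hr0, R3, hR3, C3, hC3, a3, s3, h3, h3b, h3h⟩ := T1b (R := K) (C := B) (f := a) (c := b) (t := t) (η := θ)
    (d := (d ^ 2 / 4) ^ 2 / 4) hNc (by positivity) (by apply le_of_eq; rw [hθ]; ring)
    ((sm 8 (1/2^14) (by norm_num) (by norm_num)).trans (by apply le_of_eq; ring)) hN hthin hbw hc2.le sa
    (fun b hb => ⟨_, (h1 b (hK hb)).1⟩) (by rw [hc_symm]; exact h2h)
  have ha3 : ∀ i ∈ R3, ∀ x ∈ a3 i, x ∈ a i := fun i hi => (h3 i hi).2.1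
  have hR3A : ∀ i ∈ R3, i ∈ A := fun i hi => hK (hR3 hi)
  have ha3cl : ∀ i ∈ R3, CL (a3 i) := fun i hi => ⟨_, _, (h3 i hi).1⟩
  obtain ⟨k0, hk0, R4, hR4, C4, hC4, f4, s4, h4, h4b, h4h⟩ := T1b (R := C3) (C := R3) (f := b) (c := a3) (w := w) (t := t) (η := η)
    (d := ((d ^ 2 / 4) ^ 2 / 4) ^ 2 / 4) hNc (by positivity) (by apply le_of_eq; rw [hη]; ring)
    ((sm 16 (1/2^30) (by norm_num) (by norm_num)).trans (by apply le_of_eq; ring)) hN hthin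
    (fun i hi x hx => haw i (hR3A i hi) x (ha3 i hi x hx))
    ((Nat.cast_le.2 (hc_mono' hR3A hR3A ha3 ha3)).trans hc1.le) sb
    (fun b hb => ⟨_, (h2 b (hC3 hb)).1⟩) (by rw [hc_symm]; exact h3h)
  refine PQ (X := (b r0).toFinset ∪ (a3 k0).toFinset) (Y := (a k1).toFinset) (R := R4) (C := C4) (r := f4) (k := a3) (s := s4) (N := N)
      (δ := (((d ^ 2 / 4) ^ 2 / 4) ^ 2 / 4) ^ 2 / 4) ?_ ?_ (by positivity) ?_ ht hN (hcard _) (hcard _) ?_ ?_ ?_ h4h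
  · refine ⟨?_, ?_, (hacl k1 hk1).connF, ?_, ?_⟩
    · rw [Finset.disjoint_left]; intro x hx hx'
      have hx' := List.mem_toFinset.1 hx'
      rcases Finset.mem_union.1 hx with h | h
      · exact (h2 r0 hr0).2.2.1 x (List.mem_toFinset.1 h) hx'
      · exact h2b k0 (hR3 hk0) x (ha3 k0 hk0 x (List.mem_toFinset.1 h)) hx'
    · obtain ⟨g1, g2, g3, y, g4, g5⟩ := h3 k0 hk0
      exact conn_union (hbcl r0 hr0).connF (ha3cl k0 hk0).connF (List.mem_toFinset.2 g4) (List.mem_toFinset.2 g1.left_mem) g5.symm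
    · obtain ⟨g1, g2, g3, y, g4, g5⟩ := h2 r0 hr0
      exact ⟨_, Finset.mem_union_left _ (List.mem_toFinset.2 g1.left_mem), y, List.mem_toFinset.2 g4, g5⟩
    · intro i hi
      obtain ⟨g1, g2, g3, y, g4, g5⟩ := h4 i hi
      obtain ⟨i1, i2, i3, y', i4, i5⟩ := h2 i (hC3 (hR4 hi))
      refine ⟨⟨sb i, g1, y', List.mem_toFinset.2 i4, i5⟩, ⟨y, Finset.mem_union_right _ (List.mem_toFinset.2 g4), g5⟩, ?_⟩
      intro p hp hp'
      rcases Finset.mem_union.1 hp' with h | h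
      · exact i3 p (g2 p hp) (List.mem_toFinset.1 h)
      · rcases Finset.mem_union.1 h with h | h
        · exact h3b i (hR4 hi) p (g2 p hp) (List.mem_toFinset.1 h)
        · exact g3 p hp (List.mem_toFinset.1 h)
  · intro i hi
    have hi' := hC4 hi
    refine ⟨ha3cl i hi', ?_⟩
    intro p hp hp'
    rcases Finset.mem_union.1 hp' with h | h
    · exact h2b i (hR3 hi') p (ha3 i hi' p hp) (List.mem_toFinset.1 h)
    · rcases Finset.mem_union.1 h with h | h
      · exact (h3 i hi').2.2.1 p hp (List.mem_toFinset.1 h)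
      · exact h4b i hi p hp (List.mem_toFinset.1 h)
  · calc (((d ^ 2 / 4) ^ 2 / 4) ^ 2 / 4) ^ 2 / 4 = d ^ 16 / 2 ^ 30 := by ring
        _ ≤ 1 := by linarith
  · refine hs.trans ((smη 8 (1/10^12) (by norm_num) (by norm_num)).trans ?_)
    have : η ≤ (((d ^ 2 / 4) ^ 2 / 4) ^ 2 / 4) ^ 2 / 4 := by
      calc η ≤ 2 * η := by linarith
        _ = _ := by rw [hη]; ring
    have h8 : η ^ 8 ≤ ((((d ^ 2 / 4) ^ 2 / 4) ^ 2 / 4) ^ 2 / 4) ^ 8 := by gcongr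
    rw [mul_one_div]
    gcongr
  · intro i hi x hx
    exact hbw i (hC3 (hR4 hi)) x ((h4 i hi).2.1 x hx)
  · intro i hi x hx; exact haw i (hR3A i (hC4 hi)) x (ha3 i (hC4 hi) x hx)
end
end CBP

namespace CBP
section

lemma ratio_bound (K : ℕ) (hK : 1 ≤ K) {D N : ℝ} (hD : 1 ≤ D) (hN : D ≤ N) :
    (1 / (K:ℝ) ^ K) * (D / ell D ^ K) ≤ N / ell N ^ K := by
  have hD0 : 0 < D := by linarith
  have hN0 : 0 < N := by linarith
  have l1 := one_lt_ell hD0.le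
  have l2 := one_lt_ell hN0.le
  set q := N / D with hq
  have hq1 : 1 ≤ q := by rw [hq, le_div_iff₀ hD0]; linarith
  have hKR : (1:ℝ) ≤ K := by exact_mod_cast hK
  have hlq : 0 ≤ Real.log q := Real.log_nonneg hq1
  have e1 : ell N ≤ ell D * (1 + Real.log q) := by
    have : ell N ≤ Real.log q + ell D := by
      unfold ell
      rw [← Real.log_mul (by positivity) (by positivity)]
      refine Real.log_le_log (by positivity) ?_
      have : q * D = N := by rw [hq]; field_simp
      nlinarith
    nlinarith
  have e2 : 1 + Real.log q ≤ K * q ^ ((1:ℝ) / K) := by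
    have h1 : Real.log (q ^ ((1:ℝ) / K)) ≤ q ^ ((1:ℝ) / K) - 1 := Real.log_le_sub_one_of_pos (by positivity)
    rw [Real.log_rpow (by positivity)] at h1
    have h2 : Real.log q ≤ K * (q ^ ((1:ℝ) / K) - 1) := by
      calc Real.log q = K * (1 / K * Real.log q) := by field_simp
        _ ≤ _ := by gcongr
    linarith
  have e3 : (K * q ^ ((1:ℝ) / K)) ^ K = (K:ℝ) ^ K * q := by
    rw [mul_pow, ← Real.rpow_natCast (q ^ ((1:ℝ) / K)), ← Real.rpow_mul (by positivity)]
    congr 1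
    rw [one_div_mul_cancel (by positivity), Real.rpow_one]
  have e4 : ell N ^ K ≤ ell D ^ K * ((K:ℝ) ^ K * q) := by
    calc ell N ^ K ≤ (ell D * (1 + Real.log q)) ^ K := by gcongr
      _ = ell D ^ K * (1 + Real.log q) ^ K := mul_pow _ _ _
      _ ≤ ell D ^ K * (K * q ^ ((1:ℝ) / K)) ^ K := by gcongr
      _ = _ := by rw [e3]
  have hp : 0 < ell N ^ K := by positivity
  have hp' : 0 < ell D ^ K := by positivity
  have hkk : 0 < (K:ℝ) ^ K := by positivity
  rw [le_div_iff₀ hp]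
  calc 1 / (K:ℝ) ^ K * (D / ell D ^ K) * ell N ^ K ≤ 1 / (K:ℝ) ^ K * (D / ell D ^ K) * (ell D ^ K * ((K:ℝ) ^ K * q)) := by gcongr
    _ = D * q := by field_simp
    _ = N := by rw [hq]; field_simp

lemma CL.isStr {l : List P} (h : CL l) : IsStr {x | x ∈ l} :=
  ⟨by obtain ⟨u, v, h⟩ := h; exact ⟨u, h.left_mem⟩, fun _ hx _ hy => h.conn hx hy⟩

lemma bic_disj {ι : Type*} {w : ι → List P} {t : ℕ} (h : Bic w (2 * t)) :
    ∃ A B : Finset ι, Disjoint A B ∧ t ≤ A.card ∧ t ≤ B.card ∧ ∀ a ∈ A, ∀ b ∈ B, HitL (w a) (w b) := by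
  classical
  obtain ⟨A, B, h1, h2, h3⟩ := h
  obtain ⟨A', hA', hc⟩ := Finset.exists_subset_card_eq (show t ≤ A.card by omega)
  refine ⟨A', B \ A', Finset.disjoint_sdiff, hc.ge, ?_, fun a ha b hb => h3 a (hA' ha) b (Finset.mem_sdiff.1 hb).1⟩
  have := Finset.le_card_sdiff A' B
  omega

theorem string_thm : ∃ c : ℝ, 0 < c ∧ ∃ K : ℕ, ∀ (ι : Type) [Fintype ι] (w : ι → List P) (D : ℝ),
    (∀ i, CL (w i)) → 3200 ≤ D → 0 < Fintype.card ι →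
    2 * D * Fintype.card ι ≤ eo (fun i => {x | x ∈ w i}) Finset.univ →
    ∃ A B : Finset ι, Disjoint A B ∧ c * (D / ell D ^ K) ≤ A.card ∧ c * (D / ell D ^ K) ≤ B.card ∧
      ∀ a ∈ A, ∀ b ∈ B, HitL (w a) (w b) := by
  classical
  obtain ⟨K, hK⟩ : ∃ K : ℕ, K = 10241 := ⟨_, rfl⟩
  obtain ⟨c1, hc1⟩ : ∃ c1 : ℝ, c1 = ((1 / 10 ^ 14) ^ 16 / 2 ^ 31) ^ 64 / 2 ^ 160 := ⟨_, rfl⟩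
  have c1pos : 0 < c1 := by rw [hc1]; positivity
  have hK1 : 1 ≤ K := by omega
  refine ⟨c1 / 4 * (1 / (K:ℝ) ^ K), by positivity, K, ?_⟩
  intro ι _ w D hw hD hne he
  obtain ⟨V, hV1, hV2⟩ := to_dense (S := fun i => {x | x ∈ w i}) (fun i => (hw i).isStr) D hD hne he
  have hNR : (0:ℝ) < V.card := by linarith
  have hN : 0 < V.card := by exact_mod_cast hNR
  have hl := one_lt_ell hNR.le
  suffices hmain : ∃ A B : Finset ι, Disjoint A B ∧ c1 / 4 * (V.card / ell V.card ^ K) ≤ A.card ∧ c1 / 4 * (V.card / ell V.card ^ K) ≤ B.card ∧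
      ∀ a ∈ A, ∀ b ∈ B, HitL (w a) (w b) by
    obtain ⟨A, B, h0, h1, h2, h3⟩ := hmain
    have := ratio_bound K hK1 (by linarith) hV1
    have hh : c1 / 4 * (1 / (K:ℝ) ^ K) * (D / ell D ^ K) ≤ c1 / 4 * (V.card / ell V.card ^ K) := by
      rw [mul_assoc]; gcongr
    exact ⟨A, B, h0, hh.trans h1, hh.trans h2, h3⟩
  set y := c1 / 2 * (V.card / ell V.card ^ K) with hy
  have ypos : 0 < y := by positivity
  have hy2 : c1 / 4 * (V.card / ell V.card ^ K) = y / 2 := by rw [hy]; ring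
  rw [hy2]
  by_cases hy1 : y < 1
  · -- a single pair
    have : 0 < eo (fun i => {x | x ∈ w i}) (Finset.univ : Finset ι) := by
      have : (0:ℝ) < 2 * D * Fintype.card ι := by
        have : (0:ℝ) < Fintype.card ι := by exact_mod_cast hne
        have : 0 < D := by linarith
        positivity
      exact_mod_cast this.trans_le he
    unfold eo at this
    obtain ⟨q, hq⟩ := Finset.card_pos.1 this
    rw [Finset.mem_filter, mem_hp] at hq
    refine ⟨{q.1}, {q.2}, by simpa using hq.2, by simp; linarith, by simp; linarith, ?_⟩
    intro a ha b hb
    rw [Finset.mem_singleton] at ha hb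
    subst ha hb
    exact hq.1.2
  push Not at hy1
  set t' := ⌊y⌋₊ with ht'
  have ht1 : 1 ≤ t' := Nat.le_floor (by simpa using hy1)
  have ht2 : (t':ℝ) ≤ y := Nat.floor_le ypos.le
  have ht3 : y / 2 ≤ t' := by
    have := Nat.lt_floor_add_one y
    have h1 : (1:ℝ) ≤ t' := by exact_mod_cast ht1
    rw [← ht'] at this
    linarith
  haveI : Nonempty V := by
    obtain ⟨v, hv⟩ := Finset.card_pos.1 hN
    exact ⟨⟨v, hv⟩⟩
  have hB : Bic (fun i : V => w i) (2 * t') := by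
    refine Dthm (N := V.card) (d := 1 / (10 ^ 14 * ell V.card ^ 10)) (by simp) (by positivity) ?_ (by omega) hN (fun i => hw i) ?_ ?_
    · rw [div_le_one (by positivity)]
      have : 1 ≤ ell V.card ^ 10 := one_le_pow₀ hl.le
      linarith
    · have e : ((1 / (10 ^ 14 * ell V.card ^ 10)) ^ 16 / 2 ^ 31) ^ 64 / 2 ^ 160 = c1 / (ell V.card ^ 10240) := by
        rw [hc1]
        have : ((1 / (10 ^ 14 * ell V.card ^ 10)) ^ 16 / 2 ^ 31) = ((1 / 10 ^ 14) ^ 16 / 2 ^ 31) * (1 / ell V.card ^ 160) := by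
          rw [one_div, one_div, mul_inv, mul_pow, inv_pow (ell _ ^ 10), ← pow_mul]; ring
        rw [this, mul_pow, one_div_pow (ell _ ^ 160), ← pow_mul]
        ring
      rw [e]
      have hle : ell (V.card : ℝ) ^ K = ell V.card ^ 10240 * ell V.card := by rw [hK, pow_succ]
      have h10 : 0 < ell (V.card:ℝ) ^ 10240 := by positivity
      calc ((2 * t' : ℕ) : ℝ) * ell V.card ≤ 2 * y * ell V.card := by push_cast; gcongr
        _ = _ := by
          rw [hy, hle]; field_simp
    · have h1 : (V.card:ℝ) ^ 2 * (1 / (10 ^ 14 * ell V.card ^ 10)) ≤ (hp (fun i => {x | x ∈ w i}) V).card := by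
        rw [mul_one_div, div_le_iff₀ (by positivity)]; linarith
      rw [mul_comm]
      refine h1.trans ?_
      norm_cast
      have : hp (fun i => {x | x ∈ w i}) V ⊆ (hc Finset.univ Finset.univ (fun i : V => w i) (fun i : V => w i)).image
          (fun q => ((q.1 : ι), (q.2 : ι))) := by
        rintro ⟨i, j⟩ hq
        rw [mem_hp] at hq
        exact Finset.mem_image.2 ⟨(⟨i, hq.1.1⟩, ⟨j, hq.1.2⟩), mem_hc.2 ⟨⟨Finset.mem_univ _, Finset.mem_univ _⟩, hq.2⟩, rfl⟩
      exact (Finset.card_le_card this).trans Finset.card_image_le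
  obtain ⟨A, B, h0, h1, h2, h3⟩ := bic_disj hB
  refine ⟨A.map (Function.Embedding.subtype _), B.map (Function.Embedding.subtype _), ?_, ?_, ?_, ?_⟩
  · rw [Finset.disjoint_map]; exact h0
  · rw [Finset.card_map]; exact ht3.trans (by exact_mod_cast h1)
  · rw [Finset.card_map]; exact ht3.trans (by exact_mod_cast h2)
  · intro a ha b hb
    obtain ⟨a', ha', rfl⟩ := Finset.mem_map.1 ha
    obtain ⟨b', hb', rfl⟩ := Finset.mem_map.1 hb
    exact h3 a' ha' b' hb'
end
end CBP

namespace CBP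
section

lemma cover_walk {S : Set P} (hS : ∀ x ∈ S, ∀ y ∈ S, Conn S x y) (T : Finset P) (hT : ∀ x ∈ T, x ∈ S) {a : P} (ha : a ∈ S) :
    ∃ b l, Wk a b l ∧ (∀ x ∈ l, x ∈ S) ∧ ∀ x ∈ T, x ∈ l := by
  classical
  induction T using Finset.induction_on with
  | empty => exact ⟨a, [a], Wk.nil a, by simpa using ha, by simp⟩
  | insert x T hx ih =>
    obtain ⟨b, l, h1, h2, h3⟩ := ih (fun y hy => hT y (Finset.mem_insert_of_mem hy))
    obtain ⟨l', h4, h5⟩ := hS b (h2 b h1.right_mem) x (hT x (Finset.mem_insert_self _ _))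
    refine ⟨x, _, h1.append h4, ?_, ?_⟩
    · intro y hy
      rcases List.mem_append.1 hy with h | h
      · exact h2 y h
      · exact h5 y (List.mem_of_mem_tail h)
    · intro y hy
      rcases Finset.mem_insert.1 hy with rfl | h
      · exact (h1.append h4).right_mem
      · exact List.mem_append_left _ (h3 y h)

noncomputable def rho (h : ℝ) (x : ℝ × ℝ) : P := (⌊x.1 / h⌋, ⌊x.2 / h⌋)

def box (h : ℝ) (F : Set (ℝ × ℝ)) : Set P :=
  {p | ∃ x ∈ F, |p.1 - (rho h x).1| ≤ 1 ∧ |p.2 - (rho h x).2| ≤ 1}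

lemma rho_mem {h : ℝ} {F : Set (ℝ × ℝ)} {x : ℝ × ℝ} (hx : x ∈ F) : rho h x ∈ box h F := ⟨x, hx, by simp, by simp⟩

lemma step_conn {S : Set P} {a b a' : ℤ} (h : |a' - a| ≤ 1) (h1 : (a, b) ∈ S) (h2 : (a', b) ∈ S) : Conn S (a, b) (a', b) := by
  rw [abs_le] at h
  rcases (show a' = a ∨ a' = a + 1 ∨ a = a' + 1 by omega) with rfl | h | h
  · exact Conn.refl h1
  · exact Conn.adj h1 h2 (by unfold LAdj; simp; omega)
  · exact Conn.adj h1 h2 (by unfold LAdj; simp; omega)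

lemma step_conn' {S : Set P} {a b b' : ℤ} (h : |b' - b| ≤ 1) (h1 : (a, b) ∈ S) (h2 : (a, b') ∈ S) : Conn S (a, b) (a, b') := by
  rw [abs_le] at h
  rcases (show b' = b ∨ b' = b + 1 ∨ b = b' + 1 by omega) with rfl | h | h
  · exact Conn.refl h1
  · exact Conn.adj h1 h2 (by unfold LAdj; simp; omega)
  · exact Conn.adj h1 h2 (by unfold LAdj; simp; omega)

lemma box_conn {h : ℝ} {F : Set (ℝ × ℝ)} {x : ℝ × ℝ} (hx : x ∈ F) {p : P} (h1 : |p.1 - (rho h x).1| ≤ 1) (h2 : |p.2 - (rho h x).2| ≤ 1) :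
    Conn (box h F) (rho h x) p := by
  have m : (p.1, (rho h x).2) ∈ box h F := ⟨x, hx, h1, by simp⟩
  have a1 : Conn (box h F) ((rho h x).1, (rho h x).2) (p.1, (rho h x).2) := step_conn h1 (rho_mem hx) m
  have a2 : Conn (box h F) (p.1, (rho h x).2) (p.1, p.2) := step_conn' h2 m ⟨x, hx, h1, h2⟩
  exact a1.trans a2

lemma floor_near {h a b : ℝ} (hh : 0 < h) (hab : |a - b| < h) : |⌊b / h⌋ - ⌊a / h⌋| ≤ 1 := by
  rw [abs_lt] at hab
  have h1 : b / h < a / h + 1 := by rw [div_add_one hh.ne']; gcongr; linarith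
  have h2 : a / h < b / h + 1 := by rw [div_add_one hh.ne']; gcongr; linarith
  have := Int.floor_le (a / h)
  have := Int.floor_le (b / h)
  have := Int.lt_floor_add_one (a / h)
  have := Int.lt_floor_add_one (b / h)
  rw [abs_le]
  constructor
  · have : ((⌊a / h⌋ : ℤ) : ℝ) < ((⌊b / h⌋ + 2 : ℤ) : ℝ) := by push_cast; linarith
    have := Int.cast_lt.1 this
    omega
  · have : ((⌊b / h⌋ : ℤ) : ℝ) < ((⌊a / h⌋ + 2 : ℤ) : ℝ) := by push_cast; linarith
    have := Int.cast_lt.1 this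
    omega

lemma box_isConn {h : ℝ} (hh : 0 < h) {F : Set (ℝ × ℝ)} (hF : IsPreconnected F) :
    ∀ p ∈ box h F, ∀ q ∈ box h F, Conn (box h F) p q := by
  have key : ∀ x ∈ F, ∀ y ∈ F, Conn (box h F) (rho h x) (rho h y) := by
    intro x hx y hy
    refine hF.induction₂ (fun x y => Conn (box h F) (rho h x) (rho h y)) ?_ ?_ ?_ hx hy
    · intro x hx
      filter_upwards [self_mem_nhdsWithin, mem_nhdsWithin_of_mem_nhds (Metric.ball_mem_nhds x hh)] with y hy hy'
      rw [Metric.mem_ball, Prod.dist_eq, max_lt_iff, Real.dist_eq, Real.dist_eq] at hy'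
      refine box_conn hx (floor_near hh ?_) (floor_near hh ?_)
      · rw [abs_sub_comm]; exact hy'.1
      · rw [abs_sub_comm]; exact hy'.2
    · intro x y z _ _ _ h1 h2; exact h1.trans h2
    · intro x y _ _ h1; exact h1.symm
  rintro p ⟨x, hx, h1, h2⟩ q ⟨y, hy, h3, h4⟩
  exact (box_conn hx h1 h2).symm.trans ((key x hx y hy).trans (box_conn hy h3 h4))

lemma box_finite {h : ℝ} (hh : 0 < h) {F : Set (ℝ × ℝ)} (hF : IsCompact F) : (box h F).Finite := by
  obtain ⟨M, hM⟩ := hF.isBounded.subset_closedBall 0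
  refine (Set.finite_Icc ((⌊-M / h⌋ - 1, ⌊-M / h⌋ - 1) : P) (⌊M / h⌋ + 1, ⌊M / h⌋ + 1)).subset ?_
  rintro p ⟨x, hx, h1, h2⟩
  have := hM hx
  rw [Metric.mem_closedBall, dist_zero_right, Prod.norm_def, max_le_iff, Real.norm_eq_abs, Real.norm_eq_abs, abs_le, abs_le] at this
  rw [abs_le] at h1 h2
  simp only [rho] at h1 h2
  have a1 : ⌊x.1 / h⌋ ≤ ⌊M / h⌋ := Int.floor_le_floor (by gcongr; exact this.1.2)
  have a2 : ⌊x.2 / h⌋ ≤ ⌊M / h⌋ := Int.floor_le_floor (by gcongr; exact this.2.2)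
  have a3 : ⌊-M / h⌋ ≤ ⌊x.1 / h⌋ := Int.floor_le_floor (by gcongr; exact this.1.1)
  have a4 : ⌊-M / h⌋ ≤ ⌊x.2 / h⌋ := Int.floor_le_floor (by gcongr; exact this.2.1)
  refine ⟨⟨?_, ?_⟩, ⟨?_, ?_⟩⟩ <;> simp only <;> omega

lemma floor_far {h a b : ℝ} (hh : 0 < h) {p : ℤ} (h1 : |p - ⌊a / h⌋| ≤ 1) (h2 : |p - ⌊b / h⌋| ≤ 1) : |a - b| < 3 * h := by
  rw [abs_le] at h1 h2
  have e1 := Int.floor_le (a / h)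
  have e2 := Int.floor_le (b / h)
  have e3 := Int.lt_floor_add_one (a / h)
  have e4 := Int.lt_floor_add_one (b / h)
  have f1 : (⌊a / h⌋ : ℝ) ≤ ⌊b / h⌋ + 2 := by exact_mod_cast (by omega : ⌊a / h⌋ ≤ ⌊b / h⌋ + 2)
  have f2 : (⌊b / h⌋ : ℝ) ≤ ⌊a / h⌋ + 2 := by exact_mod_cast (by omega : ⌊b / h⌋ ≤ ⌊a / h⌋ + 2)
  have g1 : a / h * h = a := by field_simp
  have g2 : b / h * h = b := by field_simp
  rw [abs_lt]
  constructor <;> nlinarith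

theorem disc {κ : Type*} [Finite κ] (F : κ → Set (ℝ × ℝ)) (h1 : ∀ k, IsCompact (F k)) (h2 : ∀ k, IsPreconnected (F k))
    (h3 : ∀ k, (F k).Nonempty) :
    ∃ ρ : ℝ × ℝ → P, ∃ w : κ → List P, (∀ k, CL (w k)) ∧ (∀ k, ∀ x ∈ F k, ρ x ∈ w k) ∧
      ∀ k k', HitL (w k) (w k') → (F k ∩ F k').Nonempty := by
  have hpair : ∀ q : κ × κ, ∃ ε : ℝ, 0 < ε ∧ (Disjoint (F q.1) (F q.2) → ∀ x ∈ F q.1, ∀ y ∈ F q.2, ε ≤ dist x y) := by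
    intro q
    by_cases hd : Disjoint (F q.1) (F q.2)
    · obtain ⟨r, hr, h⟩ := Metric.exists_pos_forall_lt_edist (h1 q.1) (h1 q.2).isClosed hd
      refine ⟨r, by exact_mod_cast hr, fun _ x hx y hy => ?_⟩
      have := h x hx y hy
      rw [edist_nndist] at this
      have h' : r < nndist x y := by exact_mod_cast this
      rw [← coe_nndist]; exact_mod_cast h'.le
    · exact ⟨1, one_pos, fun h => absurd h hd⟩
  choose e he he' using hpair
  obtain ⟨ε, hε, hε'⟩ : ∃ ε : ℝ, 0 < ε ∧ ∀ q, ε ≤ e q := by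
    cases nonempty_fintype κ
    by_cases hne : Nonempty (κ × κ)
    · obtain ⟨q0, hq0⟩ := Finite.exists_min e
      exact ⟨e q0, he q0, hq0⟩
    · exact ⟨1, one_pos, fun q => absurd ⟨q⟩ hne⟩
  set h := ε / 10 with hh
  have hpos : 0 < h := by positivity
  have hcov : ∀ k, ∃ l, CL l ∧ ∀ x, x ∈ l ↔ x ∈ box h (F k) := by
    intro k
    obtain ⟨x0, hx0⟩ := h3 k
    have hf := box_finite hpos (h1 k)
    obtain ⟨b, l, g1, g2, g3⟩ := cover_walk (box_isConn hpos (h2 k)) hf.toFinset (fun x hx => hf.mem_toFinset.1 hx) (rho_mem hx0)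
    exact ⟨l, ⟨_, _, g1⟩, fun x => ⟨g2 x, fun hx => g3 x (hf.mem_toFinset.2 hx)⟩⟩
  choose w hw1 hw2 using hcov
  refine ⟨rho h, w, hw1, fun k x hx => (hw2 k _).2 (rho_mem hx), ?_⟩
  rintro k k' ⟨p, hp1, hp2⟩
  by_contra hdis
  have hd : Disjoint (F k) (F k') := by
    rw [Set.disjoint_iff_inter_eq_empty]; exact Set.not_nonempty_iff_eq_empty.1 hdis
  obtain ⟨x, hx, a1, a2⟩ := (hw2 k p).1 hp1
  obtain ⟨y, hy, b1, b2⟩ := (hw2 k' p).1 hp2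
  have c1 := he' (k, k') hd x hx y hy
  have c2 := hε' (k, k')
  have d1 := floor_far hpos a1 b1
  have d2 := floor_far hpos a2 b2
  have : dist x y < 3 * h := by
    rw [Prod.dist_eq, max_lt_iff, Real.dist_eq, Real.dist_eq]; exact ⟨d1, d2⟩
  linarith
end
end CBP

namespace CBP
section

lemma trim {f : ℝ → ℝ × ℝ} (hf : ContinuousOn f (Set.Icc 0 1)) {p q : ℝ × ℝ} (h0 : f 0 = p) (h1 : f 1 = q) (hpq : p ≠ q) :
    ∃ a b : ℝ, 0 ≤ a ∧ a < b ∧ b ≤ 1 ∧ f a = p ∧ f b = q ∧ ∀ t ∈ Set.Ioo a b, f t ≠ p ∧ f t ≠ q := by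
  have c1 : IsCompact (Set.Icc (0:ℝ) 1 ∩ f ⁻¹' {q}) :=
    isCompact_Icc.of_isClosed_subset (hf.preimage_isClosed_of_isClosed isClosed_Icc isClosed_singleton) Set.inter_subset_left
  obtain ⟨b, ⟨hb, hbq⟩, hbmin⟩ := c1.exists_isLeast ⟨1, by simp, by simp [h1]⟩
  have hfb : ContinuousOn f (Set.Icc 0 b) := hf.mono (Set.Icc_subset_Icc_right hb.2)
  have c2 : IsCompact (Set.Icc (0:ℝ) b ∩ f ⁻¹' {p}) :=
    isCompact_Icc.of_isClosed_subset (hfb.preimage_isClosed_of_isClosed isClosed_Icc isClosed_singleton) Set.inter_subset_left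
  obtain ⟨a, ⟨ha, hap⟩, hamax⟩ := c2.exists_isGreatest ⟨0, by simp [hb.1], by simp [h0]⟩
  have hap : f a = p := hap
  have hbq : f b = q := hbq
  refine ⟨a, b, ha.1, lt_of_le_of_ne ha.2 ?_, hb.2, hap, hbq, ?_⟩
  · rintro rfl; exact hpq (hap.symm.trans hbq)
  · intro t ht
    refine ⟨fun h => ?_, fun h => ?_⟩
    · have := hamax ⟨⟨ha.1.trans ht.1.le, ht.2.le⟩, h⟩
      linarith [ht.1]
    · have := hbmin ⟨⟨ha.1.trans ht.1.le, ht.2.le.trans hb.2⟩, h⟩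
      linarith [ht.2]

lemma fin_sub {f : ℝ → ℝ × ℝ} {a b : ℝ} (hab : a < b) (F : Set (ℝ × ℝ)) (hF : F.Finite) (h : F ⊆ f '' Set.Ioo a b) :
    ∃ a' b', a < a' ∧ a' ≤ b' ∧ b' < b ∧ F ⊆ f '' Set.Icc a' b' := by
  induction F, hF using Set.Finite.induction_on with
  | empty => exact ⟨(a + b) / 2, (a + b) / 2, by linarith, le_rfl, by linarith, by simp⟩
  | @insert x s hx hs ih =>
    obtain ⟨a', b', h1, h2, h3, h4⟩ := ih (fun y hy => h (Set.mem_insert_of_mem _ hy))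
    obtain ⟨t, ht, rfl⟩ := h (Set.mem_insert _ _)
    refine ⟨min a' t, max b' t, lt_min h1 ht.1, (min_le_left _ _).trans (h2.trans (le_max_left _ _)), max_lt h3 ht.2, ?_⟩
    rintro y (rfl | hy)
    · exact ⟨t, ⟨min_le_right _ _, le_max_right _ _⟩, rfl⟩
    · obtain ⟨r, hr, rfl⟩ := h4 hy
      exact ⟨r, ⟨(min_le_left _ _).trans hr.1, hr.2.trans (le_max_left _ _)⟩, rfl⟩

theorem geom {V : Type} [Fintype V] (T : TopologicalGraph V) [DecidableRel T.G.Adj] (hn : 0 < Fintype.card V)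
    (h4 : 4 * Fintype.card V ≤ T.G.edgeFinset.card) :
    ∃ K : T.G.edgeFinset → Set (ℝ × ℝ), (∀ e, IsCompact (K e)) ∧ (∀ e, IsPreconnected (K e)) ∧ (∀ e, (K e).Nonempty) ∧
      (∀ e e', e ≠ e' → (K e ∩ K e').Nonempty → T.CrossesE e e') ∧
      (8 * Fintype.card V ≤ T.G.edgeFinset.card → ∃ S : Finset (T.G.edgeFinset × T.G.edgeFinset),
        (∀ q ∈ S, q.1 ≠ q.2 ∧ (K q.1 ∩ K q.2).Nonempty) ∧
        T.G.edgeFinset.card ^ 3 ≤ 512 * Fintype.card V ^ 2 * S.card) ∧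
      ∃ e e' : T.G.edgeFinset, e ≠ e' ∧ T.CrossesE e e' := by
  set ι := T.G.edgeFinset with hι
  classical
  set o : ι → V × V := fun e => Quot.out (e : Sym2 V) with ho
  have hoe : ∀ e : ι, (e : Sym2 V) = s((o e).1, (o e).2) := fun e => (Quot.out_eq (e : Sym2 V)).symm
  have hadj : ∀ e : ι, T.G.Adj (o e).1 (o e).2 := by
    intro e
    have := e.2
    rw [SimpleGraph.mem_edgeFinset, hoe e, SimpleGraph.mem_edgeSet] at this
    exact this
  have oinj : Function.Injective o := by
    intro e e' h
    apply Subtype.ext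
    rw [hoe e, hoe e', h]
  have hspec := fun e => T.arc_spec _ _ (hadj e)
  choose f hf hf0 hf1 hfa using hspec
  have htrim := fun e => trim (hf e) (hf0 e) (hf1 e) (fun h => (hadj e).ne (T.pos_inj h))
  choose a b ha hab hb hfa' hfb' hopen using htrim
  have hsub : ∀ e, Set.Icc (a e) (b e) ⊆ Set.Icc 0 1 := fun e => Set.Icc_subset_Icc (ha e) (hb e)
  set A : ι → Set (ℝ × ℝ) := fun e => f e '' Set.Icc (a e) (b e) with hA
  have hAarc : ∀ e, A e ⊆ T.arc (o e).1 (o e).2 := by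
    intro e; rw [hfa e]; exact Set.image_mono (hsub e)
  -- independent intersection points are inside the open arcs
  have hInt : ∀ e e', Ind (o e) (o e') → A e ∩ A e' ⊆ f e '' Set.Ioo (a e) (b e) := by
    rintro e e' ⟨i1, i2, i3, i4⟩ x ⟨⟨t, ht, rfl⟩, hx'⟩
    have hav := T.arc_avoid _ _ (hadj e')
    refine ⟨t, ⟨lt_of_le_of_ne ht.1 ?_, lt_of_le_of_ne ht.2 ?_⟩, rfl⟩
    · intro h
      rw [← h, hfa' e] at hx'
      exact hav _ i1 i2 (hAarc e' hx')
    · intro h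
      rw [h, hfb' e] at hx'
      exact hav _ i3 i4 (hAarc e' hx')
  -- chosen intersection points
  have hx : ∀ q : ι × ι, ∃ x, (A q.1 ∩ A q.2).Nonempty → x ∈ A q.1 ∩ A q.2 := by
    intro q
    by_cases h : (A q.1 ∩ A q.2).Nonempty
    · exact ⟨h.some, fun _ => h.some_mem⟩
    · exact ⟨(0, 0), fun h' => absurd h' h⟩
  choose x hx using hx
  set good : ι → ι → Prop := fun e e' => Ind (o e) (o e') ∧ (A e ∩ A e').Nonempty with hgood
  have hgs : ∀ e e', good e e' → good e' e := fun e e' h => ⟨h.1.symm, by rw [Set.inter_comm]; exact h.2⟩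
  set Fs : ι → Set (ℝ × ℝ) := fun e => (⋃ e' ∈ {e' | good e e'}, {x (e, e'), x (e', e)}) with hFs
  have hFfin : ∀ e, (Fs e).Finite := fun e => Set.Finite.biUnion (Set.toFinite _) (fun _ _ => Set.toFinite _)
  have hFsub : ∀ e, Fs e ⊆ f e '' Set.Ioo (a e) (b e) := by
    intro e y hy
    simp only [hFs, Set.mem_iUnion] at hy
    obtain ⟨e', he', hy⟩ := hy
    have he' : good e e' := he'
    rcases hy with rfl | hy
    · exact hInt e e' he'.1 (hx (e, e') he'.2)
    · rw [Set.mem_singleton_iff] at hy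
      subst hy
      have := hx (e', e) (hgs _ _ he').2
      exact hInt e e' he'.1 ⟨this.2, this.1⟩
  have hK := fun e => fin_sub (hab e) (Fs e) (hFfin e) (hFsub e)
  choose a' b' ha' hab' hb' hFK using hK
  set K : ι → Set (ℝ × ℝ) := fun e => f e '' Set.Icc (a' e) (b' e) with hKdef
  have hsub' : ∀ e, Set.Icc (a' e) (b' e) ⊆ Set.Ioo (a e) (b e) := fun e t ht => ⟨(ha' e).trans_le ht.1, ht.2.trans_lt (hb' e)⟩
  have hcont : ∀ e, ContinuousOn (f e) (Set.Icc (a' e) (b' e)) :=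
    fun e => (hf e).mono ((hsub' e).trans (Set.Ioo_subset_Icc_self.trans (hsub e)))
  have hKarc : ∀ e, K e ⊆ T.arc (o e).1 (o e).2 := fun e =>
    (Set.image_mono ((hsub' e).trans Set.Ioo_subset_Icc_self)).trans (hAarc e)
  have hgoodK : ∀ e e', good e e' → (K e ∩ K e').Nonempty := by
    intro e e' h
    refine ⟨x (e, e'), hFK e ?_, hFK e' ?_⟩
    · simp only [hFs, Set.mem_iUnion]
      exact ⟨e', h, by simp⟩
    · simp only [hFs, Set.mem_iUnion]
      exact ⟨e, hgs _ _ h, by simp⟩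
  have hcross : ∀ e e', e ≠ e' → (K e ∩ K e').Nonempty → T.CrossesE e e' := by
    rintro e e' hne ⟨y, hy, hy'⟩
    refine ⟨_, _, _, _, hoe e, hoe e', y, ⟨hKarc e hy, hKarc e' hy'⟩, ?_⟩
    rintro w hw - rfl
    obtain ⟨t, ht, hty⟩ := hy
    have := hopen e t (hsub' e ht)
    rcases hw with rfl | rfl
    · exact this.1 hty
    · exact this.2 hty
  -- the lattice drawing of the trimmed arcs
  have hAcont : ∀ e, ContinuousOn (f e) (Set.Icc (a e) (b e)) := fun e => (hf e).mono (hsub e)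
  obtain ⟨ρ, w, hw1, hw2, hw3⟩ := disc A (fun e => isCompact_Icc.image_of_continuousOn (hAcont e))
    (fun e => isPreconnected_Icc.image _ (hAcont e)) (fun e => ⟨_, a e, ⟨le_rfl, (hab e).le⟩, rfl⟩)
  set E : Finset (V × V) := Finset.univ.image o with hE
  have hEcard : E.card = ι.card := by
    rw [hE, Finset.card_image_of_injective _ oinj, Finset.card_univ, Fintype.card_coe]
  set W : V × V → Set P := fun q => {y | ∃ e, o e = q ∧ y ∈ w e} with hW
  have hWo : ∀ e, W (o e) = {y | y ∈ w e} := by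
    intro e
    ext y
    constructor
    · rintro ⟨e', h, hy⟩; rw [oinj h] at hy; exact hy
    · intro hy; exact ⟨e, rfl, hy⟩
  have e1 : ∀ q ∈ E, q.1 ≠ q.2 := by
    intro q hq
    obtain ⟨e, -, rfl⟩ := Finset.mem_image.1 hq
    exact (hadj e).ne
  have e2 : ∀ q ∈ E, (q.2, q.1) ∉ E := by
    intro q hq hq'
    obtain ⟨e, -, rfl⟩ := Finset.mem_image.1 hq
    obtain ⟨e', -, h⟩ := Finset.mem_image.1 hq'
    have : e = e' := by
      apply Subtype.ext
      rw [hoe e, hoe e', h]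
      exact Sym2.eq_swap
    subst this
    have := congrArg Prod.fst h
    exact (hadj e).ne this
  have e3 : ∀ q ∈ E, Conn (W q) (ρ (T.pos q.1)) (ρ (T.pos q.2)) := by
    intro q hq
    obtain ⟨e, -, rfl⟩ := Finset.mem_image.1 hq
    rw [hWo]
    refine (hw1 e).conn (hw2 e _ ⟨a e, ⟨le_rfl, (hab e).le⟩, hfa' e⟩) (hw2 e _ ⟨b e, ⟨(hab e).le, le_rfl⟩, hfb' e⟩)
  have hgd : ∀ e e', Ind (o e) (o e') → ¬ Disjoint (W (o e)) (W (o e')) → good e e' := by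
    intro e e' hi hd
    rw [Set.not_disjoint_iff] at hd
    obtain ⟨y, hy, hy'⟩ := hd
    rw [hWo] at hy hy'
    exact ⟨hi, hw3 e e' ⟨y, hy, hy'⟩⟩
  have hgne : ∀ e e', good e e' → e ≠ e' := by
    rintro e e' h rfl
    exact h.1.1 rfl
  refine ⟨K, fun e => isCompact_Icc.image_of_continuousOn (hcont e), fun e => isPreconnected_Icc.image _ (hcont e),
    fun e => ⟨_, a' e, ⟨le_rfl, hab' e⟩, rfl⟩, hcross, ?_, ?_⟩
  · intro h8
    have := crossing_lemma (p := fun v => ρ (T.pos v)) e1 e2 e3 hn (by rw [hEcard]; exact h8)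
    rw [hEcard] at this
    refine ⟨Finset.univ.filter (fun q : ι × ι => q.1 ≠ q.2 ∧ (K q.1 ∩ K q.2).Nonempty),
      fun q hq => (Finset.mem_filter.1 hq).2, ?_⟩
    refine this.trans (Nat.mul_le_mul_left _ ?_)
    have hs : crs E W ⊆ (Finset.univ.filter (fun q : ι × ι => q.1 ≠ q.2 ∧ (K q.1 ∩ K q.2).Nonempty)).image (fun q => (o q.1, o q.2)) := by
      rintro ⟨q, q'⟩ hq
      obtain ⟨⟨h1, h2⟩, h3, h4⟩ := mem_crs.1 hq
      obtain ⟨e, -, rfl⟩ := Finset.mem_image.1 h1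
      obtain ⟨e', -, rfl⟩ := Finset.mem_image.1 h2
      have hg := hgd e e' h3 h4
      exact Finset.mem_image.2 ⟨(e, e'), Finset.mem_filter.2 ⟨Finset.mem_univ _, hgne _ _ hg, hgoodK _ _ hg⟩, rfl⟩
    exact (Finset.card_le_card hs).trans Finset.card_image_le
  · by_contra hno
    push Not at hno
    have : Nonempty V := Fintype.card_pos_iff.1 hn
    have := PL_free (p := fun v => ρ (T.pos v)) (U := Finset.univ) e1 e2 e3 (fun _ _ => ⟨Finset.mem_univ _, Finset.mem_univ _⟩) (by
      intro q hq q' hq' hi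
      by_contra hd
      obtain ⟨e, -, rfl⟩ := Finset.mem_image.1 hq
      obtain ⟨e', -, rfl⟩ := Finset.mem_image.1 hq'
      have hg := hgd e e' hi hd
      exact hno e e' (hgne _ _ hg) (hcross e e' (hgne _ _ hg) (hgoodK _ _ hg))) Finset.univ_nonempty
    rw [hEcard, Finset.card_univ] at this
    omega
end
end CBP

namespace CBP
section

lemma final_arith {c x : ℝ} {K M : ℕ} (hc : 0 < c) (hx : 2000 ≤ x) (hM : 1024 * 2 ^ K / c ≤ 2 ^ M) :
    x ^ 2 / Real.logb 2 x ^ (K + M) ≤ c * (x ^ 2 / 1024 / ell (x ^ 2 / 1024) ^ K) := by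
  set L := Real.logb 2 x with hL
  have hx0 : 0 < x := by linarith
  have hL2 : 2 ≤ L := by
    rw [hL, Real.le_logb_iff_rpow_le (by norm_num) hx0]; norm_num; linarith
  have hl1 : 1 < ell (x ^ 2 / 1024) := one_lt_ell (by positivity)
  have hell : ell (x ^ 2 / 1024) ≤ 2 * L := by
    have h1 : ell (x ^ 2 / 1024) ≤ Real.log (x ^ 2) := by
      unfold ell
      refine Real.log_le_log (by positivity) ?_
      nlinarith
    have h2 : Real.log (x ^ 2) = 2 * Real.log x := by rw [Real.log_pow]; norm_num
    have h3 : Real.log x = L * Real.log 2 := by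
      rw [hL, Real.logb]; field_simp
    have := Real.log_two_lt_d9
    have h4 : L * Real.log 2 ≤ L * 1 := by gcongr; linarith
    linarith
  have hLM : 1024 * 2 ^ K / c ≤ L ^ M := hM.trans (by gcongr)
  rw [div_le_iff₀ hc] at hLM
  calc x ^ 2 / L ^ (K + M) = x ^ 2 / (L ^ K * L ^ M) := by rw [pow_add]
    _ ≤ c * (x ^ 2 / 1024 / (2 * L) ^ K) := by
      rw [mul_pow, div_le_iff₀ (by positivity)]
      have : c * (x ^ 2 / 1024 / (2 ^ K * L ^ K)) * (L ^ K * L ^ M) = x ^ 2 * (L ^ M * c) / (1024 * 2 ^ K) := by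
        field_simp
      rw [this, le_div_iff₀ (by positivity)]
      gcongr
    _ ≤ _ := by gcongr
end
lemma card_le_eo {ι : Type*} {S : ι → Set P} {V : Finset ι} {s : Finset (ι × ι)}
    (h : ∀ q ∈ s, q ∈ hp S V ∧ q.1 ≠ q.2) : s.card ≤ eo S V := by
  classical
  unfold eo
  refine Finset.card_le_card ?_
  intro q hq
  exact Finset.mem_filter.2 (h q hq)

end CBP
open CBP

/-- Every sufficiently dense topological graph contains a large crossing bipartite pattern. -/
theorem crossing_bipartite_pattern :
    ∃ c : ℝ, 0 < c ∧
      ∀ (V : Type) [Fintype V] (T : TopologicalGraph V) [DecidableRel T.G.Adj],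
        4 * Fintype.card V ≤ T.G.edgeFinset.card →
        ∃ E₁ E₂ : Finset (Sym2 V),
          ↑E₁ ⊆ T.G.edgeSet ∧ ↑E₂ ⊆ T.G.edgeSet ∧ Disjoint E₁ E₂ ∧
          (T.G.edgeFinset.card : ℝ) ^ 2 /
              ((Fintype.card V : ℝ) ^ 2 *
                (Real.logb 2 ((T.G.edgeFinset.card : ℝ) / (Fintype.card V : ℝ))) ^ c)
            ≤ E₁.card ∧
          (T.G.edgeFinset.card : ℝ) ^ 2 /
              ((Fintype.card V : ℝ) ^ 2 *
                (Real.logb 2 ((T.G.edgeFinset.card : ℝ) / (Fintype.card V : ℝ))) ^ c)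
            ≤ E₂.card ∧
          ∀ e ∈ E₁, ∀ e' ∈ E₂, T.CrossesE e e' := by
  obtain ⟨c, hc, K, hst⟩ := string_thm
  obtain ⟨M0, hM0⟩ := pow_unbounded_of_one_lt (1024 * 2 ^ K / c) (one_lt_two : (1:ℝ) < 2)
  obtain ⟨M, hM1, hM2⟩ : ∃ M : ℕ, 22 ≤ M ∧ 1024 * 2 ^ K / c ≤ 2 ^ M :=
    ⟨M0 + 22, by omega, hM0.le.trans (pow_le_pow_right₀ (by norm_num) (by omega))⟩
  refine ⟨((K + M : ℕ) : ℝ), by exact_mod_cast (by omega : 0 < K + M), ?_⟩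
  intro V _ T _ h4
  set m := T.G.edgeFinset.card with hm
  set n := Fintype.card V with hn
  rw [Real.rpow_natCast]
  rcases Nat.eq_zero_or_pos n with h0 | h0
  · refine ⟨∅, ∅, by simp, by simp, by simp, ?_, ?_, by simp⟩ <;> simp [h0]
  have hnR : (0:ℝ) < n := by exact_mod_cast h0
  set x : ℝ := (m:ℝ) / n with hx
  have hx4 : 4 ≤ x := by
    rw [hx, le_div_iff₀ hnR]; exact_mod_cast h4
  have hb : (m:ℝ) ^ 2 / ((n:ℝ) ^ 2 * Real.logb 2 x ^ (K + M)) = x ^ 2 / Real.logb 2 x ^ (K + M) := by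
    rw [hx, div_pow, div_div]
  rw [hb]
  obtain ⟨C, k1, k2, k3, k4, k5, e, e', hee, hcr⟩ := geom T h0 h4
  by_cases hbig : x < 2000
  · have hL2 : 2 ≤ Real.logb 2 x := by
      rw [Real.le_logb_iff_rpow_le (by norm_num) (by linarith)]; norm_num; linarith
    have h1 : x ^ 2 / Real.logb 2 x ^ (K + M) ≤ 1 := by
      rw [div_le_one (by positivity)]
      calc x ^ 2 ≤ 2000 ^ 2 := by gcongr
        _ ≤ 2 ^ 22 := by norm_num
        _ ≤ 2 ^ (K + M) := pow_le_pow_right₀ (by norm_num) (by omega)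
        _ ≤ _ := by gcongr
    refine ⟨{(e : Sym2 V)}, {(e' : Sym2 V)}, ?_, ?_, ?_, by simpa using h1, by simpa using h1, ?_⟩
    · rw [Finset.coe_singleton, Set.singleton_subset_iff]; exact SimpleGraph.mem_edgeFinset.1 e.2
    · rw [Finset.coe_singleton, Set.singleton_subset_iff]; exact SimpleGraph.mem_edgeFinset.1 e'.2
    · rw [Finset.disjoint_singleton]; exact fun h => hee (Subtype.ext h)
    · intro a ha b hb
      rw [Finset.mem_singleton] at ha hb
      subst ha hb; exact hcr
  push Not at hbig
  have hmx : (m:ℝ) = x * n := by rw [hx]; field_simp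
  have h8 : 8 * n ≤ m := by
    have : (8:ℝ) * n ≤ m := by rw [hmx]; gcongr; linarith
    exact_mod_cast this
  obtain ⟨S, hS1, hS2⟩ := k5 h8
  obtain ⟨ρ, w, hw1, hw2, hw3⟩ := disc C k1 k2 k3
  have hmpos : 0 < m := by omega
  have hmR : (0:ℝ) < m := by exact_mod_cast hmpos
  have hS3 : (m:ℝ) ^ 3 ≤ 512 * n ^ 2 * S.card := by exact_mod_cast hS2
  obtain ⟨A, B, hAB, hA, hB, hh⟩ := hst T.G.edgeFinset w (x ^ 2 / 1024) hw1 (by nlinarith) (by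
      rw [Fintype.card_coe]; exact hmpos) (by
      rw [Fintype.card_coe]
      have h1 : (S.card : ℝ) ≤ eo (fun i => {x | x ∈ w i}) Finset.univ := by
        refine Nat.cast_le.2 (card_le_eo ?_)
        intro q hq
        obtain ⟨h1, y, h2, h3⟩ := hS1 q hq
        rw [mem_hp]
        exact ⟨⟨⟨Finset.mem_univ _, Finset.mem_univ _⟩, ρ y, hw2 _ _ h2, hw2 _ _ h3⟩, h1⟩
      refine le_trans ?_ h1
      rw [← hm]
      have h2 : 2 * (x ^ 2 / 1024) * (m:ℝ) = (m:ℝ) ^ 3 / (512 * n ^ 2) := by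
        rw [hx]; field_simp; norm_num
      rw [h2, div_le_iff₀ (by positivity)]
      linarith)
  have hf := final_arith hc hbig hM2
  refine ⟨A.map (Function.Embedding.subtype _), B.map (Function.Embedding.subtype _), ?_, ?_, ?_, ?_, ?_, ?_⟩
  · intro z hz
    obtain ⟨a, -, rfl⟩ := Finset.mem_map.1 (Finset.mem_coe.1 hz)
    exact SimpleGraph.mem_edgeFinset.1 a.2
  · intro z hz
    obtain ⟨a, -, rfl⟩ := Finset.mem_map.1 (Finset.mem_coe.1 hz)
    exact SimpleGraph.mem_edgeFinset.1 a.2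
  · rw [Finset.disjoint_map]; exact hAB
  · rw [Finset.card_map]; exact hf.trans hA
  · rw [Finset.card_map]; exact hf.trans hB
  · intro a ha b hb
    obtain ⟨a', ha', rfl⟩ := Finset.mem_map.1 ha
    obtain ⟨b', hb', rfl⟩ := Finset.mem_map.1 hb
    refine k4 a' b' ?_ (hw3 a' b' (hh a' ha' b' hb'))
    rintro rfl
    exact Finset.disjoint_left.1 hAB ha' hb'
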